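/- In the bounded-degree uniform attachment process with m ≥ 2, fix a cycle length ℓ and a depth k, and let U_1, …, U_K be the non-complete max-admissible unicyclic graphs of depth k containing an ℓ-cycle. Then for every tuple (i_1, …, i_K) of non-negative integers there exists a constant c = c(i_1, …, i_K) ≥ 0 such that P( N_{U_1}(n) = i_1, …, N_{U_K}(n) = i_K ) → c as n → ∞, and the sum of c(i_1, …, i_K) over all tuples (i_1, …, i_K) of non-negative integers equals 1. -/

import Mathlib

open MeasureTheory ProbabilityTheory Filter Topology
open scoped ENNReal

/-- The degree of a vertex in a simple graph on `ℕ` (the number of its neighbours). -/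
noncomputable def graphDeg (g : SimpleGraph ℕ) (v : ℕ) : ℕ := (g.neighborSet v).ncard

/-- The complete graph on the vertex set `[m] = {1,…,m}`, viewed as a simple graph on `ℕ`. -/
def initGraph (m : ℕ) : SimpleGraph ℕ :=
  SimpleGraph.fromRel (fun a b => a ∈ Finset.Icc 1 m ∧ b ∈ Finset.Icc 1 m)

/-- The graph obtained from `g` by joining the (new) vertex `v` to every vertex of `S`. -/
def attachStep (g : SimpleGraph ℕ) (v : ℕ) (S : Finset ℕ) : SimpleGraph ℕ :=
  g ⊔ SimpleGraph.fromRel (fun a b => a = v ∧ b ∈ S)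

/-- The set of vertices of `[n] = {1,…,n}` whose degree in `g` is strictly less than `d`. -/
noncomputable def lowDegSet (d : ℕ) (g : SimpleGraph ℕ) (n : ℕ) : Finset ℕ :=
  (Finset.Icc 1 n).filter (fun v => graphDeg g v < d)

/-- `IsUAProcess m d μ G` says that `(G n)_{n ≥ m}` (as random graphs on `ℕ`, with `G n`
supported on the vertex set `[n] = {1,…,n}`) is the bounded-degree uniform attachment
process: `G m` is the complete graph on `[m]`, and `G (n+1)` is obtained from `G n` by
joining the new vertex `n+1` to a uniformly chosen `m`-element subset of the set of
vertices of `G n` of degree less than `d`, conditionally on `G n` and independently of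
the past (note that `G n` determines the whole past of the process). -/
def IsUAProcess (m d : ℕ) {Ω : Type*} [MeasurableSpace Ω] (μ : Measure Ω)
    (G : ℕ → Ω → SimpleGraph ℕ) : Prop :=
  (∀ n g, MeasurableSet {ω | G n ω = g}) ∧
  (∀ ω, G m ω = initGraph m) ∧
  (∀ n, m ≤ n → ∀ g : SimpleGraph ℕ, ∀ S : Finset ℕ,
    S ⊆ lowDegSet d g n → S.card = m →
    μ ({ω | G (n + 1) ω = attachStep g (n + 1) S} ∩ {ω | G n ω = g})
      = μ {ω | G n ω = g} / (((lowDegSet d g n).card.choose m : ℝ≥0∞)))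

/-- The graphs on `ℕ` reachable by the bounded-degree uniform attachment process at time
`n`. -/
inductive UAReachable (m d : ℕ) : ℕ → SimpleGraph ℕ → Prop
  | init : UAReachable m d m (initGraph m)
  | step {n : ℕ} {g : SimpleGraph ℕ} {S : Finset ℕ} :
      m ≤ n → UAReachable m d n g → S ⊆ lowDegSet d g n → S.card = m →
      UAReachable m d (n + 1) (attachStep g (n + 1) S)

/-- A graph is unicyclic if it is connected and contains exactly one cycle; for a finite
graph this means connected with as many edges as vertices. -/
def IsUnicyclic {t : ℕ} (U : SimpleGraph (Fin t)) : Prop :=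
  U.Connected ∧ U.edgeSet.ncard = t

/-- The set of vertices lying on some cycle of `U` (in a unicyclic graph, the vertex set of
its unique cycle). -/
def cycleVerts {V : Type*} (U : SimpleGraph V) : Set V :=
  {v : V | ∃ c : U.Walk v v, c.IsCycle}

/-- `U` contains a cycle of length `ℓ`. -/
def HasCycleOfLength {V : Type*} (U : SimpleGraph V) (ℓ : ℕ) : Prop :=
  ∃ v : V, ∃ c : U.Walk v v, c.IsCycle ∧ c.length = ℓ

/-- A unicyclic graph has depth `k` if the disjoint trees growing from its cycle all have
depth exactly `k`: every vertex is at distance at most `k` from the cycle, and from each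
cycle vertex `v` there is a vertex `w` of the tree growing from `v` (i.e. whose nearest
cycle vertex is `v`) at distance exactly `k` from `v`. -/
def UnicyclicDepth {V : Type*} (U : SimpleGraph V) (k : ℕ) : Prop :=
  (∀ w : V, ∃ v ∈ cycleVerts U, U.dist v w ≤ k) ∧
  (∀ v ∈ cycleVerts U, ∃ w : V, U.dist v w = k ∧
    ∀ u ∈ cycleVerts U, U.dist v w ≤ U.dist u w)

/-- A unicyclic graph is complete (w.r.t. the degree bound `d`) if all its non-leaf vertices
(vertices of degree at least `2`) have degree `d`. -/
def UnicyclicComplete {V : Type*} (U : SimpleGraph V) (d : ℕ) : Prop :=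
  ∀ v : V, 2 ≤ (U.neighborSet v).ncard → (U.neighborSet v).ncard = d

/-- `H` is a maximal unicyclic subgraph of `g`: it is finite, connected and unicyclic, and
every non-leaf vertex of `H` is adjacent in `g` only to vertices of `H`. -/
def IsMaxUnicyclicSubgraph (g : SimpleGraph ℕ) (H : g.Subgraph) : Prop :=
  H.verts.Finite ∧ H.coe.Connected ∧ H.edgeSet.ncard = H.verts.ncard ∧
  ∀ u ∈ H.verts, 2 ≤ (H.neighborSet u).ncard → ∀ w : ℕ, g.Adj u w → w ∈ H.verts

/-- `N_U(n)`: the number of maximal unicyclic subgraphs of `g` isomorphic to `U`. -/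
noncomputable def unicyclicCount (g : SimpleGraph ℕ) {t : ℕ} (U : SimpleGraph (Fin t)) : ℕ :=
  {H : g.Subgraph | IsMaxUnicyclicSubgraph g H ∧ Nonempty (U ≃g H.coe)}.ncard

/-- A unicyclic graph is max-admissible if it occurs as a maximal unicyclic subgraph of a
possible value of `G_n` for all sufficiently large `n`. -/
def MaxAdmissibleUnicyclic (m d : ℕ) {t : ℕ} (U : SimpleGraph (Fin t)) : Prop :=
  ∃ N : ℕ, ∀ n : ℕ, N ≤ n → ∃ g : SimpleGraph ℕ, UAReachable m d n g ∧
    1 ≤ unicyclicCount g U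

namespace UA

open scoped Classical

section

lemma attach_adj {g : SimpleGraph ℕ} {v a b : ℕ} {S : Finset ℕ} :
    (attachStep g v S).Adj a b ↔
      g.Adj a b ∨ (a ≠ b ∧ (a = v ∧ b ∈ S ∨ b = v ∧ a ∈ S)) := by
  simp [attachStep, SimpleGraph.fromRel_adj]

lemma mem_lowDegSet {d n x : ℕ} {g : SimpleGraph ℕ} :
    x ∈ lowDegSet d g n ↔ (1 ≤ x ∧ x ≤ n) ∧ graphDeg g x < d := by
  simp [lowDegSet]

lemma reach_le {m d n : ℕ} {g : SimpleGraph ℕ} (h : UAReachable m d n g) : m ≤ n := by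
  induction h with
  | init => exact le_rfl
  | step h _ _ _ _ => omega

lemma reach_adj {m d n : ℕ} {g : SimpleGraph ℕ} (h : UAReachable m d n g) {a b : ℕ}
    (hab : g.Adj a b) : (1 ≤ a ∧ a ≤ n) ∧ (1 ≤ b ∧ b ≤ n) := by
  induction h generalizing a b with
  | init =>
    simp only [initGraph, SimpleGraph.fromRel_adj, Finset.mem_Icc] at hab
    omega
  | step h _ hS _ ih =>
    rcases attach_adj.1 hab with h1 | ⟨-, ⟨rfl, h1⟩ | ⟨rfl, h1⟩⟩
    · have := ih h1; omega
    · have := (mem_lowDegSet.1 (hS h1)).1; omega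
    · have := (mem_lowDegSet.1 (hS h1)).1; omega

lemma reach_neighborSet {m d n : ℕ} {g : SimpleGraph ℕ} (h : UAReachable m d n g) (x : ℕ) :
    g.neighborSet x = ((Finset.Icc 1 n).filter (g.Adj x) : Finset ℕ) := by
  ext y
  simp only [SimpleGraph.mem_neighborSet, Finset.coe_filter, Finset.mem_Icc, Set.mem_ofPred_eq]
  exact ⟨fun hy => ⟨(reach_adj h hy).2, hy⟩, fun hy => hy.2⟩

lemma reach_deg {m d n : ℕ} {g : SimpleGraph ℕ} (h : UAReachable m d n g) (x : ℕ) :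
    graphDeg g x = ((Finset.Icc 1 n).filter (g.Adj x)).card := by
  rw [graphDeg, reach_neighborSet h, Set.ncard_coe_finset]

lemma reach_finite {m d n : ℕ} {g : SimpleGraph ℕ} (h : UAReachable m d n g) (x : ℕ) :
    (g.neighborSet x).Finite := by
  rw [reach_neighborSet h]; exact Finset.finite_toSet _

lemma reach_deg_eq_zero {m d n : ℕ} {g : SimpleGraph ℕ} (h : UAReachable m d n g) {x : ℕ}
    (hx : ¬ (1 ≤ x ∧ x ≤ n)) : graphDeg g x = 0 := by
  rw [reach_deg h, Finset.card_eq_zero, Finset.filter_eq_empty_iff]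
  intro y _ hxy
  exact hx (reach_adj h hxy).1

lemma deg_attach_old {m d n : ℕ} {g : SimpleGraph ℕ} {S : Finset ℕ} (h : UAReachable m d n g)
    {x : ℕ} (hx : x ≠ n + 1) :
    graphDeg (attachStep g (n + 1) S) x = graphDeg g x + if x ∈ S then 1 else 0 := by
  have hfin := reach_finite h x
  by_cases hxS : x ∈ S
  · have : (attachStep g (n + 1) S).neighborSet x = insert (n + 1) (g.neighborSet x) := by
      ext y
      simp only [SimpleGraph.mem_neighborSet, attach_adj, Set.mem_insert_iff]
      constructor
      · rintro (h1 | ⟨-, ⟨h1, -⟩ | ⟨h1, -⟩⟩)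
        · exact Or.inr h1
        · exact absurd h1 hx
        · exact Or.inl h1
      · rintro (rfl | h1)
        · exact Or.inr ⟨hx, Or.inr ⟨rfl, hxS⟩⟩
        · exact Or.inl h1
    rw [graphDeg, this, Set.ncard_insert_of_notMem _ hfin, if_pos hxS, graphDeg]
    intro hmem
    have := (reach_adj h hmem).2
    omega
  · have : (attachStep g (n + 1) S).neighborSet x = g.neighborSet x := by
      ext y
      simp only [SimpleGraph.mem_neighborSet, attach_adj]
      constructor
      · rintro (h1 | ⟨-, ⟨h1, -⟩ | ⟨-, h1⟩⟩)
        · exact h1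
        · exact absurd h1 hx
        · exact absurd h1 hxS
      · exact Or.inl
    rw [graphDeg, this, if_neg hxS, graphDeg, add_zero]

lemma deg_attach_new {m d n : ℕ} {g : SimpleGraph ℕ} {S : Finset ℕ} (h : UAReachable m d n g)
    (hS : S ⊆ lowDegSet d g n) :
    graphDeg (attachStep g (n + 1) S) (n + 1) = S.card := by
  have : (attachStep g (n + 1) S).neighborSet (n + 1) = S := by
    ext y
    simp only [SimpleGraph.mem_neighborSet, attach_adj, Finset.mem_coe]
    constructor
    · rintro (h1 | ⟨h0, ⟨-, h1⟩ | ⟨h1, -⟩⟩)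
      · have := (reach_adj h h1).1
        omega
      · exact h1
      · exact absurd h1.symm h0
    · intro hy
      have := (mem_lowDegSet.1 (hS hy)).1
      exact Or.inr ⟨by omega, Or.inl ⟨trivial, hy⟩⟩
  rw [graphDeg, this, Set.ncard_coe_finset]

lemma sum_Icc_succ {M : Type*} [AddCommMonoid M] (f : ℕ → M) (n : ℕ) :
    ∑ x ∈ Finset.Icc 1 (n + 1), f x = ∑ x ∈ Finset.Icc 1 n, f x + f (n + 1) :=
  Finset.sum_Icc_succ_top (by omega) f

lemma init_deg {m x : ℕ} (hx : 1 ≤ x ∧ x ≤ m) : graphDeg (initGraph m) x + 1 = m := by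
  rw [reach_deg (UAReachable.init (d := 0))]
  have : (Finset.Icc 1 m).filter ((initGraph m).Adj x) = (Finset.Icc 1 m).erase x := by
    ext y
    simp only [initGraph, SimpleGraph.fromRel_adj, Finset.mem_filter, Finset.mem_Icc,
      Finset.mem_erase]
    constructor
    · rintro ⟨h1, h2, -⟩
      exact ⟨h2.symm, h1⟩
    · rintro ⟨h1, h2⟩
      exact ⟨h2, h1.symm, Or.inl ⟨hx, h2⟩⟩
  rw [this, Finset.card_erase_of_mem (by simpa using hx)]
  simp
  omega

lemma reach_sum_deg {m d n : ℕ} {g : SimpleGraph ℕ} (h : UAReachable m d n g) :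
    ∑ x ∈ Finset.Icc 1 n, graphDeg g x + m * m + m = 2 * m * n := by
  induction h with
  | init =>
    have h1 : ∑ x ∈ Finset.Icc 1 m, graphDeg (initGraph m) x + ∑ x ∈ Finset.Icc 1 m, 1
        = ∑ x ∈ Finset.Icc 1 m, m := by
      rw [← Finset.sum_add_distrib]
      refine Finset.sum_congr rfl fun x hx => init_deg (by simpa using hx)
    simp at h1
    nlinarith
  | @step n g S h1 h2 h3 h4 ih =>
    rw [sum_Icc_succ, deg_attach_new h2 h3]
    have : ∑ x ∈ Finset.Icc 1 n, graphDeg (attachStep g (n + 1) S) x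
        = ∑ x ∈ Finset.Icc 1 n, graphDeg g x + m := by
      rw [← h4, Finset.card_eq_sum_ones, ← Finset.sum_filter_add_sum_filter_not (Finset.Icc 1 n)
        (fun x => x ∈ S) (fun x => graphDeg (attachStep g (n + 1) S) x)]
      have hs : (Finset.Icc 1 n).filter (fun x => x ∈ S) = S := by
        ext x
        simp only [Finset.mem_filter, Finset.mem_Icc, and_iff_right_iff_imp]
        intro hx
        exact (mem_lowDegSet.1 (h3 hx)).1
      rw [← Finset.sum_filter_add_sum_filter_not (Finset.Icc 1 n)
        (fun x => x ∈ S) (fun x => graphDeg g x), hs, add_right_comm, ← Finset.sum_add_distrib]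
      congr 1
      · refine Finset.sum_congr rfl fun x hx => ?_
        have := (mem_lowDegSet.1 (h3 hx)).1
        rw [deg_attach_old h2 (by omega), if_pos hx]
      · refine Finset.sum_congr rfl fun x hx => ?_
        simp only [Finset.mem_filter, Finset.mem_Icc] at hx
        rw [deg_attach_old h2 (by omega), if_neg hx.2, add_zero]
    rw [this, h4]
    nlinarith

lemma reach_deg_le {m d n : ℕ} {g : SimpleGraph ℕ} (hd : 2 * m < d) (h : UAReachable m d n g)
    (x : ℕ) : graphDeg g x ≤ d := by
  induction h generalizing x with
  | init =>
    by_cases hx : 1 ≤ x ∧ x ≤ m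
    · have := init_deg hx; omega
    · rw [reach_deg_eq_zero (UAReachable.init (d := d)) hx]; omega
  | @step n g S h1 h2 h3 h4 ih =>
    by_cases hx : x = n + 1
    · rw [hx, deg_attach_new h2 h3]; omega
    · rw [deg_attach_old h2 hx]
      split_ifs with hxS
      · have := (mem_lowDegSet.1 (h3 hxS)).2; omega
      · exact ih x

lemma reach_le_deg {m d n : ℕ} {g : SimpleGraph ℕ} (h : UAReachable m d n g)
    {x : ℕ} (hx : 1 ≤ x ∧ x ≤ n) : m ≤ graphDeg g x + 1 := by
  induction h generalizing x with
  | init => exact (init_deg hx).ge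
  | @step n g S h1 h2 h3 h4 ih =>
    by_cases hx' : x = n + 1
    · rw [hx', deg_attach_new h2 h3]; omega
    · rw [deg_attach_old h2 hx']
      have := @ih x (by omega)
      omega

lemma lowDegSet_card_le {d n : ℕ} {g : SimpleGraph ℕ} : (lowDegSet d g n).card ≤ n := by
  simpa [lowDegSet] using Finset.card_filter_le (Finset.Icc 1 n) (fun v => graphDeg g v < d)

lemma reach_low {m d n : ℕ} {g : SimpleGraph ℕ} (hd : 2 * m < d) (h : UAReachable m d n g) :
    (d - 2 * m) * n + (m * m + m) ≤ (d + 1 - m) * (lowDegSet d g n).card := by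
  have h1 := reach_sum_deg h
  have h2 : ∑ x ∈ Finset.Icc 1 n, (d + 1) ≤ ∑ x ∈ Finset.Icc 1 n, (graphDeg g x + 1) +
      ∑ x ∈ (Finset.Icc 1 n).filter (fun v => graphDeg g v < d), (d + 1 - m) := by
    rw [Finset.sum_filter, ← Finset.sum_add_distrib]
    refine Finset.sum_le_sum fun x hx => ?_
    have := reach_le_deg h (x := x) (by simpa using hx)
    split_ifs <;> omega
  simp only [Finset.sum_add_distrib] at h2
  simp only [Finset.sum_const, smul_eq_mul, Nat.card_Icc] at h2
  rw [show (Finset.Icc 1 n).filter (fun v => graphDeg g v < d) = lowDegSet d g n from rfl] at h2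
  simp only [Nat.add_sub_cancel, mul_one] at h2
  zify [show 2 * m ≤ d by omega, show m ≤ d + 1 by omega] at h1 h2 ⊢
  nlinarith

lemma le_lowDegSet_card {m d n : ℕ} {g : SimpleGraph ℕ} (hd : 2 * m < d)
    (h : UAReachable m d n g) : m ≤ (lowDegSet d g n).card := by
  have h1 := reach_low hd h
  have h2 := reach_le h
  have h3 : (d + 1 - m) * m ≤ (d - 2 * m) * n + (m * m + m) := by
    zify [show 2 * m ≤ d by omega, show m ≤ d + 1 by omega] at *
    nlinarith
  exact Nat.le_of_mul_le_mul_left (h3.trans h1) (by omega)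

lemma reach_le_deg' {m d n : ℕ} {g : SimpleGraph ℕ} (h : UAReachable m d n g)
    {x : ℕ} (hx : 1 ≤ x ∧ x ≤ n) (hn : m + 1 ≤ n) : m ≤ graphDeg g x := by
  induction h generalizing x with
  | init => omega
  | @step n g S h1 h2 h3 h4 ih =>
    by_cases hx' : x = n + 1
    · rw [hx', deg_attach_new h2 h3]; omega
    · rw [deg_attach_old h2 hx']
      by_cases hn' : m + 1 ≤ n
      · have := @ih x (by omega) hn'
        omega
      · have hmn : n = m := by omega
        have : S = Finset.Icc 1 n := by
          refine Finset.eq_of_subset_of_card_le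
            (h3.trans (Finset.filter_subset _ _)) ?_
          simp [h4, hmn]
        rw [if_pos (by rw [this]; simp; omega)]
        exact reach_le_deg h2 (by omega)

/-- A positive constant `κ` with `κ n ≤ |lowDegSet|`. -/
noncomputable def kap (m d : ℕ) : ℝ := ((d - 2 * m : ℕ) : ℝ) / ((d + 1 - m : ℕ) : ℝ)

lemma kap_pos {m d : ℕ} (hd : 2 * m < d) : 0 < kap m d := by
  unfold kap
  have h1 : (0 : ℝ) < ((d - 2 * m : ℕ) : ℝ) := by exact_mod_cast (by omega)
  have h2 : (0 : ℝ) < ((d + 1 - m : ℕ) : ℝ) := by exact_mod_cast (by omega)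
  positivity

lemma kap_mul_le {m d n : ℕ} {g : SimpleGraph ℕ} (hd : 2 * m < d) (h : UAReachable m d n g) :
    kap m d * n ≤ (lowDegSet d g n).card := by
  have h2 : (0 : ℝ) < ((d + 1 - m : ℕ) : ℝ) := by exact_mod_cast (by omega)
  rw [kap, div_mul_eq_mul_div, div_le_iff₀ h2, mul_comm ((lowDegSet d g n).card : ℝ)]
  exact_mod_cast (Nat.le_add_right _ _).trans (reach_low hd h)

end

section

/-- Average of `F` over the `m`-element subsets of `X`. -/
noncomputable def savg (X : Finset ℕ) (m : ℕ) (F : Finset ℕ → ℝ) : ℝ :=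
  (∑ S ∈ X.powersetCard m, F S) / (X.card.choose m)

lemma savg_mono {X : Finset ℕ} {m : ℕ} {F F' : Finset ℕ → ℝ}
    (h : ∀ S, S ⊆ X → S.card = m → F S ≤ F' S) : savg X m F ≤ savg X m F' := by
  unfold savg
  gcongr with S hS
  exact h S (Finset.mem_powersetCard.1 hS).1 (Finset.mem_powersetCard.1 hS).2

lemma savg_congr {X : Finset ℕ} {m : ℕ} {F F' : Finset ℕ → ℝ}
    (h : ∀ S, S ⊆ X → S.card = m → F S = F' S) : savg X m F = savg X m F' :=
  le_antisymm (savg_mono fun S h1 h2 => (h S h1 h2).le) (savg_mono fun S h1 h2 => (h S h1 h2).ge)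

lemma savg_const {X : Finset ℕ} {m : ℕ} (h : m ≤ X.card) (c : ℝ) : savg X m (fun _ => c) = c := by
  have : (0 : ℝ) < X.card.choose m := by exact_mod_cast Nat.choose_pos h
  rw [savg, Finset.sum_const, Finset.card_powersetCard, nsmul_eq_mul]
  field_simp

lemma savg_add (X : Finset ℕ) (m : ℕ) (F F' : Finset ℕ → ℝ) :
    savg X m (fun S => F S + F' S) = savg X m F + savg X m F' := by
  rw [savg, Finset.sum_add_distrib, add_div, savg, savg]

lemma savg_mul (X : Finset ℕ) (m : ℕ) (c : ℝ) (F : Finset ℕ → ℝ) :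
    savg X m (fun S => c * F S) = c * savg X m F := by
  rw [savg, ← Finset.mul_sum, mul_div_assoc, savg]

lemma savg_sub (X : Finset ℕ) (m : ℕ) (F F' : Finset ℕ → ℝ) :
    savg X m (fun S => F S - F' S) = savg X m F - savg X m F' := by
  rw [savg, Finset.sum_sub_distrib, sub_div, savg, savg]

lemma savg_sum {ι : Type*} (X : Finset ℕ) (m : ℕ) (s : Finset ι) (F : ι → Finset ℕ → ℝ) :
    savg X m (fun S => ∑ i ∈ s, F i S) = ∑ i ∈ s, savg X m (F i) := by
  simp only [savg]
  rw [Finset.sum_comm, Finset.sum_div]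

/-- One step of the process, as an operator on functions of graphs. -/
noncomputable def stepL (m d n : ℕ) : (SimpleGraph ℕ → ℝ) →ₗ[ℝ] (SimpleGraph ℕ → ℝ) where
  toFun f g := savg (lowDegSet d g n) m (fun S => f (attachStep g (n + 1) S))
  map_add' f f' := by ext g; exact savg_add _ _ _ _
  map_smul' c f := by ext g; exact savg_mul _ _ _ _

lemma stepL_apply (m d n : ℕ) (f : SimpleGraph ℕ → ℝ) (g : SimpleGraph ℕ) :
    stepL m d n f g = savg (lowDegSet d g n) m (fun S => f (attachStep g (n + 1) S)) := rfl

/-- Transition operator from time `T` to time `n`. -/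
noncomputable def kerL (m d T : ℕ) : ℕ → (SimpleGraph ℕ → ℝ) →ₗ[ℝ] (SimpleGraph ℕ → ℝ)
  | 0 => LinearMap.id
  | n + 1 => if T ≤ n then (kerL m d T n).comp (stepL m d n) else LinearMap.id

lemma kerL_of_le {m d T n : ℕ} (h : n ≤ T) : kerL m d T n = LinearMap.id := by
  cases n with
  | zero => rfl
  | succ n => rw [kerL, if_neg (by omega)]

lemma kerL_succ {m d T n : ℕ} (h : T ≤ n) (f : SimpleGraph ℕ → ℝ) :
    kerL m d T (n + 1) f = kerL m d T n (stepL m d n f) := by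
  rw [kerL, if_pos h]; rfl

/-- Expectation functionals of the attachment process run from time `T`. -/
structure Chain (m d T : ℕ) (E : ℕ → (SimpleGraph ℕ → ℝ) →ₗ[ℝ] ℝ) : Prop where
  mono : ∀ n, T ≤ n → ∀ f f' : SimpleGraph ℕ → ℝ,
    (∀ g, UAReachable m d n g → f g ≤ f' g) → E n f ≤ E n f'
  one : ∀ n, T ≤ n → E n (fun _ => 1) = 1
  step : ∀ n, T ≤ n → ∀ f, E (n + 1) f = E n (stepL m d n f)

/-- The expectation functionals of the process started from `g0` at time `T`. -/
noncomputable def evE (m d T : ℕ) (g0 : SimpleGraph ℕ) (n : ℕ) :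
    (SimpleGraph ℕ → ℝ) →ₗ[ℝ] ℝ :=
  (LinearMap.proj g0).comp (kerL m d T n)

lemma evE_apply (m d T : ℕ) (g0 : SimpleGraph ℕ) (n : ℕ) (f : SimpleGraph ℕ → ℝ) :
    evE m d T g0 n f = kerL m d T n f g0 := rfl

lemma chain_evE {m d T : ℕ} {g0 : SimpleGraph ℕ} (hd : 2 * m < d) (h : UAReachable m d T g0) :
    Chain m d T (evE m d T g0) where
  mono n hn := by
    induction n, hn using Nat.le_induction with
    | base =>
      intro f f' hf
      simp only [evE_apply, kerL_of_le le_rfl]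
      exact hf g0 h
    | succ n hn ih =>
      intro f f' hf
      simp only [evE_apply, kerL_succ hn]
      refine ih _ _ fun g hg => savg_mono fun S h1 h2 => hf _ ?_
      exact UAReachable.step (reach_le hg) hg h1 h2
  one n hn := by
    induction n, hn using Nat.le_induction with
    | base => simp only [evE_apply, kerL_of_le le_rfl]; rfl
    | succ n hn ih =>
      simp only [evE_apply, kerL_succ hn] at ih ⊢
      have key : ∀ n, T ≤ n → ∀ f f' : SimpleGraph ℕ → ℝ,
          (∀ g, UAReachable m d n g → f g = f' g) → kerL m d T n f g0 = kerL m d T n f' g0 := by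
        intro n hn
        induction n, hn using Nat.le_induction with
        | base =>
          intro f f' hf
          simp only [kerL_of_le le_rfl]
          exact hf g0 h
        | succ n hn ih =>
          intro f f' hf
          simp only [kerL_succ hn]
          refine ih _ _ fun g hg => savg_congr fun S h1 h2 => hf _ ?_
          exact UAReachable.step (reach_le hg) hg h1 h2
      refine (key n hn _ _ fun g hg => ?_).trans ih
      rw [stepL_apply, savg_const (le_lowDegSet_card hd hg)]
  step n hn f := by simp only [evE_apply, kerL_succ hn]

namespace Chain
variable {m d T : ℕ} {E : ℕ → (SimpleGraph ℕ → ℝ) →ₗ[ℝ] ℝ}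

lemma congr (hE : Chain m d T E) {n : ℕ} (hn : T ≤ n) {f f' : SimpleGraph ℕ → ℝ}
    (h : ∀ g, UAReachable m d n g → f g = f' g) : E n f = E n f' :=
  le_antisymm (hE.mono n hn _ _ fun g hg => (h g hg).le)
    (hE.mono n hn _ _ fun g hg => (h g hg).ge)

lemma const (hE : Chain m d T E) {n : ℕ} (hn : T ≤ n) (c : ℝ) : E n (fun _ => c) = c := by
  have := (E n).map_smul c (fun _ => 1)
  rw [hE.one n hn] at this
  simpa [Pi.smul_def] using this

lemma nonneg (hE : Chain m d T E) {n : ℕ} (hn : T ≤ n) {f : SimpleGraph ℕ → ℝ}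
    (h : ∀ g, UAReachable m d n g → 0 ≤ f g) : 0 ≤ E n f := by
  have := hE.mono n hn (fun _ => 0) f h
  rwa [hE.const hn] at this

lemma abs_le (hE : Chain m d T E) {n : ℕ} (hn : T ≤ n) {f f' : SimpleGraph ℕ → ℝ}
    (h : ∀ g, UAReachable m d n g → |f g| ≤ f' g) : |E n f| ≤ E n f' := by
  rw [_root_.abs_le]
  refine ⟨?_, hE.mono n hn _ _ fun g hg => (_root_.abs_le.1 (h g hg)).2⟩
  rw [← map_neg]
  exact hE.mono n hn _ _ fun g hg => (_root_.abs_le.1 (h g hg)).1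

lemma semigroup (hE : Chain m d T E) {T' n : ℕ} (h1 : T ≤ T') (hn : T' ≤ n)
    (f : SimpleGraph ℕ → ℝ) : E n f = E T' (kerL m d T' n f) := by
  induction n, hn using Nat.le_induction generalizing f with
  | base => rw [kerL_of_le le_rfl]; rfl
  | succ n hn ih => rw [hE.step n (h1.trans hn), ih, kerL_succ hn]

end Chain

lemma finite_reachable (m d n : ℕ) : {g | UAReachable m d n g}.Finite := by
  induction n with
  | zero =>
    refine (Set.finite_singleton (initGraph m)).subset fun g hg => ?_
    cases hg
    rfl
  | succ n ih =>
    refine ((Set.finite_singleton (initGraph m)).union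
      (Set.Finite.image2 (fun g S => attachStep g (n + 1) S) ih
        (Finset.finite_toSet (Finset.Icc 1 n).powerset))).subset ?_
    intro g hg
    cases hg with
    | init => left; rfl
    | @step _ g S h1 h2 h3 h4 =>
      right
      refine ⟨g, h2, S, ?_, rfl⟩
      rw [Finset.mem_coe, Finset.mem_powerset]
      exact h3.trans (Finset.filter_subset _ _)

/-- The finite set of graphs reachable at time `n`. -/
noncomputable def reachSet (m d n : ℕ) : Finset (SimpleGraph ℕ) := (finite_reachable m d n).toFinset

lemma mem_reachSet {m d n : ℕ} {g : SimpleGraph ℕ} : g ∈ reachSet m d n ↔ UAReachable m d n g := by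
  simp [reachSet]

lemma Chain.eq_sum {m d T : ℕ} {E : ℕ → (SimpleGraph ℕ → ℝ) →ₗ[ℝ] ℝ} (hE : Chain m d T E)
    {n : ℕ} (hn : T ≤ n) (f : SimpleGraph ℕ → ℝ) :
    E n f = ∑ g ∈ reachSet m d n, f g * E n (fun g' => if g' = g then 1 else 0) := by
  have : ∀ g ∈ reachSet m d n, f g * E n (fun g' => if g' = g then 1 else 0)
      = E n (f g • fun g' => if g' = g then 1 else 0) := by
    intro g _
    rw [map_smul, smul_eq_mul]
  rw [Finset.sum_congr rfl this, ← map_sum]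
  refine hE.congr hn fun g hg => ?_
  simp only [Finset.sum_apply, Pi.smul_apply, smul_eq_mul, mul_ite, mul_one, mul_zero]
  rw [Finset.sum_ite_eq, if_pos (mem_reachSet.2 hg)]

lemma attach_injective {m d n : ℕ} {g : SimpleGraph ℕ} (h : UAReachable m d n g) {S S' : Finset ℕ}
    (hS : S ⊆ lowDegSet d g n) (hS' : S' ⊆ lowDegSet d g n)
    (he : attachStep g (n + 1) S = attachStep g (n + 1) S') : S = S' := by
  have key : ∀ S, S ⊆ lowDegSet d g n → ∀ y, (attachStep g (n + 1) S).Adj (n + 1) y ↔ y ∈ S := by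
    intro S hS y
    rw [attach_adj]
    constructor
    · rintro (h1 | ⟨h0, ⟨-, h1⟩ | ⟨h1, -⟩⟩)
      · have := (reach_adj h h1).1
        omega
      · exact h1
      · exact absurd h1.symm h0
    · intro hy
      have := (mem_lowDegSet.1 (hS hy)).1
      exact Or.inr ⟨by omega, Or.inl ⟨rfl, hy⟩⟩
  ext y
  rw [← key S hS, he, key S' hS']

section link
variable {m d : ℕ} {Ω : Type*} [MeasurableSpace Ω] {μ : Measure Ω} [IsProbabilityMeasure μ]
  {G : ℕ → Ω → SimpleGraph ℕ}

lemma link_of_lower {A : Set Ω} {a b : ℝ} (hb : 0 ≤ b) (hab : a + b = 1)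
    (h1 : ∃ B, MeasurableSet B ∧ B ⊆ A ∧ μ B = ENNReal.ofReal a)
    (h2 : ∃ B, MeasurableSet B ∧ B ⊆ Aᶜ ∧ μ B = ENNReal.ofReal b) : μ A = ENNReal.ofReal a := by
  obtain ⟨B, -, hBA, hB⟩ := h1
  obtain ⟨B', hB'm, hBA', hB'⟩ := h2
  refine le_antisymm ?_ (hB ▸ measure_mono hBA)
  calc μ A ≤ μ B'ᶜ := measure_mono (Set.subset_compl_comm.1 hBA')
    _ = 1 - μ B' := by rw [measure_compl hB'm (measure_ne_top _ _), measure_univ]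
    _ = ENNReal.ofReal a := by
      rw [hB', ← ENNReal.ofReal_one, ← ENNReal.ofReal_sub _ hb]
      congr 1; linarith

lemma process_law (hd : 2 * m < d) (hG : IsUAProcess m d μ G) {n : ℕ} (hn : m ≤ n)
    (P : SimpleGraph ℕ → Prop) :
    μ {ω | P (G n ω)} =
      ENNReal.ofReal (evE m d m (initGraph m) n (fun g => if P g then 1 else 0)) := by
  obtain ⟨hmeas, hinit, htrans⟩ := hG
  have hE : Chain m d m (evE m d m (initGraph m)) := chain_evE hd UAReachable.init
  have hnn : ∀ n, m ≤ n → ∀ P : SimpleGraph ℕ → Prop,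
      0 ≤ evE m d m (initGraph m) n (fun g => if P g then 1 else 0) := fun n hn P =>
    hE.nonneg hn fun g _ => by split_ifs <;> norm_num
  have hlow : ∀ n, m ≤ n → (∀ P : SimpleGraph ℕ → Prop, ∃ B, MeasurableSet B ∧
      B ⊆ {ω | P (G n ω)} ∧ μ B =
        ENNReal.ofReal (evE m d m (initGraph m) n (fun g => if P g then 1 else 0))) →
      ∀ P : SimpleGraph ℕ → Prop, μ {ω | P (G n ω)} =
        ENNReal.ofReal (evE m d m (initGraph m) n (fun g => if P g then 1 else 0)) := by
    intro n hn h P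
    refine link_of_lower (hnn n hn fun g => ¬ P g) ?_ (h P) (h fun g => ¬ P g)
    rw [← map_add]
    refine Eq.trans (congrArg _ ?_) (hE.one n hn)
    ext g
    by_cases hg : P g <;> simp [hg]
  refine hlow n hn ?_ P
  clear P
  induction n, hn using Nat.le_induction with
  | base =>
    intro P
    rw [evE_apply, kerL_of_le le_rfl]
    by_cases hP : P (initGraph m)
    · exact ⟨Set.univ, MeasurableSet.univ, fun ω _ => by simpa [hinit ω] using hP, by simp [hP]⟩
    · exact ⟨∅, MeasurableSet.empty, Set.empty_subset _, by simp [hP]⟩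
  | succ n hn ih =>
    intro P
    have ih := hlow n hn ih
    let I : Finset ((_ : SimpleGraph ℕ) × Finset ℕ) := (reachSet m d n).sigma fun g =>
      ((lowDegSet d g n).powersetCard m).filter fun S => P (attachStep g (n + 1) S)
    let B : ((_ : SimpleGraph ℕ) × Finset ℕ) → Set Ω := fun x =>
      {ω | G (n + 1) ω = attachStep x.1 (n + 1) x.2} ∩ {ω | G n ω = x.1}
    have hBm : ∀ x, MeasurableSet (B x) := fun x => (hmeas _ _).inter (hmeas _ _)
    have hI : ∀ x ∈ I, UAReachable m d n x.1 ∧ x.2 ⊆ lowDegSet d x.1 n ∧ x.2.card = m ∧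
        P (attachStep x.1 (n + 1) x.2) := by
      intro x hx
      simp only [I, Finset.mem_sigma, mem_reachSet, Finset.mem_filter,
        Finset.mem_powersetCard] at hx
      tauto
    refine ⟨⋃ x ∈ I, B x, I.measurableSet_biUnion fun x _ => hBm x, ?_, ?_⟩
    · refine Set.iUnion₂_subset fun x hx ω hω => ?_
      have h1 : G (n + 1) ω = attachStep x.1 (n + 1) x.2 := hω.1
      simp only [Set.mem_ofPred_eq, h1]
      exact (hI x hx).2.2.2
    · rw [measure_biUnion_finset ?_ fun x _ => hBm x]
      · rw [Finset.sum_sigma, hE.step n hn, hE.eq_sum hn, ENNReal.ofReal_sum_of_nonneg]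
        · refine Finset.sum_congr rfl fun g hg => ?_
          have hgr := mem_reachSet.1 hg
          have hpos : (0 : ℝ) < (lowDegSet d g n).card.choose m := by
            exact_mod_cast Nat.choose_pos (le_lowDegSet_card hd hgr)
          have hμ := ih (fun g' => g' = g)
          have : ∀ S ∈ ((lowDegSet d g n).powersetCard m).filter
              (fun S => P (attachStep g (n + 1) S)), μ (B ⟨g, S⟩) =
              ENNReal.ofReal (evE m d m (initGraph m) n (fun g' => if g' = g then 1 else 0) /
                (lowDegSet d g n).card.choose m) := by
            intro S hS
            simp only [Finset.mem_filter, Finset.mem_powersetCard] at hS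
            rw [htrans n hn g S hS.1.1 hS.1.2, hμ, ENNReal.ofReal_div_of_pos hpos,
              ENNReal.ofReal_natCast]
          rw [Finset.sum_congr rfl this, Finset.sum_const, nsmul_eq_mul,
            ← ENNReal.ofReal_natCast, ← ENNReal.ofReal_mul (by positivity), stepL_apply, savg,
            Finset.sum_boole]
          congr 1
          ring
        · intro g hg
          refine mul_nonneg ?_ (hnn n hn _)
          have hgr := mem_reachSet.1 hg
          rw [stepL_apply]
          refine div_nonneg (Finset.sum_nonneg fun S _ => ?_) (by positivity)
          split_ifs <;> norm_num
      · rintro ⟨g, S⟩ hx ⟨g', S'⟩ hy hxy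
        rw [Function.onFun, Set.disjoint_left]
        rintro ω ⟨h1, h2⟩ ⟨h3, h4⟩
        simp only [Set.mem_ofPred_eq] at h1 h2 h3 h4
        obtain rfl : g = g' := h2.symm.trans h4
        have h5 := hI _ hx
        have h6 := hI _ hy
        obtain rfl : S = S' := attach_injective h5.1 h5.2.1 h6.2.1 (h1.symm.trans h3)
        exact hxy rfl

end link

end

section

/-- The probability that a uniform `m`-subset of an `L`-set contains `r` given points. -/
noncomputable def pr (m L r : ℕ) : ℝ := (m.descFactorial r : ℝ) / L.descFactorial r

lemma pr_nonneg (m L r : ℕ) : 0 ≤ pr m L r := by unfold pr; positivity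

lemma pr_le {m L : ℕ} (hmL : m ≤ L) (r : ℕ) : pr m L r ≤ ((m : ℝ) / L) ^ r := by
  induction r with
  | zero => simp [pr]
  | succ r ih =>
    rw [pr, Nat.descFactorial_succ, Nat.descFactorial_succ, Nat.cast_mul, Nat.cast_mul,
      mul_div_mul_comm, pow_succ']
    refine mul_le_mul ?_ ih (pr_nonneg m L r) (by positivity)
    rcases le_or_gt m r with h | h
    · rw [Nat.sub_eq_zero_of_le h]; simp; positivity
    · have h1 : (0 : ℝ) < ((L - r : ℕ) : ℝ) := by exact_mod_cast (by omega)
      have h2 : (0 : ℝ) < (L : ℝ) := by exact_mod_cast (by omega)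
      rw [div_le_div_iff₀ h1 h2, Nat.cast_sub h.le, Nat.cast_sub (by omega)]
      have : (m : ℝ) ≤ L := by exact_mod_cast hmL
      nlinarith [(Nat.cast_nonneg r : (0 : ℝ) ≤ r)]

lemma descFactorial_ratio {L : ℕ} (hL : 0 < L) {r : ℕ} (hr : r ≤ L) :
    1 - (r : ℝ) ^ 2 / L ≤ (L.descFactorial r : ℝ) / (L : ℝ) ^ r := by
  induction r with
  | zero => simp
  | succ r ih =>
    have ih := ih (by omega)
    have h2 : (0 : ℝ) < (L : ℝ) := by exact_mod_cast hL
    rw [Nat.descFactorial_succ, Nat.cast_mul, pow_succ' (L : ℝ), mul_div_mul_comm,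
      Nat.cast_sub (by omega)]
    have h3 : ((L : ℝ) - r) / L = 1 - r / L := by field_simp
    have h4 : (r : ℝ) / L ≤ 1 := by
      rw [div_le_one h2]; exact_mod_cast (by omega)
    have h5 : (0 : ℝ) ≤ r / L := by positivity
    have h6 : (0 : ℝ) ≤ (r : ℝ) ^ 2 / L := by positivity
    have h7 : ((r + 1 : ℕ) : ℝ) ^ 2 / L = (r : ℝ) ^ 2 / L + r / L + (r / L + 1 / L) := by
      push_cast; ring
    have h8 : (0 : ℝ) ≤ 1 / L := by positivity
    rw [h3, h7]
    nlinarith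

lemma pr_approx {m L : ℕ} (hm : 0 < m) (hmL : m ≤ L) (r : ℕ) :
    |pr m L r - (m.descFactorial r : ℝ) / (L : ℝ) ^ r| ≤ (m : ℝ) ^ r * r ^ 2 / (L : ℝ) ^ (r + 1) := by
  have hL : 0 < L := by omega
  have hL' : (0 : ℝ) < L := by exact_mod_cast hL
  rcases lt_or_ge m r with h | h
  · rw [pr, Nat.descFactorial_eq_zero_iff_lt.2 h]; simp; positivity
  · have h1 := descFactorial_ratio hL (h.trans hmL)
    have h2 : (0 : ℝ) < L.descFactorial r := by
      exact_mod_cast Nat.descFactorial_pos.2 (h.trans hmL)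
    have h3 : (L.descFactorial r : ℝ) / (L : ℝ) ^ r ≤ 1 := by
      rw [div_le_one (by positivity)]
      exact_mod_cast Nat.descFactorial_le_pow L r
    have h4 : pr m L r - (m.descFactorial r : ℝ) / (L : ℝ) ^ r =
        pr m L r * (1 - (L.descFactorial r : ℝ) / (L : ℝ) ^ r) := by
      rw [pr]; field_simp
    rw [h4, abs_of_nonneg (mul_nonneg (pr_nonneg _ _ _) (by linarith))]
    calc pr m L r * (1 - (L.descFactorial r : ℝ) / (L : ℝ) ^ r)
        ≤ ((m : ℝ) / L) ^ r * ((r : ℝ) ^ 2 / L) :=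
          mul_le_mul (pr_le hmL r) (by linarith) (by linarith) (by positivity)
      _ = _ := by rw [div_pow, div_mul_div_comm, pow_succ (L : ℝ)]

lemma savg_subset {X I : Finset ℕ} {m : ℕ} (hm : m ≤ X.card) (hI : I ⊆ X) :
    savg X m (fun S => if I ⊆ S then 1 else 0) = pr m X.card I.card := by
  rw [savg, Finset.sum_boole]
  rcases lt_or_ge m I.card with h | h
  · rw [pr, Nat.descFactorial_eq_zero_iff_lt.2 h, Finset.filter_eq_empty_iff.2]
    · simp
    · intro S hS hIS
      have := Finset.card_le_card hIS
      rw [(Finset.mem_powersetCard.1 hS).2] at this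
      omega
  · rw [Finset.card_filter_powersetCard_subset _ _ _ hI h, pr]
    have h1 : X.card.choose m * m.choose I.card =
        X.card.choose I.card * (X.card - I.card).choose (m - I.card) := Nat.choose_mul h
    have h2 : (0 : ℝ) < X.card.choose m := by exact_mod_cast Nat.choose_pos hm
    have h3 : (0 : ℝ) < X.card.choose I.card := by
      exact_mod_cast Nat.choose_pos (h.trans hm)
    rw [Nat.descFactorial_eq_factorial_mul_choose, Nat.descFactorial_eq_factorial_mul_choose]
    push_cast
    rw [mul_div_mul_left _ _ (by positivity), div_eq_div_iff h2.ne' h3.ne']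
    rw [mul_comm, mul_comm (m.choose I.card : ℝ)]
    exact_mod_cast h1.symm

lemma savg_le_of_subset {X I : Finset ℕ} {m : ℕ} (hm : m ≤ X.card) (p : Finset ℕ → Prop)
    [DecidablePred p] (hp : ∀ S, S ⊆ X → p S → I ⊆ S) :
    savg X m (fun S => if p S then 1 else 0) ≤ ((m : ℝ) / X.card) ^ I.card := by
  by_cases hI : I ⊆ X
  · rw [← ge_iff_le]
    calc ((m : ℝ) / X.card) ^ I.card ≥ pr m X.card I.card := pr_le hm _
      _ = _ := (savg_subset hm hI).symm
      _ ≥ _ := savg_mono fun S hS _ => by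
        by_cases h : p S
        · simp [h, hp S hS h]
        · simp only [h, if_false]; split_ifs <;> norm_num
  · calc _ ≤ savg X m (fun _ => 0) := savg_mono fun S hS _ => by
          rw [if_neg fun h => hI ((hp S hS h).trans hS)]
      _ = 0 := savg_const hm 0
      _ ≤ _ := by positivity

lemma savg_inter {X I B : Finset ℕ} {m : ℕ} (hm0 : 0 < m) (hm : m ≤ X.card) (hI : I ⊆ X)
    (hB : Disjoint I B) :
    |savg X m (fun S => if I ⊆ S ∧ Disjoint B S then 1 else 0) -
      (m.descFactorial I.card : ℝ) / (X.card : ℝ) ^ I.card| ≤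
      ((m : ℝ) ^ I.card * I.card ^ 2 + B.card * (m : ℝ) ^ (I.card + 1)) /
        (X.card : ℝ) ^ (I.card + 1) := by
  have h1 := pr_approx hm0 hm I.card
  have h2 : savg X m (fun S => if I ⊆ S ∧ Disjoint B S then 1 else 0) ≤ pr m X.card I.card := by
    rw [← savg_subset hm hI]
    refine savg_mono fun S _ _ => ?_
    by_cases h : I ⊆ S <;> by_cases h' : Disjoint B S <;> simp [h, h']
  have h3 : pr m X.card I.card - B.card * ((m : ℝ) / X.card) ^ (I.card + 1) ≤
      savg X m (fun S => if I ⊆ S ∧ Disjoint B S then 1 else 0) := by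
    have h4 : ∑ x ∈ B, savg X m (fun S => if insert x I ⊆ S then 1 else 0) ≤
        B.card * ((m : ℝ) / X.card) ^ (I.card + 1) := by
      rw [← nsmul_eq_mul]
      refine Finset.sum_le_card_nsmul _ _ _ fun x hx => ?_
      rw [← Finset.card_insert_of_notMem fun h => (Finset.disjoint_left.1 hB h hx)]
      exact savg_le_of_subset hm (fun S => _ ⊆ S) fun S _ h => h
    rw [← savg_subset hm hI]
    refine le_trans (sub_le_sub_left h4 _) ?_
    rw [← savg_sum, ← savg_sub]
    refine savg_mono fun S _ _ => ?_
    by_cases h : I ⊆ S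
    · by_cases h' : Disjoint B S
      · simp only [h, h', and_self, if_true, sub_le_self_iff]
        exact Finset.sum_nonneg fun x _ => by split_ifs <;> norm_num
      · simp only [h, h', and_false, if_true, if_false, sub_nonpos]
        obtain ⟨x, hxB, hxS⟩ := Finset.not_disjoint_iff.1 h'
        refine le_trans ?_ (Finset.single_le_sum (f := fun x => if insert x I ⊆ S then (1 : ℝ) else 0)
          (fun x _ => by positivity) hxB)
        simp [Finset.insert_subset_iff, hxS, h]
    · simp only [h, false_and, if_false, zero_sub, Left.neg_nonpos_iff]
      exact Finset.sum_nonneg fun x _ => by positivity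
  rw [add_div, mul_div_assoc (B.card : ℝ), ← div_pow]
  rw [abs_le] at h1 ⊢
  have : (0 : ℝ) ≤ B.card * ((m : ℝ) / X.card) ^ (I.card + 1) := by positivity
  constructor <;> linarith

lemma savg_card_inter {X B : Finset ℕ} {m : ℕ} (hm : m ≤ X.card) :
    savg X m (fun S => ((B ∩ S).card : ℝ)) = m * (B ∩ X).card / X.card := by
  have hk : ∀ S : Finset ℕ, ∑ x ∈ B, (if x ∈ S then (1 : ℝ) else 0) = ((B ∩ S).card : ℝ) := by
    intro S
    rw [Finset.sum_boole, Finset.filter_mem_eq_inter]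
  rw [show (fun S => ((B ∩ S).card : ℝ)) = fun S => ∑ x ∈ B, (if x ∈ S then (1 : ℝ) else 0) from
    funext fun S => (hk S).symm, savg_sum, ← Finset.sum_inter_add_sum_sdiff B X, Finset.sum_eq_card_nsmul (b := (m : ℝ) / X.card),
    Finset.sum_eq_zero]
  · rw [nsmul_eq_mul]; ring
  · intro x hx
    refine Eq.trans (savg_congr fun S hS _ => ?_) (savg_const hm 0)
    exact if_neg fun h => (Finset.mem_sdiff.1 hx).2 (hS h)
  · intro x hx
    have := savg_subset hm (Finset.singleton_subset_iff.2 (Finset.mem_inter.1 hx).2)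
    simpa [pr] using this

lemma savg_disjoint {X B : Finset ℕ} {m : ℕ} (hm : m ≤ X.card) :
    |savg X m (fun S => if Disjoint B S then 1 else 0) - (1 - m * (B ∩ X).card / X.card)| ≤
      (B.card : ℝ) ^ 2 * m ^ 2 / (X.card : ℝ) ^ 2 := by
  have h1 := savg_card_inter (B := B) hm
  have h2 : savg X m (fun S => ((B ∩ S).card : ℝ) * ((B ∩ S).card - 1)) ≤
      (B.card : ℝ) ^ 2 * m ^ 2 / (X.card : ℝ) ^ 2 := by
    have h3 : ∀ S : Finset ℕ, ((B ∩ S).card : ℝ) * ((B ∩ S).card - 1) =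
        ∑ x ∈ B.offDiag, if ({x.1, x.2} : Finset ℕ) ⊆ S then 1 else 0 := by
      intro S
      rw [Finset.sum_boole]
      have : B.offDiag.filter (fun x => ({x.1, x.2} : Finset ℕ) ⊆ S) = (B ∩ S).offDiag := by
        ext x
        simp only [Finset.mem_filter, Finset.mem_offDiag, Finset.insert_subset_iff,
          Finset.singleton_subset_iff, Finset.mem_inter]
        tauto
      rw [this, Finset.offDiag_card, Nat.cast_sub (Nat.le_mul_self _)]
      push_cast; ring
    simp only [h3]
    rw [savg_sum, mul_div_assoc, ← div_pow]
    refine (Finset.sum_le_card_nsmul _ _ (((m : ℝ) / X.card) ^ 2) fun x hx => ?_).trans ?_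
    · have hx := (Finset.mem_offDiag.1 hx).2.2
      rw [← Finset.card_pair hx]
      exact savg_le_of_subset hm (fun S => _ ⊆ S) fun S _ h => h
    · rw [nsmul_eq_mul]
      refine mul_le_mul_of_nonneg_right ?_ (by positivity)
      rw [Finset.offDiag_card, sq]
      exact_mod_cast Nat.sub_le _ _
  rw [← h1]
  have h4 : savg X m (fun S => (1 : ℝ) - (B ∩ S).card) = 1 - savg X m (fun S => ((B ∩ S).card : ℝ)) := by
    rw [savg_sub, savg_const hm]
  rw [← h4, abs_le]
  have h5 : savg X m (fun S => (1 : ℝ) - (B ∩ S).card) ≤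
      savg X m (fun S => if Disjoint B S then 1 else 0) := by
    refine savg_mono fun S _ _ => ?_
    split_ifs with h
    · simp
    · rw [Finset.disjoint_iff_inter_eq_empty, ← Finset.card_eq_zero] at h
      have : (1 : ℝ) ≤ (B ∩ S).card := by exact_mod_cast Nat.one_le_iff_ne_zero.2 h
      linarith
  have h6 : savg X m (fun S => if Disjoint B S then 1 else 0) ≤
      savg X m (fun S => (1 : ℝ) - (B ∩ S).card) +
        savg X m (fun S => ((B ∩ S).card : ℝ) * ((B ∩ S).card - 1)) := by
    rw [← savg_add]
    refine savg_mono fun S _ _ => ?_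
    split_ifs with h
    · rw [Finset.disjoint_iff_inter_eq_empty] at h
      simp [h]
    · nlinarith [sq_nonneg (((B ∩ S).card : ℝ) - 1)]
  have : (0 : ℝ) ≤ (B.card : ℝ) ^ 2 * m ^ 2 / (X.card : ℝ) ^ 2 := by positivity
  constructor <;> linarith

lemma tendsto_zero_of_contract {w ε : ℕ → ℝ} {α : ℝ} (hα : 0 < α) {N : ℕ}
    (hw : ∀ n, 0 ≤ w n) (hε : Tendsto ε atTop (𝓝 0))
    (h : ∀ n, N ≤ n → w (n + 1) ≤ (1 - α / n) * w n + ε n / n) : Tendsto w atTop (𝓝 0) := by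
  refine (Metric.tendsto_atTop).2 fun η hη => ?_
  have h1 : ∀ᶠ n in atTop, ε n ≤ α * (η / 2) :=
    (hε.eventually (gt_mem_nhds (by positivity))).mono fun n hn => hn.le
  obtain ⟨M, hM⟩ := eventually_atTop.1 (h1.and ((eventually_ge_atTop N).and
    ((tendsto_natCast_atTop_atTop (R := ℝ)).eventually_ge_atTop (α + 1))))
  have hv : ∀ n, M ≤ n → max (w n - η / 2) 0 * (n : ℝ) ^ α ≤
      max (w M - η / 2) 0 * (M : ℝ) ^ α := by
    intro n hn
    induction n, hn using Nat.le_induction with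
    | base => exact le_rfl
    | succ n hn ih =>
      refine le_trans ?_ ih
      obtain ⟨e1, e2, e3⟩ := hM n hn
      have hn0 : (0 : ℝ) < n := by linarith
      have hc : 0 ≤ 1 - α / n := by
        rw [sub_nonneg, div_le_one hn0]; linarith
      have e4 : max (w (n + 1) - η / 2) 0 ≤ (1 - α / n) * max (w n - η / 2) 0 := by
        refine max_le ?_ (mul_nonneg hc (le_max_right _ _))
        refine le_trans ?_ (mul_le_mul_of_nonneg_left (le_max_left _ _) hc)
        have e5 := h n e2
        have e6 : ε n / n ≤ α / n * (η / 2) := by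
          rw [div_mul_eq_mul_div]; gcongr
        nlinarith
      have e7 : (1 - α / n) * ((n + 1 : ℕ) : ℝ) ^ α ≤ (n : ℝ) ^ α := by
        have e8 : 1 - α / n ≤ ((n : ℝ) / (n + 1 : ℕ)) ^ α := by
          rw [Real.rpow_def_of_pos (by positivity)]
          refine le_trans (show _ ≤ Real.exp (-(α / n)) by linarith [Real.add_one_le_exp (-(α / n))])
            (Real.exp_le_exp.2 ?_)
          have e9 : Real.log (((n + 1 : ℕ) : ℝ) / n) ≤ 1 / n := by
            refine (Real.log_le_sub_one_of_pos (by positivity)).trans ?_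
            push_cast
            rw [add_div, div_self hn0.ne']; linarith
          rw [← inv_div ((n + 1 : ℕ) : ℝ) (n : ℝ), Real.log_inv]
          have : α / n = 1 / n * α := by ring
          rw [this]
          nlinarith
        rw [Real.div_rpow hn0.le (by positivity), le_div_iff₀ (by positivity)] at e8
        exact e8
      calc _ ≤ (1 - α / n) * max (w n - η / 2) 0 * ((n + 1 : ℕ) : ℝ) ^ α := by gcongr
        _ = max (w n - η / 2) 0 * ((1 - α / n) * ((n + 1 : ℕ) : ℝ) ^ α) := by ring
        _ ≤ _ := mul_le_mul_of_nonneg_left e7 (le_max_right _ _)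
  have h2 : Tendsto (fun n : ℕ => max (w M - η / 2) 0 * (M : ℝ) ^ α * (n : ℝ) ^ (-α)) atTop (𝓝 0) := by
    simpa using ((tendsto_rpow_neg_atTop hα).comp tendsto_natCast_atTop_atTop).const_mul
      (max (w M - η / 2) 0 * (M : ℝ) ^ α)
  obtain ⟨M', hM'⟩ := eventually_atTop.1 (h2.eventually (gt_mem_nhds (half_pos hη)))
  refine ⟨max M (M' + 1), fun n hn => ?_⟩
  have hn0 : (0 : ℝ) < n := by exact_mod_cast (by have := le_of_max_le_right hn; omega)
  have e1 := hv n (le_of_max_le_left hn)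
  have e2 := hM' n (by have := le_of_max_le_right hn; omega)
  rw [Real.rpow_neg hn0.le, ← div_eq_mul_inv] at e2
  have e3 : max (w n - η / 2) 0 < η / 2 := by
    refine lt_of_le_of_lt ?_ e2
    rw [le_div_iff₀ (by positivity)]; exact e1
  rw [Real.dist_eq, sub_zero, abs_of_nonneg (hw n)]
  linarith [le_max_left (w n - η / 2) 0]

lemma bounded_of_contract {w : ℕ → ℝ} {α C : ℝ} (hα : 0 < α) {N : ℕ}
    (h : ∀ n, N ≤ n → w (n + 1) ≤ (1 - α / n) * w n + C / n) : ∃ D, ∀ n, w n ≤ D := by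
  obtain ⟨M, hM⟩ := eventually_atTop.1 ((eventually_ge_atTop N).and
    ((tendsto_natCast_atTop_atTop (R := ℝ)).eventually_ge_atTop (α + 1)))
  have h1 : ∀ n, M ≤ n → w n ≤ max (w M) (C / α) := by
    intro n hn
    induction n, hn using Nat.le_induction with
    | base => exact le_max_left _ _
    | succ n hn ih =>
      obtain ⟨e2, e3⟩ := hM n hn
      have hn0 : (0 : ℝ) < n := by linarith
      have hc : 0 ≤ 1 - α / n := by
        rw [sub_nonneg, div_le_one hn0]; linarith
      have e4 : C / n = α / n * (C / α) := by field_simp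
      have e5 : α / n * (C / α) ≤ α / n * max (w M) (C / α) :=
        mul_le_mul_of_nonneg_left (le_max_right _ _) (by positivity)
      have e6 := mul_le_mul_of_nonneg_left ih hc
      have := h n e2
      linarith
  obtain ⟨D, hD⟩ := (Finset.image w (Finset.range M)).bddAbove
  refine ⟨max D (max (w M) (C / α)), fun n => ?_⟩
  rcases le_or_gt M n with h2 | h2
  · exact (h1 n h2).trans (le_max_right _ _)
  · exact (hD (by simpa using ⟨n, h2, rfl⟩)).trans (le_max_left _ _)

lemma tendsto_of_linear_recursion {y ε : ℕ → ℝ} {α β : ℝ} (hα : 0 < α) {N : ℕ}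
    (hε0 : ∀ n, 0 ≤ ε n) (hε : Tendsto ε atTop (𝓝 0))
    (h : ∀ n, N ≤ n → |y (n + 1) - (y n - (α * y n - β) / n)| ≤ ε n * (1 + |y n|) / n) :
    Tendsto y atTop (𝓝 (β / α)) := by
  rw [tendsto_iff_norm_sub_tendsto_zero]
  simp only [Real.norm_eq_abs]
  obtain ⟨M, hM⟩ := eventually_atTop.1
    (((hε.eventually (gt_mem_nhds (half_pos hα))).and (eventually_ge_atTop N)).and
    ((tendsto_natCast_atTop_atTop (R := ℝ)).eventually_ge_atTop (α + 1)))
  refine tendsto_zero_of_contract (half_pos hα) (N := M) (fun n => abs_nonneg _)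
    (ε := fun n => ε n * (1 + |β / α|)) (by simpa using hε.mul_const (1 + |β / α|)) fun n hn => ?_
  obtain ⟨⟨e1, e2⟩, e3⟩ := hM n hn
  have hn0 : (0 : ℝ) < n := by linarith
  have hc : 0 ≤ 1 - α / n := by
    rw [sub_nonneg, div_le_one hn0]; linarith
  have e4 := h n e2
  have e5 : y (n + 1) - β / α = (y (n + 1) - (y n - (α * y n - β) / n)) +
      (1 - α / n) * (y n - β / α) := by
    field_simp; ring
  have e6 : |y n| ≤ |y n - β / α| + |β / α| := by
    simpa using abs_add_le (y n - β / α) (β / α)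
  have e7 : ε n * (1 + |y n|) / n ≤ α / 2 / n * |y n - β / α| + ε n * (1 + |β / α|) / n := by
    rw [div_mul_eq_mul_div, ← add_div]
    gcongr
    nlinarith [hε0 n, abs_nonneg (y n - β / α), mul_le_mul_of_nonneg_left e6 (hε0 n),
      mul_le_mul_of_nonneg_right e1.le (abs_nonneg (y n - β / α))]
  rw [e5]
  refine (abs_add_le _ _).trans ?_
  rw [abs_mul, abs_of_nonneg hc]
  have : α / n = α / 2 / n + α / 2 / n := by ring
  rw [this]
  linarith

end

section

/-- The indicator of a proposition. -/
noncomputable def ind (p : Prop) : ℝ := if p then 1 else 0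

lemma ind_pos {p : Prop} (h : p) : ind p = 1 := if_pos h

lemma ind_neg {p : Prop} (h : ¬ p) : ind p = 0 := if_neg h

lemma ind_nonneg (p : Prop) : 0 ≤ ind p := by unfold ind; positivity

lemma ind_le_one (p : Prop) : ind p ≤ 1 := by unfold ind; split_ifs <;> norm_num

lemma ind_mono {p q : Prop} (h : p → q) : ind p ≤ ind q := by
  by_cases hp : p
  · rw [ind_pos hp, ind_pos (h hp)]
  · rw [ind_neg hp]; exact ind_nonneg q

lemma ind_or_le (p q : Prop) : ind (p ∨ q) ≤ ind p + ind q := by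
  by_cases hp : p
  · rw [ind_pos (Or.inl hp), ind_pos hp]; linarith [ind_nonneg q]
  · rw [ind_neg hp, zero_add]; exact ind_mono fun h => h.resolve_left hp

lemma ite_eq_ind (p : Prop) [Decidable p] : (if p then (1 : ℝ) else 0) = ind p := by
  by_cases hp : p <;> simp [ind, hp]

/-- The events `A n` have exponentially small probability. -/
def Negl (E : ℕ → (SimpleGraph ℕ → ℝ) →ₗ[ℝ] ℝ) (A : ℕ → SimpleGraph ℕ → Prop) : Prop :=
  ∃ C c : ℝ, 0 ≤ C ∧ 0 < c ∧ ∀ᶠ n : ℕ in atTop,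
    E n (fun g => ind (A n g)) ≤ C * Real.exp (-(c * n))

section
variable {m d T : ℕ} {E : ℕ → (SimpleGraph ℕ → ℝ) →ₗ[ℝ] ℝ}

lemma Negl.mono (hE : Chain m d T E) {A B : ℕ → SimpleGraph ℕ → Prop} (hB : Negl E B) {N : ℕ}
    (h : ∀ n, N ≤ n → ∀ g, UAReachable m d n g → A n g → B n g) : Negl E A := by
  obtain ⟨C, c, hC, hc, hn⟩ := hB
  refine ⟨C, c, hC, hc, ?_⟩
  filter_upwards [hn, eventually_ge_atTop T, eventually_ge_atTop N] with n h1 h2 h3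
  exact (hE.mono n h2 _ _ fun g hg => ind_mono (h n h3 g hg)).trans h1

lemma Negl.or (hE : Chain m d T E) {A B : ℕ → SimpleGraph ℕ → Prop} (hA : Negl E A)
    (hB : Negl E B) : Negl E (fun n g => A n g ∨ B n g) := by
  obtain ⟨C, c, hC, hc, h1⟩ := hA
  obtain ⟨C', c', hC', hc', h2⟩ := hB
  refine ⟨C + C', min c c', by positivity, lt_min hc hc', ?_⟩
  filter_upwards [h1, h2, eventually_ge_atTop T] with n h1 h2 h3
  have h4 : E n (fun g => ind (A n g ∨ B n g)) ≤
      E n (fun g => ind (A n g)) + E n (fun g => ind (B n g)) := by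
    rw [← map_add]
    exact hE.mono n h3 _ _ fun g _ => ind_or_le _ _
  refine h4.trans ((add_le_add h1 h2).trans ?_)
  rw [add_mul]
  gcongr
  · exact min_le_left _ _
  · exact min_le_right _ _

lemma Negl.of_never (hE : Chain m d T E) {A : ℕ → SimpleGraph ℕ → Prop} {N : ℕ}
    (h : ∀ n, N ≤ n → ∀ g, UAReachable m d n g → ¬ A n g) : Negl E A := by
  refine ⟨0, 1, le_rfl, one_pos, ?_⟩
  filter_upwards [eventually_ge_atTop T, eventually_ge_atTop N] with n h2 h3
  rw [zero_mul]
  refine le_of_eq (Eq.trans (hE.congr h2 fun g hg => ?_) (hE.const h2 0))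
  rw [ind_neg (h n h3 g hg)]

lemma negl_of_drift (hd : 2 * m < d) (hE : Chain m d T E) {z : ℕ → SimpleGraph ℕ → ℝ} {C : ℝ}
    (hC : 0 < C)
    (hz : ∀ n g, UAReachable m d n g → z n g ≤ C * n)
    (hz' : ∀ n g, UAReachable m d n g → ∀ S, S ⊆ lowDegSet d g n → S.card = m →
      |z (n + 1) (attachStep g (n + 1) S) - z n g| ≤ C)
    (h : ∀ ε : ℝ, 0 < ε → Negl E (fun n g => 0 ≤ z n g ∧ z n g + ε < stepL m d n (z (n + 1)) g))
    {ε : ℝ} (hε : 0 < ε) : Negl E (fun n g => ε * n < z n g) := by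
  obtain ⟨C1, c1, hC1, hc1, hA⟩ := h (ε / 8) (by positivity)
  set A : ℕ → SimpleGraph ℕ → Prop :=
    fun n g => 0 ≤ z n g ∧ z n g + ε / 8 < stepL m d n (z (n + 1)) g with hAdef
  obtain ⟨l, hl0, hl1, hl2, hl3⟩ : ∃ l : ℝ, 0 < l ∧ l * C ≤ c1 ∧ l * (C + ε) ≤ 1 ∧
      l * (C + ε) ^ 2 ≤ ε / 8 := by
    refine ⟨min (c1 / C) (min (1 / (C + ε)) (ε / 8 / (C + ε) ^ 2)), by positivity, ?_, ?_, ?_⟩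
    · rw [← le_div_iff₀ hC]; exact min_le_left _ _
    · rw [← le_div_iff₀ (by positivity)]; exact (min_le_right _ _).trans (min_le_left _ _)
    · rw [← le_div_iff₀ (by positivity)]; exact (min_le_right _ _).trans (min_le_right _ _)
  set u : ℕ → SimpleGraph ℕ → ℝ := fun n g => Real.exp (l * (z n g - ε / 2 * n)) with hu
  have hstep : ∀ n g, UAReachable m d n g → stepL m d n (u (n + 1)) g ≤
      (1 - l * ε / 4) * u n g + Real.exp (l * C) +
        Real.exp (l * C) * Real.exp (c1 * n) * ind (A n g) := by
    intro n g hg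
    have hL := le_lowDegSet_card hd hg
    have hlE : l * ε ≤ 1 := by nlinarith
    have hpos1 : 0 ≤ (1 - l * ε / 4) * u n g := mul_nonneg (by linarith) (Real.exp_pos _).le
    have hn0 : (0 : ℝ) ≤ n := Nat.cast_nonneg n
    rw [stepL_apply]
    by_cases hz0 : 0 ≤ z n g
    · by_cases hAn : A n g
      · have h1 : savg (lowDegSet d g n) m (fun S => u (n + 1) (attachStep g (n + 1) S)) ≤
            Real.exp (l * C) * Real.exp (c1 * n) := by
          rw [← savg_const hL (Real.exp (l * C) * Real.exp (c1 * n))]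
          refine savg_mono fun S h1 h2 => ?_
          rw [← Real.exp_add]
          refine Real.exp_le_exp.2 ?_
          have e1 := (abs_le.1 (hz' n g hg S h1 h2)).2
          have e2 := hz n g hg
          have e3 : l * C * n ≤ c1 * n := mul_le_mul_of_nonneg_right hl1 hn0
          have e4 : z (n + 1) (attachStep g (n + 1) S) - ε / 2 * ((n + 1 : ℕ) : ℝ) ≤ C + C * n := by
            push_cast
            nlinarith
          nlinarith [mul_le_mul_of_nonneg_left e4 hl0.le]
        rw [ind_pos hAn, mul_one]
        linarith [Real.exp_pos (l * C)]
      · have hdr : stepL m d n (z (n + 1)) g ≤ z n g + ε / 8 := by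
          by_contra hcon
          exact hAn ⟨hz0, not_le.1 hcon⟩
        have h1 : savg (lowDegSet d g n) m (fun S => u (n + 1) (attachStep g (n + 1) S)) ≤
            u n g * (1 + l * (stepL m d n (z (n + 1)) g - z n g - ε / 2) +
              l ^ 2 * (C + ε) ^ 2) := by
          have : savg (lowDegSet d g n) m (fun S => u n g * ((1 + l * (- z n g - ε / 2) +
              l ^ 2 * (C + ε) ^ 2) + l * z (n + 1) (attachStep g (n + 1) S))) =
              u n g * (1 + l * (stepL m d n (z (n + 1)) g - z n g - ε / 2) +
              l ^ 2 * (C + ε) ^ 2) := by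
            rw [savg_mul, savg_add, savg_const hL, savg_mul, stepL_apply]
            ring
          rw [← this]
          refine savg_mono fun S h1 h2 => ?_
          set D := z (n + 1) (attachStep g (n + 1) S) - z n g with hD
          have e1 := hz' n g hg S h1 h2
          have e2 : u (n + 1) (attachStep g (n + 1) S) = u n g * Real.exp (l * (D - ε / 2)) := by
            simp only [hu]
            rw [← Real.exp_add]
            congr 1
            push_cast
            rw [hD]; ring
          have e3 : |D - ε / 2| ≤ C + ε := by
            rw [abs_le] at e1 ⊢
            constructor <;> linarith [e1.1, e1.2]
          have e4 : |l * (D - ε / 2)| ≤ 1 := by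
            rw [abs_mul, abs_of_pos hl0]
            exact (mul_le_mul_of_nonneg_left e3 hl0.le).trans hl2
          have e5 := (abs_le.1 (Real.abs_exp_sub_one_sub_id_le e4)).2
          have e6 : (l * (D - ε / 2)) ^ 2 ≤ l ^ 2 * (C + ε) ^ 2 := by
            rw [mul_pow]
            gcongr ?_ * ?_
            exact sq_le_sq' (by linarith [(abs_le.1 e3).1]) (abs_le.1 e3).2
          rw [e2]
          refine mul_le_mul_of_nonneg_left ?_ (Real.exp_pos _).le
          have : l * D = l * z (n + 1) (attachStep g (n + 1) S) - l * z n g := by rw [hD]; ring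
          nlinarith
        have h2 : u n g * (1 + l * (stepL m d n (z (n + 1)) g - z n g - ε / 2) +
              l ^ 2 * (C + ε) ^ 2) ≤ (1 - l * ε / 4) * u n g := by
          rw [mul_comm]
          refine mul_le_mul_of_nonneg_right ?_ (Real.exp_pos _).le
          have e1 : l * (stepL m d n (z (n + 1)) g - z n g - ε / 2) ≤ l * (ε / 8 - ε / 2) :=
            mul_le_mul_of_nonneg_left (by linarith) hl0.le
          nlinarith [mul_le_mul_of_nonneg_left hl3 hl0.le]
        rw [ind_neg hAn, mul_zero, add_zero]
        linarith [Real.exp_pos (l * C)]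
    · have h1 : savg (lowDegSet d g n) m (fun S => u (n + 1) (attachStep g (n + 1) S)) ≤
            Real.exp (l * C) := by
        rw [← savg_const hL (Real.exp (l * C))]
        refine savg_mono fun S h1 h2 => ?_
        refine Real.exp_le_exp.2 (mul_le_mul_of_nonneg_left ?_ hl0.le)
        have e1 := (abs_le.1 (hz' n g hg S h1 h2)).2
        push_cast
        nlinarith
      have h2 : 0 ≤ Real.exp (l * C) * Real.exp (c1 * n) * ind (A n g) :=
        mul_nonneg (by positivity) (ind_nonneg _)
      linarith
  obtain ⟨N, hN⟩ := eventually_atTop.1 (hA.and (eventually_ge_atTop T))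
  have hrec : ∀ n, N ≤ n → E (n + 1) (u (n + 1)) ≤
      (1 - l * ε / 4) * E n (u n) + (Real.exp (l * C) + Real.exp (l * C) * C1) := by
    intro n hn
    obtain ⟨h1, h2⟩ := hN n hn
    rw [hE.step n h2]
    refine (hE.mono n h2 _ ((1 - l * ε / 4) • u n + (fun _ => Real.exp (l * C)) +
      (Real.exp (l * C) * Real.exp (c1 * n)) • (fun g => ind (A n g)))
      (hstep n)).trans ?_
    rw [map_add, map_add, map_smul, map_smul, hE.const h2, smul_eq_mul, smul_eq_mul, add_assoc]
    refine add_le_add_right (add_le_add_right ?_ _) _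
    refine (mul_le_mul_of_nonneg_left h1 (by positivity)).trans (le_of_eq ?_)
    rw [mul_assoc, ← mul_assoc (Real.exp (c1 * n)), mul_comm (Real.exp (c1 * n)), mul_assoc C1,
      ← Real.exp_add]
    simp
  have hk : 0 < l * ε / 4 := by positivity
  have hk1 : l * ε / 4 ≤ 1 := by nlinarith
  set D := Real.exp (l * C) + Real.exp (l * C) * C1 with hD
  have hDpos : 0 < D := by positivity
  have hbd : ∀ n, N ≤ n → E n (u n) ≤ max (E N (u N)) (D / (l * ε / 4)) := by
    intro n hn
    induction n, hn using Nat.le_induction with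
    | base => exact le_max_left _ _
    | succ n hn ih =>
      refine (hrec n hn).trans ?_
      have e1 := mul_le_mul_of_nonneg_left ih (sub_nonneg.2 hk1)
      have e2 : D ≤ l * ε / 4 * max (E N (u N)) (D / (l * ε / 4)) := by
        rw [← div_le_iff₀' hk]; exact le_max_right _ _
      linarith
  refine ⟨max (E N (u N)) (D / (l * ε / 4)), l * (ε / 2), le_max_of_le_right (by positivity),
    by positivity, ?_⟩
  filter_upwards [eventually_ge_atTop N] with n hn
  have h2 := (hN n hn).2
  rw [Real.exp_neg, ← div_eq_mul_inv, le_div_iff₀ (Real.exp_pos _)]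
  refine le_trans ?_ (hbd n hn)
  rw [mul_comm, ← smul_eq_mul, ← map_smul]
  refine hE.mono n h2 _ _ fun g hg => ?_
  simp only [Pi.smul_apply, smul_eq_mul]
  by_cases hz0 : ε * n < z n g
  · rw [ind_pos hz0, mul_one]
    refine Real.exp_le_exp.2 ?_
    have : ε / 2 * n ≤ z n g - ε / 2 * n := by linarith
    nlinarith
  · rw [ind_neg hz0, mul_zero]; exact (Real.exp_pos _).le

end

end

section

/-- Number of vertices of degree at least `j`. -/
noncomputable def cnt (j n : ℕ) (g : SimpleGraph ℕ) : ℝ :=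
  ((Finset.Icc 1 n).filter (fun v => j ≤ graphDeg g v)).card

/-- Normalised attachment rate. -/
noncomputable def rate (m d n : ℕ) (g : SimpleGraph ℕ) : ℝ := m * n / (lowDegSet d g n).card

section
variable {m d T : ℕ} {E : ℕ → (SimpleGraph ℕ → ℝ) →ₗ[ℝ] ℝ}

lemma cnt_nonneg (j n : ℕ) (g : SimpleGraph ℕ) : 0 ≤ cnt j n g := Nat.cast_nonneg _

lemma cnt_le (j n : ℕ) (g : SimpleGraph ℕ) : cnt j n g ≤ n := by
  unfold cnt
  exact_mod_cast (Finset.card_filter_le _ _).trans (by simp)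

lemma cnt_add_low (d n : ℕ) (g : SimpleGraph ℕ) :
    cnt d n g + (lowDegSet d g n).card = n := by
  have := Finset.card_filter_add_card_filter_not (s := Finset.Icc 1 n) (fun v => d ≤ graphDeg g v)
  simp only [not_le, Nat.card_Icc, Nat.add_sub_cancel] at this
  unfold cnt lowDegSet
  exact_mod_cast this

lemma cnt_succ_sub (j n : ℕ) (g : SimpleGraph ℕ) :
    (((Finset.Icc 1 n).filter (fun v => graphDeg g v = j)).card : ℝ) =
      cnt j n g - cnt (j + 1) n g := by
  have : ((Finset.Icc 1 n).filter (fun v => graphDeg g v = j)).card +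
      ((Finset.Icc 1 n).filter (fun v => j + 1 ≤ graphDeg g v)).card =
      ((Finset.Icc 1 n).filter (fun v => j ≤ graphDeg g v)).card := by
    rw [← Finset.card_union_of_disjoint, ← Finset.filter_or]
    · congr 1; ext v; simp only [Finset.mem_filter]; constructor <;> intro h <;> exact ⟨h.1, by omega⟩
    · rw [Finset.disjoint_filter]; intro v _ h; omega
  unfold cnt
  rw [eq_sub_iff_add_eq]
  exact_mod_cast this

lemma cnt_attach {n j : ℕ} {g : SimpleGraph ℕ} (hg : UAReachable m d n g) {S : Finset ℕ}
    (hS : S ⊆ lowDegSet d g n) (hSm : S.card = m) (hj : m ≤ j) :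
    cnt (j + 1) (n + 1) (attachStep g (n + 1) S) = cnt (j + 1) n g +
      (((Finset.Icc 1 n).filter (fun v => graphDeg g v = j) ∩ S).card : ℝ) := by
  have : (Finset.Icc 1 (n + 1)).filter (fun v => j + 1 ≤ graphDeg (attachStep g (n + 1) S) v) =
      ((Finset.Icc 1 n).filter (fun v => j + 1 ≤ graphDeg g v)) ∪
        ((Finset.Icc 1 n).filter (fun v => graphDeg g v = j) ∩ S) := by
    ext x
    simp only [Finset.mem_filter, Finset.mem_union, Finset.mem_inter, Finset.mem_Icc]
    by_cases hx : x = n + 1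
    · subst hx
      rw [deg_attach_new hg hS, hSm]
      omega
    · rw [deg_attach_old hg hx]
      by_cases hxS : x ∈ S
      · simp only [hxS, if_true, and_true]; omega
      · simp only [hxS, if_false, and_false, or_false, add_zero]; omega
  unfold cnt
  rw [this, Finset.card_union_of_disjoint]
  · push_cast; rfl
  · rw [Finset.disjoint_left]
    intro x hx hx'
    simp only [Finset.mem_filter, Finset.mem_inter] at hx hx'
    omega

lemma stepL_cnt (hd : 2 * m < d) {n j : ℕ} {g : SimpleGraph ℕ} (hg : UAReachable m d n g)
    (hj : m ≤ j) (hjd : j < d) :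
    stepL m d n (cnt (j + 1) (n + 1)) g =
      cnt (j + 1) n g + m * (cnt j n g - cnt (j + 1) n g) / (lowDegSet d g n).card := by
  rw [stepL_apply, savg_congr fun S hS hSm => cnt_attach hg hS hSm hj, savg_add,
    savg_const (le_lowDegSet_card hd hg), savg_card_inter (le_lowDegSet_card hd hg),
    Finset.inter_eq_left.2, cnt_succ_sub]
  intro x hx
  simp only [Finset.mem_filter, Finset.mem_Icc] at hx
  rw [mem_lowDegSet]
  exact ⟨hx.1, by omega⟩

lemma rate_le (hd : 2 * m < d) {n : ℕ} {g : SimpleGraph ℕ} (hg : UAReachable m d n g)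
    (hm : 0 < m) : rate m d n g ≤ m / kap m d := by
  have h1 := kap_mul_le hd hg
  have h2 := kap_pos hd
  have h3 : (0 : ℝ) < (lowDegSet d g n).card := by
    exact_mod_cast hm.trans_le (le_lowDegSet_card hd hg)
  rw [rate, div_le_div_iff₀ h3 h2, mul_assoc, mul_comm (n : ℝ)]
  gcongr

lemma le_rate (hd : 2 * m < d) {n : ℕ} {g : SimpleGraph ℕ} (hg : UAReachable m d n g)
    (hm : 0 < m) : m ≤ rate m d n g := by
  have h3 : (0 : ℝ) < (lowDegSet d g n).card := by
    exact_mod_cast hm.trans_le (le_lowDegSet_card hd hg)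
  rw [rate, le_div_iff₀ h3]
  gcongr
  exact lowDegSet_card_le

/-- `c` is an asymptotic upper (`σ = 1`) or lower (`σ = -1`) bound for the rate. -/
def RateBound (m d : ℕ) (E : ℕ → (SimpleGraph ℕ → ℝ) →ₗ[ℝ] ℝ) (σ c : ℝ) : Prop :=
  ∀ ε : ℝ, 0 < ε → Negl E (fun n g => ε < σ * (rate m d n g - c))

lemma cnt_bound (hm : 0 < m) (hd : 2 * m < d) (hE : Chain m d T E) {σ c : ℝ}
    (hσ : σ = 1 ∨ σ = -1) (hc : 0 < c) (h : RateBound m d E σ c) (i : ℕ) (hi : m + i ≤ d) :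
    ∀ ε : ℝ, 0 < ε → Negl E (fun n g => ε * n < σ * (cnt (m + i) n g - (c / (1 + c)) ^ i * n)) := by
  set q := c / (1 + c) with hq
  have hσ1 : |σ| = 1 := by rcases hσ with rfl | rfl <;> simp
  have hq0 : 0 ≤ q := by positivity
  have hq1 : q ≤ 1 := by rw [hq, div_le_one (by positivity)]; linarith
  induction i with
  | zero =>
    intro ε hε
    refine Negl.of_never hE (N := m + 1) fun n hn g hg => ?_
    have : cnt (m + 0) n g = n := by
      unfold cnt
      rw [Finset.filter_true_of_mem]
      · simp
      · intro x hx
        exact reach_le_deg' hg (by simpa using hx) hn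
    rw [this]
    simp
    positivity
  | succ i ih =>
    have ih := ih (by omega)
    have hqi0 : 0 ≤ q ^ i := by positivity
    have hqi1 : q ^ i ≤ 1 := pow_le_one₀ hq0 hq1
    have hqi1' : q ^ (i + 1) ≤ 1 := pow_le_one₀ hq0 hq1
    have hqi0' : 0 ≤ q ^ (i + 1) := by positivity
    have hqrec : q ^ (i + 1) = c * (q ^ i - q ^ (i + 1)) := by
      rw [pow_succ, hq]; field_simp; ring
    refine fun ε hε => negl_of_drift hd hE (C := m + 1) (by positivity)
      (z := fun n g => σ * (cnt (m + (i + 1)) n g - q ^ (i + 1) * n)) ?_ ?_ ?_ hε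
    · intro n g _
      have h1 := cnt_nonneg (m + (i + 1)) n g
      have h2 := cnt_le (m + (i + 1)) n g
      have hn : (0 : ℝ) ≤ n := Nat.cast_nonneg n
      have h3 : q ^ (i + 1) * n ≤ n := by nlinarith
      have h4 : 0 ≤ q ^ (i + 1) * n := by positivity
      have h5 : (0 : ℝ) ≤ m * n := by positivity
      rcases hσ with rfl | rfl <;> linarith
    · intro n g hg S hS hSm
      rw [← mul_sub, abs_mul, hσ1, one_mul, ← add_assoc, cnt_attach hg hS hSm (by omega)]
      have h1 : (((Finset.Icc 1 n).filter (fun v => graphDeg g v = m + i) ∩ S).card : ℝ) ≤ m := by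
        rw [← hSm]
        exact_mod_cast Finset.card_le_card Finset.inter_subset_right
      have h2 : (0 : ℝ) ≤ ((Finset.Icc 1 n).filter (fun v => graphDeg g v = m + i) ∩ S).card :=
        Nat.cast_nonneg _
      rw [abs_le]
      push_cast
      constructor <;> nlinarith
    · intro ε hε
      have hK : 0 < m / kap m d := div_pos (by exact_mod_cast hm) (kap_pos hd)
      set K := m / kap m d with hKdef
      refine ((ih (ε / (K + 1)) (by positivity)).or hE (h (ε / (K + 1)) (by positivity))).mono hE
        (N := 1) ?_
      rintro n hn g hg ⟨h1, h2⟩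
      by_contra hcon
      simp only [not_or, not_lt] at hcon
      obtain ⟨h3, h4⟩ := hcon
      have hn0 : (0 : ℝ) < n := by exact_mod_cast hn
      have hL : (0 : ℝ) < (lowDegSet d g n).card := by
        exact_mod_cast hm.trans_le (le_lowDegSet_card hd hg)
      have e1 : stepL m d n (fun g => σ * (cnt (m + (i + 1)) (n + 1) g - q ^ (i + 1) * (n + 1 : ℕ))) g =
          σ * (cnt (m + i + 1) n g + m * (cnt (m + i) n g - cnt (m + i + 1) n g) /
            (lowDegSet d g n).card - q ^ (i + 1) * (n + 1 : ℕ)) := by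
        rw [← stepL_cnt hd hg (by omega) (by omega), stepL_apply, savg_mul, savg_sub,
          savg_const (le_lowDegSet_card hd hg), stepL_apply]
        rfl
      rw [e1, ← add_assoc] at h2
      rw [← add_assoc] at h1
      have hr0 := le_rate hd hg hm
      have hr1 := rate_le hd hg hm
      have hrm : (0 : ℝ) < m := by exact_mod_cast hm
      have e2 : m * (cnt (m + i) n g - cnt (m + i + 1) n g) / (lowDegSet d g n).card =
          rate m d n g * ((cnt (m + i) n g - cnt (m + i + 1) n g) / n) := by
        rw [rate, div_mul_div_comm, mul_right_comm,
          mul_div_mul_right _ _ hn0.ne']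
      rw [e2] at h2
      set r := rate m d n g
      set x := cnt (m + i) n g / n with hx
      set y := cnt (m + i + 1) n g / n with hy
      have e3 : cnt (m + i) n g = x * n := by rw [hx]; field_simp
      have e4 : cnt (m + i + 1) n g = y * n := by rw [hy]; field_simp
      have e5 : σ * (x - q ^ i) ≤ ε / (K + 1) := by
        rw [e3] at h3
        have : σ * (x - q ^ i) * n ≤ ε / (K + 1) * n := by linarith
        exact le_of_mul_le_mul_right this hn0
      have e6 : 0 ≤ σ * (y - q ^ (i + 1)) := by
        rw [e4] at h1
        have : 0 * (n : ℝ) ≤ σ * (y - q ^ (i + 1)) * n := by linarith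
        exact le_of_mul_le_mul_right this hn0
      have e7 : (cnt (m + i) n g - cnt (m + i + 1) n g) / n = x - y := by rw [sub_div]
      rw [e7] at h2
      push_cast at h2
      have e8 : ε < σ * (r * (x - y) - q ^ (i + 1)) := by linarith
      have e9 : σ * (r * (x - y) - q ^ (i + 1)) = r * (σ * (x - q ^ i)) -
          r * (σ * (y - q ^ (i + 1))) + σ * (r - c) * (q ^ i - q ^ (i + 1)) := by
        linear_combination (-σ) * hqrec
      have f1 : r * (σ * (x - q ^ i)) ≤ K * (ε / (K + 1)) :=
        (mul_le_mul_of_nonneg_left e5 (by linarith)).trans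
          (mul_le_mul_of_nonneg_right hr1 (by positivity))
      have f2 : 0 ≤ r * (σ * (y - q ^ (i + 1))) := mul_nonneg (by linarith) e6
      have f3 : 0 ≤ q ^ i - q ^ (i + 1) := by
        rw [sub_nonneg]; exact pow_le_pow_of_le_one hq0 hq1 (by omega)
      have f4 : σ * (r - c) * (q ^ i - q ^ (i + 1)) ≤ ε / (K + 1) :=
        (mul_le_mul_of_nonneg_right h4 f3).trans
          (mul_le_of_le_one_right (by positivity) (by linarith))
      have f5 : K * (ε / (K + 1)) + ε / (K + 1) = ε := by field_simp
      linarith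

/-- The function whose fixed point is the limiting rate. -/
noncomputable def rateMap (m d : ℕ) (c : ℝ) : ℝ := m / (1 - (c / (1 + c)) ^ (d - m))

lemma pow_ratio_lt_one {c : ℝ} (hc : 0 < c) {D : ℕ} (hD : D ≠ 0) : (c / (1 + c)) ^ D < 1 :=
  pow_lt_one₀ (by positivity) (by rw [div_lt_one (by positivity)]; linarith) hD

lemma RateBound.map (hm : 0 < m) (hd : 2 * m < d) (hE : Chain m d T E) {σ c : ℝ}
    (hσ : σ = 1 ∨ σ = -1) (hc : 0 < c) (h : RateBound m d E σ c) :
    RateBound m d E σ (rateMap m d c) := by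
  intro ε hε
  have h1 := cnt_bound hm hd hE hσ hc h (d - m) (by omega)
  rw [show m + (d - m) = d by omega] at h1
  have hK : 0 < m / kap m d := div_pos (by exact_mod_cast hm) (kap_pos hd)
  have hb : (c / (1 + c)) ^ (d - m) < 1 := pow_ratio_lt_one hc (by omega)
  unfold rateMap
  set K := m / kap m d with hKdef
  set b := (c / (1 + c)) ^ (d - m) with hbdef
  refine (h1 (ε * (1 - b) / K) (div_pos (mul_pos hε (by linarith)) hK)).mono hE (N := 1) ?_
  intro n hn g hg h2
  by_contra hcon
  rw [not_lt] at hcon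
  have hn0 : (0 : ℝ) < n := by exact_mod_cast hn
  have hL : (0 : ℝ) < (lowDegSet d g n).card := by
    exact_mod_cast hm.trans_le (le_lowDegSet_card hd hg)
  have hr1 := rate_le hd hg hm
  have hr0 := le_rate hd hg hm
  have hrm : (0 : ℝ) < m := by exact_mod_cast hm
  have e1 : cnt d n g = n - (lowDegSet d g n).card := by linarith [cnt_add_low d n g]
  have hb' : 0 < 1 - b := by linarith
  have e2 : σ * (rate m d n g - m / (1 - b)) * (1 - b) * n =
      rate m d n g * (σ * (cnt d n g - b * n)) := by
    rw [e1, rate]; field_simp; ring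
  have e3 : rate m d n g * (σ * (cnt d n g - b * n)) ≤ rate m d n g * (ε * (1 - b) / K * n) :=
    mul_le_mul_of_nonneg_left hcon (by linarith)
  have e4 : rate m d n g * (ε * (1 - b) / K * n) ≤ K * (ε * (1 - b) / K * n) :=
    mul_le_mul_of_nonneg_right hr1 (by positivity)
  have e5 : K * (ε * (1 - b) / K * n) = ε * (1 - b) * n := by field_simp
  have e6 : ε * ((1 - b) * n) < σ * (rate m d n g - m / (1 - b)) * ((1 - b) * n) :=
    mul_lt_mul_of_pos_right h2 (by positivity)
  linarith

/-- `rateFun c = m` characterises the limiting rate. -/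
noncomputable def rateFun (m d : ℕ) (c : ℝ) : ℝ := c * (1 - (c / (1 + c)) ^ (d - m))

lemma rateFun_eq {c : ℝ} (hc : 0 < c) :
    rateFun m d c = c / (1 + c) * ∑ k ∈ Finset.range (d - m), (c / (1 + c)) ^ k := by
  rw [rateFun, ← mul_neg_geom_sum, ← mul_assoc]
  congr 1
  field_simp
  ring

lemma rateFun_lt (hd : 2 * m < d) {c c' : ℝ} (hc : 0 < c) (h : c < c') :
    rateFun m d c < rateFun m d c' := by
  have hc' : 0 < c' := hc.trans h
  rw [rateFun_eq hc, rateFun_eq hc']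
  have hq : c / (1 + c) < c' / (1 + c') := by
    rw [div_lt_div_iff₀ (by positivity) (by positivity)]; nlinarith
  have h1 : ∑ k ∈ Finset.range (d - m), (c / (1 + c)) ^ k ≤
      ∑ k ∈ Finset.range (d - m), (c' / (1 + c')) ^ k := by
    gcongr
  have h2 : 0 < ∑ k ∈ Finset.range (d - m), (c / (1 + c)) ^ k :=
    Finset.sum_pos (fun k _ => by positivity) (by simp; omega)
  exact mul_lt_mul hq h1 h2 (by positivity)

lemma exists_rateFun_eq (hm : 0 < m) (hd : 2 * m < d) :
    ∃ θ : ℝ, m ≤ θ ∧ rateFun m d θ = m := by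
  set D := d - m with hD
  have hmR : (0 : ℝ) < m := by exact_mod_cast hm
  have hDm : (m : ℝ) + 1 ≤ D := by exact_mod_cast (by omega)
  have hle : (m : ℝ) ≤ (D : ℝ) ^ 2 := by nlinarith
  have hcont : ContinuousOn (rateFun m d) (Set.Icc m ((D : ℝ) ^ 2)) := by
    unfold rateFun
    refine continuousOn_id.mul (continuousOn_const.sub ((ContinuousOn.div continuousOn_id
      (continuousOn_const.add continuousOn_id) ?_).pow _))
    intro x hx
    have : (0 : ℝ) < x := hmR.trans_le hx.1
    show (1 : ℝ) + x ≠ 0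
    positivity
  have h1 : rateFun m d m ≤ m := by
    unfold rateFun
    have : (0 : ℝ) ≤ ((m : ℝ) / (1 + m)) ^ (d - m) := by positivity
    nlinarith
  have h2 : (m : ℝ) ≤ rateFun m d ((D : ℝ) ^ 2) := by
    have hDpos : (0 : ℝ) < D := by linarith
    rw [rateFun_eq (by positivity), ← hD]
    set q := (D : ℝ) ^ 2 / (1 + (D : ℝ) ^ 2) with hq
    have hq0 : 0 ≤ q := by positivity
    have hq1 : q ≤ 1 := by rw [hq, div_le_one (by positivity)]; linarith
    have hq' : q = 1 + (-(1 / (1 + (D : ℝ) ^ 2))) := by rw [hq]; field_simp; ring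
    have e1 : 1 - D * (1 / (1 + (D : ℝ) ^ 2)) ≤ q ^ D := by
      have := one_add_mul_le_pow (a := -(1 / (1 + (D : ℝ) ^ 2))) ?_ D
      · rw [← hq'] at this; linarith
      · have : 1 / (1 + (D : ℝ) ^ 2) ≤ 1 := by
          rw [div_le_one (by positivity)]; nlinarith
        linarith
    have e2 : D * q ^ D ≤ q * ∑ k ∈ Finset.range D, q ^ k := by
      rw [Finset.mul_sum, ← nsmul_eq_mul]
      have := Finset.card_nsmul_le_sum (Finset.range D) (fun k => q * q ^ k) (q ^ D) ?_
      · rwa [Finset.card_range] at this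
      · intro k hk
        rw [← pow_succ']
        exact pow_le_pow_of_le_one hq0 hq1 (by have := Finset.mem_range.1 hk; omega)
    have e3 : (D : ℝ) * (D * (1 / (1 + (D : ℝ) ^ 2))) ≤ 1 := by
      rw [← mul_assoc, mul_one_div, div_le_one (by positivity)]; nlinarith
    nlinarith
  obtain ⟨θ, hθ, h3⟩ := intermediate_value_Icc hle hcont ⟨h1, h2⟩
  exact ⟨θ, hθ.1, h3⟩

lemma RateBound.weaken (hE : Chain m d T E) {σ c c' : ℝ} (h : RateBound m d E σ c)
    (hc : σ * c ≤ σ * c') : RateBound m d E σ c' := fun ε hε =>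
  (h ε hε).mono hE (N := 0) fun n _ g _ h1 => by linarith

lemma rate_concentration (hm : 0 < m) (hd : 2 * m < d) {θ : ℝ} (hθm : m ≤ θ)
    (hθ : rateFun m d θ = m) (hE : Chain m d T E) {ε : ℝ} (hε : 0 < ε) :
    Negl E (fun n g => ε < |rate m d n g - θ|) := by
  have hmR : (0 : ℝ) < m := by exact_mod_cast hm
  have hmap : ∀ c : ℝ, 0 < c → (rateMap m d c < c ↔ (m : ℝ) < rateFun m d c) := by
    intro c hc
    have := pow_ratio_lt_one hc (D := d - m) (by omega)
    rw [rateMap, div_lt_iff₀ (by linarith), rateFun]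
  have hmap' : ∀ c : ℝ, 0 < c → (c < rateMap m d c ↔ rateFun m d c < (m : ℝ)) := by
    intro c hc
    have := pow_ratio_lt_one hc (D := d - m) (by omega)
    rw [rateMap, lt_div_iff₀ (by linarith), rateFun]
  have hmono : ∀ c c' : ℝ, 0 < c' → rateFun m d c ≤ rateFun m d c' → c ≤ c' := by
    intro c c' hc' h
    by_contra hcon
    exact absurd h (not_le.2 (rateFun_lt hd hc' (not_le.1 hcon)))
  have hmapm : ∀ c : ℝ, 0 < c → m ≤ rateMap m d c := by
    intro c hc
    have := pow_ratio_lt_one hc (D := d - m) (by omega)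
    have h2 : 0 ≤ (c / (1 + c)) ^ (d - m) := by positivity
    rw [rateMap, le_div_iff₀ (by linarith)]
    nlinarith
  set K := max (m / kap m d) θ with hK
  have hKm : m ≤ K := hθm.trans (le_max_right _ _)
  have hup : RateBound m d E 1 θ := by
    set A : Set ℝ := {c | c ∈ Set.Icc (m : ℝ) K ∧ RateBound m d E 1 c} with hA
    have hAne : A.Nonempty := ⟨K, ⟨hKm, le_rfl⟩, fun ε hε =>
      Negl.of_never hE (N := 0) fun n _ g hg h => by
        have := (rate_le hd hg hm).trans (le_max_left _ θ)
        linarith⟩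
    have hAbdd : BddBelow A := ⟨m, fun c hc => hc.1.1⟩
    have hcm : m ≤ sInf A := le_csInf hAne fun c hc => hc.1.1
    have hcpos : 0 < sInf A := hmR.trans_le hcm
    have hcK : sInf A ≤ K := (csInf_le hAbdd hAne.choose_spec).trans hAne.choose_spec.1.2
    have hgood : RateBound m d E 1 (sInf A) := by
      intro ε hε
      obtain ⟨c, hc, hc'⟩ := exists_lt_of_csInf_lt hAne (show sInf A < sInf A + ε / 2 by linarith)
      exact (hc.2 (ε / 2) (by positivity)).mono hE (N := 0) fun n _ g _ h => by linarith
    have h2 := hgood.map hm hd hE (Or.inl rfl) hcpos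
    have h3 : ¬ rateMap m d (sInf A) < sInf A := fun hlt =>
      absurd (csInf_le hAbdd ⟨⟨hmapm _ hcpos, hlt.le.trans hcK⟩, h2⟩) (not_le.2 hlt)
    rw [hmap _ hcpos, not_lt, ← hθ] at h3
    exact hgood.weaken hE (by linarith [hmono _ _ (hmR.trans_le hθm) h3])
  have hlow : RateBound m d E (-1) θ := by
    set A : Set ℝ := {c | c ∈ Set.Icc (m : ℝ) K ∧ RateBound m d E (-1) c} with hA
    have hAne : A.Nonempty := ⟨m, ⟨le_rfl, hKm⟩, fun ε hε =>
      Negl.of_never hE (N := 0) fun n _ g hg h => by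
        have := le_rate hd hg hm
        linarith⟩
    have hAbdd : BddAbove A := ⟨K, fun c hc => hc.1.2⟩
    have hcm : m ≤ sSup A := hAne.choose_spec.1.1.trans (le_csSup hAbdd hAne.choose_spec)
    have hcpos : 0 < sSup A := hmR.trans_le hcm
    have hgood : RateBound m d E (-1) (sSup A) := by
      intro ε hε
      obtain ⟨c, hc, hc'⟩ := exists_lt_of_lt_csSup hAne (show sSup A - ε / 2 < sSup A by linarith)
      exact (hc.2 (ε / 2) (by positivity)).mono hE (N := 0) fun n _ g _ h => by linarith
    have h2 := hgood.map hm hd hE (Or.inr rfl) hcpos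
    have h3 : min (rateMap m d (sSup A)) K ≤ sSup A :=
      le_csSup hAbdd ⟨⟨le_min (hmapm _ hcpos) hKm, min_le_right _ _⟩,
        h2.weaken hE (by linarith [min_le_left (rateMap m d (sSup A)) K])⟩
    refine hgood.weaken hE ?_
    rcases min_le_iff.1 h3 with h4 | h4
    · rw [← not_lt, hmap' _ hcpos, not_lt] at h4
      have := hmono θ (sSup A) hcpos (by rw [hθ]; exact h4)
      linarith
    · have := (le_max_right (m / kap m d) θ).trans h4
      linarith
  refine ((hup ε hε).or hE (hlow ε hε)).mono hE (N := 0) fun n _ g _ h => ?_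
  rcases lt_abs.1 h with h | h
  · left; linarith
  · right; linarith

end

end

section

section
variable {V : Type*} (Q Q' : SimpleGraph V)

/-- `φ` embeds the part `A` of the pattern `(Q, Q', δ)` into `g`: edges of `Q` are kept, all edges
of the image come from `Q'`, and the image of `i` has degree `δ i`. -/
structure IsEmb (n : ℕ) (g : SimpleGraph ℕ) (A : Finset V) (δ : V → ℕ) (φ : V → ℕ) : Prop where
  mem : ∀ i ∈ A, 1 ≤ φ i ∧ φ i ≤ n
  zero : ∀ i, i ∉ A → φ i = 0
  inj : ∀ i ∈ A, ∀ j ∈ A, φ i = φ j → i = j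
  adj : ∀ i ∈ A, ∀ j ∈ A, Q.Adj i j → g.Adj (φ i) (φ j)
  adj' : ∀ i ∈ A, ∀ j ∈ A, g.Adj (φ i) (φ j) → Q'.Adj i j
  deg : ∀ i ∈ A, graphDeg g (φ i) = δ i

/-- Decrease `δ` by one on `I`. -/
noncomputable def dec (δ : V → ℕ) (I : Finset V) (i : V) : ℕ := δ i - if i ∈ I then 1 else 0

/-- The set of neighbours of `i` inside `A`. -/
noncomputable def nbr (Q : SimpleGraph V) (A : Finset V) (i : V) : Finset V := A.filter (Q.Adj i)

/-- The elements of `A` mapped into `S`. -/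
noncomputable def trc (A : Finset V) (φ : V → ℕ) (S : Finset ℕ) : Finset V :=
  A.filter (fun i => φ i ∈ S)

variable {Q Q'} {m d n : ℕ} {g : SimpleGraph ℕ} {S : Finset ℕ} {A : Finset V} {δ : V → ℕ}

lemma isEmb_old (hg : UAReachable m d n g) (hδ : ∀ i ∈ A, 1 ≤ δ i) {φ : V → ℕ} :
    (IsEmb Q Q' (n + 1) (attachStep g (n + 1) S) A δ φ ∧ ∀ i ∈ A, φ i ≠ n + 1) ↔
      IsEmb Q Q' n g A (dec δ (trc A φ S)) φ := by
  have hadj : ∀ a b, a ≠ n + 1 → b ≠ n + 1 → ((attachStep g (n + 1) S).Adj a b ↔ g.Adj a b) := by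
    intro a b ha hb
    rw [attach_adj]
    simp [ha, hb]
  have hdeg : ∀ i ∈ A, φ i ≠ n + 1 →
      (graphDeg (attachStep g (n + 1) S) (φ i) = δ i ↔ graphDeg g (φ i) = dec δ (trc A φ S) i) := by
    intro i hi h
    rw [deg_attach_old hg h]
    have := hδ i hi
    unfold dec trc
    simp only [Finset.mem_filter, hi, true_and]
    split_ifs <;> omega
  constructor
  · rintro ⟨h, h1⟩
    refine ⟨fun i hi => ?_, h.zero, h.inj, fun i hi j hj hij => ?_, fun i hi j hj hij => ?_,
      fun i hi => ?_⟩
    · have := h.mem i hi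
      have := h1 i hi
      omega
    · exact (hadj _ _ (h1 i hi) (h1 j hj)).1 (h.adj i hi j hj hij)
    · exact h.adj' i hi j hj ((hadj _ _ (h1 i hi) (h1 j hj)).2 hij)
    · exact (hdeg i hi (h1 i hi)).1 (h.deg i hi)
  · intro h
    have h1 : ∀ i ∈ A, φ i ≠ n + 1 := fun i hi => by have := h.mem i hi; omega
    refine ⟨⟨fun i hi => ?_, h.zero, h.inj, fun i hi j hj hij => ?_, fun i hi j hj hij => ?_,
      fun i hi => ?_⟩, h1⟩
    · have := h.mem i hi
      omega
    · exact (hadj _ _ (h1 i hi) (h1 j hj)).2 (h.adj i hi j hj hij)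
    · exact h.adj' i hi j hj ((hadj _ _ (h1 i hi) (h1 j hj)).1 hij)
    · exact (hdeg i hi (h1 i hi)).2 (h.deg i hi)

lemma isEmb_new (hg : UAReachable m d n g) (hS : S ⊆ lowDegSet d g n) (hSm : S.card = m)
    (hδ : ∀ i ∈ A, 1 ≤ δ i) {i₀ : V} (hi₀ : i₀ ∈ A) {φ : V → ℕ} :
    (IsEmb Q Q' (n + 1) (attachStep g (n + 1) S) A δ φ ∧ φ i₀ = n + 1) ↔
      (φ i₀ = n + 1 ∧ δ i₀ = m ∧
        nbr Q (A.erase i₀) i₀ ⊆ trc (A.erase i₀) φ S ∧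
        trc (A.erase i₀) φ S ⊆ nbr Q' (A.erase i₀) i₀ ∧
        IsEmb Q Q' n g (A.erase i₀) (dec δ (trc (A.erase i₀) φ S)) (Function.update φ i₀ 0)) := by
  have hadj : ∀ a b, a ≠ n + 1 → b ≠ n + 1 → ((attachStep g (n + 1) S).Adj a b ↔ g.Adj a b) := by
    intro a b ha hb
    rw [attach_adj]
    simp [ha, hb]
  have hadjn : ∀ b, b ≠ n + 1 → ((attachStep g (n + 1) S).Adj (n + 1) b ↔ b ∈ S) := by
    intro b hb
    rw [attach_adj]
    simp only [hb.symm, ne_eq, not_false_eq_true, true_and, hb, false_and, or_false,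
      or_iff_right_iff_imp]
    intro h
    have := reach_adj hg h
    omega
  have hdeg : ∀ i ∈ A.erase i₀, φ i ≠ n + 1 →
      (graphDeg (attachStep g (n + 1) S) (φ i) = δ i ↔
        graphDeg g (φ i) = dec δ (trc (A.erase i₀) φ S) i) := by
    intro i hi h
    rw [deg_attach_old hg h]
    have := hδ i (Finset.mem_of_mem_erase hi)
    unfold dec trc
    simp only [Finset.mem_filter, hi, true_and]
    split_ifs <;> omega
  have hup : ∀ i ∈ A.erase i₀, Function.update φ i₀ 0 i = φ i := fun i hi =>
    Function.update_of_ne (Finset.ne_of_mem_erase hi) _ _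
  constructor
  · rintro ⟨h, h0⟩
    have h1 : ∀ i ∈ A.erase i₀, φ i ≠ n + 1 := fun i hi hcon =>
      Finset.ne_of_mem_erase hi (h.inj i (Finset.mem_of_mem_erase hi) i₀ hi₀ (hcon.trans h0.symm))
    refine ⟨h0, ?_, ?_, ?_, ?_⟩
    · rw [← h.deg i₀ hi₀, h0, deg_attach_new hg hS, hSm]
    · intro j hj
      simp only [nbr, trc, Finset.mem_filter] at hj ⊢
      refine ⟨hj.1, ?_⟩
      have := h.adj i₀ hi₀ j (Finset.mem_of_mem_erase hj.1) hj.2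
      rwa [h0, hadjn _ (h1 j hj.1)] at this
    · intro j hj
      simp only [nbr, trc, Finset.mem_filter] at hj ⊢
      refine ⟨hj.1, h.adj' i₀ hi₀ j (Finset.mem_of_mem_erase hj.1) ?_⟩
      rw [h0, hadjn _ (h1 j hj.1)]
      exact hj.2
    · refine ⟨fun i hi => ?_, fun i hi => ?_, fun i hi j hj => ?_, fun i hi j hj hij => ?_,
        fun i hi j hj hij => ?_, fun i hi => ?_⟩
      · rw [hup i hi]
        have := h.mem i (Finset.mem_of_mem_erase hi)
        have := h1 i hi
        omega
      · by_cases hii : i = i₀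
        · rw [hii, Function.update_self]
        · rw [Function.update_of_ne hii]
          exact h.zero i fun hA => hi (Finset.mem_erase.2 ⟨hii, hA⟩)
      · rw [hup i hi, hup j hj]
        exact h.inj i (Finset.mem_of_mem_erase hi) j (Finset.mem_of_mem_erase hj)
      · rw [hup i hi, hup j hj]
        exact (hadj _ _ (h1 i hi) (h1 j hj)).1
          (h.adj i (Finset.mem_of_mem_erase hi) j (Finset.mem_of_mem_erase hj) hij)
      · rw [hup i hi, hup j hj] at hij
        exact h.adj' i (Finset.mem_of_mem_erase hi) j (Finset.mem_of_mem_erase hj)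
          ((hadj _ _ (h1 i hi) (h1 j hj)).2 hij)
      · rw [hup i hi]
        exact (hdeg i hi (h1 i hi)).1 (h.deg i (Finset.mem_of_mem_erase hi))
  · rintro ⟨h0, hm, hJ, hJ', h⟩
    have h1 : ∀ i ∈ A.erase i₀, φ i ≠ n + 1 := fun i hi => by
      have := h.mem i hi
      rw [hup i hi] at this
      omega
    have hc : ∀ i ∈ A, i = i₀ ∨ i ∈ A.erase i₀ := fun i hi => by
      by_cases hii : i = i₀
      · exact Or.inl hii
      · exact Or.inr (Finset.mem_erase.2 ⟨hii, hi⟩)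
    have hQ : ∀ j ∈ A.erase i₀, Q.Adj i₀ j → (attachStep g (n + 1) S).Adj (φ i₀) (φ j) := by
      intro j hj hij
      rw [h0, hadjn _ (h1 j hj)]
      have : j ∈ nbr Q (A.erase i₀) i₀ := Finset.mem_filter.2 ⟨hj, hij⟩
      exact (Finset.mem_filter.1 (hJ this)).2
    have hQ' : ∀ j ∈ A.erase i₀, (attachStep g (n + 1) S).Adj (φ i₀) (φ j) → Q'.Adj i₀ j := by
      intro j hj hij
      rw [h0, hadjn _ (h1 j hj)] at hij
      have : j ∈ trc (A.erase i₀) φ S := Finset.mem_filter.2 ⟨hj, hij⟩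
      exact (Finset.mem_filter.1 (hJ' this)).2
    refine ⟨⟨fun i hi => ?_, fun i hi => ?_, fun i hi j hj hij => ?_, fun i hi j hj hij => ?_,
        fun i hi j hj hij => ?_, fun i hi => ?_⟩, h0⟩
    · rcases hc i hi with rfl | hi
      · omega
      · have := h.mem i hi
        rw [hup i hi] at this
        omega
    · have hii : i ≠ i₀ := fun hh => hi (hh ▸ hi₀)
      have := h.zero i fun hh => hi (Finset.mem_of_mem_erase hh)
      rwa [Function.update_of_ne hii] at this
    · rcases hc i hi with rfl | hi <;> rcases hc j hj with rfl | hj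
      · rfl
      · exact absurd (hij.symm.trans h0) (h1 j hj)
      · exact absurd (hij.trans h0) (h1 i hi)
      · exact h.inj i hi j hj (by rw [hup i hi, hup j hj, hij])
    · rcases hc i hi with rfl | hi <;> rcases hc j hj with rfl | hj
      · exact absurd hij (Q.loopless.irrefl _)
      · exact hQ j hj hij
      · exact (hQ i hi hij.symm).symm
      · rw [hadj _ _ (h1 i hi) (h1 j hj)]
        have := h.adj i hi j hj hij
        rwa [hup i hi, hup j hj] at this
    · rcases hc i hi with rfl | hi <;> rcases hc j hj with rfl | hj
      · exact absurd hij ((attachStep g (n + 1) S).loopless.irrefl _)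
      · exact hQ' j hj hij
      · exact (hQ' i hi hij.symm).symm
      · rw [hadj _ _ (h1 i hi) (h1 j hj)] at hij
        exact h.adj' i hi j hj (by rwa [hup i hi, hup j hj])
    · rcases hc i hi with rfl | hi
      · rw [h0, deg_attach_new hg hS, hSm, hm]
      · have := h.deg i hi
        rw [hup i hi] at this
        exact (hdeg i hi (h1 i hi)).2 this

variable [Fintype V]
variable (Q')
variable (Q)

/-- The finite set of embeddings. -/
noncomputable def emb (n : ℕ) (g : SimpleGraph ℕ) (A : Finset V) (δ : V → ℕ) : Finset (V → ℕ) :=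
  (Fintype.piFinset (fun i => if i ∈ A then Finset.Icc 1 n else {0})).filter
    (IsEmb Q Q' n g A δ)

variable {Q Q'}

lemma mem_emb {φ : V → ℕ} : φ ∈ emb Q Q' n g A δ ↔ IsEmb Q Q' n g A δ φ := by
  rw [emb, Finset.mem_filter, and_iff_right_iff_imp]
  intro h
  rw [Fintype.mem_piFinset]
  intro i
  split_ifs with hi
  · exact Finset.mem_Icc.2 (h.mem i hi)
  · exact Finset.mem_singleton.2 (h.zero i hi)

lemma emb_card_le : (emb Q Q' n g A δ).card ≤ n ^ A.card := by
  refine (Finset.card_filter_le _ _).trans ?_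
  rw [Fintype.card_piFinset]
  have : ∀ i, (if i ∈ A then Finset.Icc 1 n else {0}).card = if i ∈ A then n else 1 := by
    intro i; split_ifs <;> simp
  simp only [this]
  rw [Finset.prod_ite]
  simp

/-- Embeddings using the new vertex. -/
noncomputable def embNew (Q Q' : SimpleGraph V) (n : ℕ) (g : SimpleGraph ℕ) (A : Finset V)
    (δ : V → ℕ) : Finset (V → ℕ) :=
  (emb Q Q' n g A δ).filter (fun φ => ∃ i ∈ A, φ i = n)

/-- Number of embeddings with prescribed trace on `S`. -/
noncomputable def embT (Q Q' : SimpleGraph V) (n : ℕ) (g : SimpleGraph ℕ) (A : Finset V)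
    (δ : V → ℕ) (I : Finset V) (S : Finset ℕ) : ℝ :=
  ∑ φ ∈ emb Q Q' n g A (dec δ I), ind (trc A φ S = I)

lemma card_filter_eq_sum_ind {α : Type*} (s : Finset α) (p : α → Prop) [DecidablePred p] :
    ((s.filter p).card : ℝ) = ∑ x ∈ s, ind (p x) := by
  rw [Finset.card_filter]
  push_cast
  exact Finset.sum_congr rfl fun x _ => ite_eq_ind _

lemma emb_attach_old (hg : UAReachable m d n g) (hδ : ∀ i ∈ A, 1 ≤ δ i) :
    (((emb Q Q' (n + 1) (attachStep g (n + 1) S) A δ).filter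
      (fun φ => ¬ ∃ i ∈ A, φ i = n + 1)).card : ℝ) = ∑ I ∈ A.powerset, embT Q Q' n g A δ I S := by
  rw [Finset.card_eq_sum_card_fiberwise (f := fun φ => trc A φ S) (t := A.powerset)]
  · push_cast
    refine Finset.sum_congr rfl fun I _ => ?_
    rw [embT, ← card_filter_eq_sum_ind]
    congr 2
    ext φ
    simp only [Finset.mem_filter, mem_emb]
    constructor
    · rintro ⟨⟨h1, h2⟩, rfl⟩
      push Not at h2
      exact ⟨(isEmb_old hg hδ).1 ⟨h1, h2⟩, rfl⟩
    · rintro ⟨h1, rfl⟩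
      have := (isEmb_old hg hδ).2 h1
      push Not
      exact ⟨this, rfl⟩
  · intro φ _
    exact Finset.mem_powerset.2 (Finset.filter_subset _ _)

/-- Possible traces when the new vertex plays the role of `i₀`. -/
noncomputable def newTr (Q Q' : SimpleGraph V) (A : Finset V) (i₀ : V) : Finset (Finset V) :=
  (A.erase i₀).powerset.filter
    (fun I => nbr Q (A.erase i₀) i₀ ⊆ I ∧ I ⊆ nbr Q' (A.erase i₀) i₀)

lemma embNew_attach (hg : UAReachable m d n g) (hS : S ⊆ lowDegSet d g n) (hSm : S.card = m)
    (hδ : ∀ i ∈ A, 1 ≤ δ i) :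
    ((embNew Q Q' (n + 1) (attachStep g (n + 1) S) A δ).card : ℝ) =
      ∑ i₀ ∈ A.filter (fun i => δ i = m), ∑ I ∈ newTr Q Q' A i₀,
        embT Q Q' n g (A.erase i₀) δ I S := by
  have h1 : embNew Q Q' (n + 1) (attachStep g (n + 1) S) A δ =
      (A.filter (fun i => δ i = m)).biUnion (fun i₀ =>
        (emb Q Q' (n + 1) (attachStep g (n + 1) S) A δ).filter (fun φ => φ i₀ = n + 1)) := by
    ext φ
    simp only [embNew, Finset.mem_filter, Finset.mem_biUnion, mem_emb]
    constructor
    · rintro ⟨h, i, hi, h2⟩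
      exact ⟨i, ⟨hi, ((isEmb_new hg hS hSm hδ hi).1 ⟨h, h2⟩).2.1⟩, h, h2⟩
    · rintro ⟨i, ⟨hi, _⟩, h, h2⟩
      exact ⟨h, i, hi, h2⟩
  rw [h1, Finset.card_biUnion]
  · push_cast
    refine Finset.sum_congr rfl fun i₀ hi₀ => ?_
    obtain ⟨hi₀, hm⟩ := Finset.mem_filter.1 hi₀
    rw [Finset.card_eq_sum_card_fiberwise (f := fun φ => trc (A.erase i₀) φ S)
      (t := newTr Q Q' A i₀)]
    · push_cast
      refine Finset.sum_congr rfl fun I hI => ?_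
      rw [embT, ← card_filter_eq_sum_ind]
      congr 1
      have hup : ∀ (φ : V → ℕ) c, trc (A.erase i₀) (Function.update φ i₀ c) S =
          trc (A.erase i₀) φ S := by
        intro φ c
        unfold trc
        refine Finset.filter_congr fun i hi => ?_
        rw [Function.update_of_ne (Finset.ne_of_mem_erase hi)]
      refine Finset.card_bij' (fun φ _ => Function.update φ i₀ 0)
        (fun φ _ => Function.update φ i₀ (n + 1)) ?_ ?_ ?_ ?_
      · intro φ hφ
        simp only [Finset.mem_filter, mem_emb] at hφ ⊢
        obtain ⟨⟨h2, h3⟩, rfl⟩ := hφ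
        exact ⟨((isEmb_new hg hS hSm hδ hi₀).1 ⟨h2, h3⟩).2.2.2.2, hup _ _⟩
      · intro φ hφ
        simp only [Finset.mem_filter, mem_emb] at hφ ⊢
        obtain ⟨h2, rfl⟩ := hφ
        have h3 := (Finset.mem_filter.1 hI).2
        refine ⟨(isEmb_new hg hS hSm hδ hi₀).2 ⟨Function.update_self _ _ _, hm, ?_, ?_, ?_⟩,
          hup _ _⟩
        · rw [hup]; exact h3.1
        · rw [hup]; exact h3.2
        · rw [hup, Function.update_idem]
          have : φ i₀ = 0 := h2.zero i₀ (Finset.notMem_erase _ _)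
          rwa [← this, Function.update_eq_self]
      · intro φ hφ
        simp only [Finset.mem_filter, mem_emb] at hφ
        rw [Function.update_idem, ← hφ.1.2, Function.update_eq_self]
      · intro φ hφ
        simp only [Finset.mem_filter, mem_emb] at hφ
        rw [Function.update_idem, ← hφ.1.zero i₀ (Finset.notMem_erase _ _),
          Function.update_eq_self]
    · intro φ hφ
      simp only [Finset.coe_filter, Set.mem_ofPred_eq, mem_emb] at hφ
      have := (isEmb_new hg hS hSm hδ hi₀).1 hφ
      exact Finset.mem_coe.2 (Finset.mem_filter.2 ⟨Finset.mem_powerset.2 (Finset.filter_subset _ _),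
        this.2.2.1, this.2.2.2.1⟩)
  · intro i hi j hj hij
    rw [Function.onFun, Finset.disjoint_left]
    intro φ h2 h3
    simp only [Finset.mem_filter, mem_emb] at h2 h3
    exact hij (h2.1.inj i (Finset.mem_filter.1 hi).1 j (Finset.mem_filter.1 hj).1
      (h2.2.trans h3.2.symm))

lemma emb_attach (hg : UAReachable m d n g) (hS : S ⊆ lowDegSet d g n) (hSm : S.card = m)
    (hδ : ∀ i ∈ A, 1 ≤ δ i) :
    ((emb Q Q' (n + 1) (attachStep g (n + 1) S) A δ).card : ℝ) =
      ∑ I ∈ A.powerset, embT Q Q' n g A δ I S +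
      ∑ i₀ ∈ A.filter (fun i => δ i = m), ∑ I ∈ newTr Q Q' A i₀,
        embT Q Q' n g (A.erase i₀) δ I S := by
  rw [← emb_attach_old hg hδ, ← embNew_attach hg hS hSm hδ, embNew, ← Nat.cast_add,
    add_comm (Finset.card _), Finset.card_filter_add_card_filter_not]

end

end

section

section
variable {V : Type*} [Fintype V] {Q Q' : SimpleGraph V}
variable {m d n : ℕ} {g : SimpleGraph ℕ} {A : Finset V} {δ : V → ℕ}

lemma dec_empty (δ : V → ℕ) : dec δ ∅ = δ := by
  funext i; simp [dec]

lemma trc_eq_iff {I : Finset V} (hI : I ⊆ A) {φ : V → ℕ} {S : Finset ℕ} :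
    trc A φ S = I ↔ I.image φ ⊆ S ∧ Disjoint ((A \ I).image φ) S := by
  constructor
  · rintro rfl
    constructor
    · intro x hx
      obtain ⟨i, hi, rfl⟩ := Finset.mem_image.1 hx
      exact (Finset.mem_filter.1 hi).2
    · rw [Finset.disjoint_left]
      intro x hx hxS
      obtain ⟨i, hi, rfl⟩ := Finset.mem_image.1 hx
      obtain ⟨h1, h2⟩ := Finset.mem_sdiff.1 hi
      exact h2 (Finset.mem_filter.2 ⟨h1, hxS⟩)
  · rintro ⟨h1, h2⟩
    ext i
    rw [trc, Finset.mem_filter]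
    constructor
    · rintro ⟨hi, hiS⟩
      by_contra hiI
      exact Finset.disjoint_left.1 h2 (Finset.mem_image_of_mem φ (Finset.mem_sdiff.2 ⟨hi, hiI⟩)) hiS
    · intro hi
      exact ⟨hI hi, h1 (Finset.mem_image_of_mem φ hi)⟩

lemma savg_abs_sub_sum {ι : Type*} {X : Finset ℕ} {s : Finset ι} {F : ι → Finset ℕ → ℝ} {c e : ℝ}
    (h : ∀ i ∈ s, |savg X m (F i) - c| ≤ e) :
    |savg X m (fun S => ∑ i ∈ s, F i S) - s.card * c| ≤ s.card * e := by
  rw [savg_sum]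
  have : ∑ i ∈ s, savg X m (F i) - s.card * c = ∑ i ∈ s, (savg X m (F i) - c) := by
    rw [Finset.sum_sub_distrib, Finset.sum_const, nsmul_eq_mul]
  rw [this, ← nsmul_eq_mul, ← Finset.sum_const]
  exact (Finset.abs_sum_le_sum_abs _ _).trans (Finset.sum_le_sum h)

/-- Number of non-saturated vertices of the pattern. -/
noncomputable def low (d : ℕ) (δ : V → ℕ) (A : Finset V) : ℕ := (A.filter (fun i => δ i < d)).card

lemma savg_embT_empty (hd : 2 * m < d) (hg : UAReachable m d n g) :
    |savg (lowDegSet d g n) m (embT Q Q' n g A δ ∅) -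
      (emb Q Q' n g A δ).card * (1 - m * low d δ A / (lowDegSet d g n).card)| ≤
      (emb Q Q' n g A δ).card *
        ((A.card : ℝ) ^ 2 * m ^ 2 / ((lowDegSet d g n).card : ℝ) ^ 2) := by
  have hE : embT Q Q' n g A δ ∅ = fun S => ∑ φ ∈ emb Q Q' n g A δ, ind (trc A φ S = ∅) := by
    funext S; rw [embT, dec_empty]
  rw [hE]
  refine savg_abs_sub_sum fun φ hφ => ?_
  rw [mem_emb] at hφ
  have h1 := savg_disjoint (X := lowDegSet d g n) (B := A.image φ) (le_lowDegSet_card hd hg)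
  have hinj : Set.InjOn φ A := fun i hi j hj => hφ.inj i hi j hj
  have h2 : ((A.image φ) ∩ lowDegSet d g n).card = low d δ A := by
    rw [low, ← Finset.card_image_of_injOn (s := A.filter _) (f := φ)
      (hinj.mono (Finset.coe_subset.2 (Finset.filter_subset _ _)))]
    congr 1
    ext x
    simp only [Finset.mem_inter, Finset.mem_image, Finset.mem_filter, mem_lowDegSet]
    constructor
    · rintro ⟨⟨i, hi, rfl⟩, h⟩
      exact ⟨i, ⟨hi, by rw [← hφ.deg i hi]; exact h.2⟩, rfl⟩
    · rintro ⟨i, ⟨hi, h⟩, rfl⟩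
      exact ⟨⟨i, hi, rfl⟩, hφ.mem i hi, by rw [hφ.deg i hi]; exact h⟩
  rw [h2, Finset.card_image_of_injOn hinj] at h1
  refine le_of_eq_of_le ?_ h1
  congr 2
  refine savg_congr fun S _ _ => ?_
  rw [ite_eq_ind]
  congr 1
  rw [trc_eq_iff (Finset.empty_subset _)]
  simp

lemma savg_embT_main (hm : 0 < m) (hd : 2 * m < d) (hg : UAReachable m d n g) {I : Finset V}
    (hI : I ⊆ A) (hδ : ∀ i ∈ A, 1 ≤ δ i) (hδd : ∀ i ∈ A, δ i ≤ d) :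
    |savg (lowDegSet d g n) m (embT Q Q' n g A δ I) - (emb Q Q' n g A (dec δ I)).card *
      ((m.descFactorial I.card : ℝ) / ((lowDegSet d g n).card : ℝ) ^ I.card)| ≤
      (emb Q Q' n g A (dec δ I)).card *
        (((m : ℝ) ^ I.card * I.card ^ 2 + A.card * (m : ℝ) ^ (I.card + 1)) /
          ((lowDegSet d g n).card : ℝ) ^ (I.card + 1)) := by
  unfold embT
  refine savg_abs_sub_sum fun φ hφ => ?_
  rw [mem_emb] at hφ
  have hinj : Set.InjOn φ A := fun i hi j hj => hφ.inj i hi j hj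
  have hinjI := hinj.mono (Finset.coe_subset.2 hI)
  have h1 := savg_inter (X := lowDegSet d g n) (I := I.image φ) (B := (A \ I).image φ) hm
    (le_lowDegSet_card hd hg) ?_ ?_
  · rw [Finset.card_image_of_injOn hinjI] at h1
    refine le_trans (le_of_eq_of_le ?_ h1) ?_
    · congr 2
      refine savg_congr fun S _ _ => ?_
      rw [ite_eq_ind]
      congr 1
      rw [trc_eq_iff hI]
    · gcongr
      exact Finset.card_image_le.trans (Finset.card_le_card Finset.sdiff_subset)
  · intro x hx
    obtain ⟨i, hi, rfl⟩ := Finset.mem_image.1 hx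
    have h3 := hφ.deg i (hI hi)
    have := hδ i (hI hi)
    have := hδd i (hI hi)
    rw [dec, if_pos hi] at h3
    rw [mem_lowDegSet]
    exact ⟨hφ.mem i (hI hi), by omega⟩
  · rw [Finset.disjoint_left]
    intro x hx hx'
    obtain ⟨i, hi, rfl⟩ := Finset.mem_image.1 hx
    obtain ⟨j, hj, h⟩ := Finset.mem_image.1 hx'
    have := hφ.inj j (Finset.mem_sdiff.1 hj).1 i (hI hi) h
    exact (Finset.mem_sdiff.1 hj).2 (this ▸ hi)

lemma savg_embT_le (hd : 2 * m < d) (hg : UAReachable m d n g) {I : Finset V} (hI : I ⊆ A) :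
    savg (lowDegSet d g n) m (embT Q Q' n g A δ I) ≤ (emb Q Q' n g A (dec δ I)).card *
      ((m : ℝ) / (lowDegSet d g n).card) ^ I.card := by
  unfold embT
  rw [savg_sum, ← nsmul_eq_mul, ← Finset.sum_const]
  refine Finset.sum_le_sum fun φ hφ => ?_
  rw [mem_emb] at hφ
  have hinjI : Set.InjOn φ I := fun i hi j hj => hφ.inj i (hI hi) j (hI hj)
  rw [← Finset.card_image_of_injOn hinjI]
  simp only [← ite_eq_ind]
  exact savg_le_of_subset (le_lowDegSet_card hd hg) _ fun S _ h => ((trc_eq_iff hI).1 h).1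

lemma savg_embT_nonneg {I : Finset V} :
    0 ≤ savg (lowDegSet d g n) m (embT Q Q' n g A δ I) := by
  unfold savg embT
  exact div_nonneg (Finset.sum_nonneg fun S _ => Finset.sum_nonneg fun φ _ => ind_nonneg _)
    (Nat.cast_nonneg _)

lemma div_low_eq (hn : 0 < n) :
    (m : ℝ) / (lowDegSet d g n).card = rate m d n g / n := by
  rw [rate, div_div, mul_div_mul_right]
  exact_mod_cast hn.ne'

lemma div_low_le (hm : 0 < m) (hd : 2 * m < d) (hg : UAReachable m d n g) :
    (m : ℝ) / (lowDegSet d g n).card ≤ m / kap m d / n := by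
  have hn : 0 < n := hm.trans_le (reach_le hg)
  rw [div_low_eq hn]
  have := rate_le hd hg hm
  gcongr

lemma inv_low_le (hm : 0 < m) (hd : 2 * m < d) (hg : UAReachable m d n g) (r : ℕ) :
    1 / ((lowDegSet d g n).card : ℝ) ^ r ≤ (1 / kap m d) ^ r / (n : ℝ) ^ r := by
  have hn : (0 : ℝ) < n := by exact_mod_cast hm.trans_le (reach_le hg)
  have hk := kap_pos hd
  rw [← div_pow, div_div, one_div_pow]
  have := kap_mul_le hd hg
  gcongr

/-- Main term for the average of `embT` when no new vertex is used. -/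
noncomputable def mainOld (Q Q' : SimpleGraph V) (m d n : ℕ) (A : Finset V) (δ : V → ℕ)
    (I : Finset V) (g : SimpleGraph ℕ) : ℝ :=
  if I = ∅ then (emb Q Q' n g A δ).card - low d δ A / n * ((emb Q Q' n g A δ).card * rate m d n g)
  else if I.card = 1 then (emb Q Q' n g A (dec δ I)).card * rate m d n g / n else 0

lemma savg_embT_old (hm : 0 < m) (hd : 2 * m < d) {I : Finset V}
    (hI : I ⊆ A) (hδ : ∀ i ∈ A, 1 ≤ δ i) (hδd : ∀ i ∈ A, δ i ≤ d) :
    ∃ C : ℝ, 0 ≤ C ∧ ∀ n g, UAReachable m d n g →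
      |savg (lowDegSet d g n) m (embT Q Q' n g A δ I) - mainOld Q Q' m d n A δ I g| ≤
        C / (n : ℝ) ^ 2 * (emb Q Q' n g A (dec δ I)).card := by
  have hk := kap_pos hd
  by_cases h0 : I = ∅
  · subst h0
    refine ⟨(A.card : ℝ) ^ 2 * m ^ 2 * (1 / kap m d) ^ 2, by positivity, fun n g hg => ?_⟩
    have hn : 0 < n := hm.trans_le (reach_le hg)
    have h1 := savg_embT_empty (Q := Q) (Q' := Q') (A := A) (δ := δ) hd hg
    rw [mainOld, if_pos rfl, dec_empty]
    have e1 : ((emb Q Q' n g A δ).card : ℝ) - low d δ A / n * ((emb Q Q' n g A δ).card * rate m d n g)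
        = (emb Q Q' n g A δ).card * (1 - m * low d δ A / (lowDegSet d g n).card) := by
      have := div_low_eq (m := m) (d := d) (g := g) hn
      rw [mul_div_right_comm, this]
      ring
    rw [e1]
    refine h1.trans ?_
    rw [mul_comm]
    refine mul_le_mul_of_nonneg_right ?_ (Nat.cast_nonneg _)
    have := inv_low_le hm hd hg 2
    calc _ = (A.card : ℝ) ^ 2 * m ^ 2 * (1 / ((lowDegSet d g n).card : ℝ) ^ 2) := by ring
      _ ≤ (A.card : ℝ) ^ 2 * m ^ 2 * ((1 / kap m d) ^ 2 / (n : ℝ) ^ 2) := by gcongr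
      _ = _ := by ring
  by_cases h1 : I.card = 1
  · refine ⟨(m + A.card * m ^ 2) * (1 / kap m d) ^ 2, by positivity, fun n g hg => ?_⟩
    have hn : 0 < n := hm.trans_le (reach_le hg)
    have h2 := savg_embT_main (Q := Q) (Q' := Q') hm hd hg hI hδ hδd
    rw [mainOld, if_neg h0, if_pos h1, mul_div_assoc, ← div_low_eq hn]
    rw [h1] at h2
    simp only [Nat.descFactorial_one, pow_one, Nat.cast_one, one_pow, mul_one] at h2
    refine h2.trans ?_
    rw [mul_comm]
    refine mul_le_mul_of_nonneg_right ?_ (Nat.cast_nonneg _)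
    have := inv_low_le hm hd hg 2
    calc _ = ((m : ℝ) + A.card * m ^ 2) * (1 / ((lowDegSet d g n).card : ℝ) ^ 2) := by
          norm_num; ring
      _ ≤ ((m : ℝ) + A.card * m ^ 2) * ((1 / kap m d) ^ 2 / (n : ℝ) ^ 2) := by gcongr
      _ = _ := by ring
  · have h2 : 2 ≤ I.card := by
      have : I.card ≠ 0 := fun h => h0 (Finset.card_eq_zero.1 h)
      omega
    refine ⟨(m / kap m d) ^ I.card, by positivity, fun n g hg => ?_⟩
    have hn : 1 ≤ n := hm.trans_le (reach_le hg)
    have hnR : (1 : ℝ) ≤ n := by exact_mod_cast hn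
    rw [mainOld, if_neg h0, if_neg h1, sub_zero, abs_of_nonneg savg_embT_nonneg]
    refine (savg_embT_le hd hg hI).trans ?_
    rw [mul_comm]
    gcongr
    refine (pow_le_pow_left₀ (by positivity) (div_low_le hm hd hg) _).trans ?_
    rw [div_pow]
    gcongr

/-- Main term for the average of `embT` when the new vertex is used. -/
noncomputable def mainNew (Q Q' : SimpleGraph V) (m d n : ℕ) (A : Finset V) (δ : V → ℕ)
    (J I : Finset V) (g : SimpleGraph ℕ) : ℝ :=
  if I = J then (m.descFactorial J.card : ℝ) / m ^ J.card *
    ((emb Q Q' n g A (dec δ J)).card * rate m d n g ^ J.card) / (n : ℝ) ^ J.card else 0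

lemma savg_embT_new (hm : 0 < m) (hd : 2 * m < d) {I J : Finset V} (hJ : J ⊆ I)
    (hI : I ⊆ A) (hδ : ∀ i ∈ A, 1 ≤ δ i) (hδd : ∀ i ∈ A, δ i ≤ d) :
    ∃ C : ℝ, 0 ≤ C ∧ ∀ n g, UAReachable m d n g →
      |savg (lowDegSet d g n) m (embT Q Q' n g A δ I) - mainNew Q Q' m d n A δ J I g| ≤
        C / (n : ℝ) ^ (J.card + 1) * (emb Q Q' n g A (dec δ I)).card := by
  have hk := kap_pos hd
  by_cases h1 : I = J
  · subst h1
    refine ⟨((m : ℝ) ^ I.card * I.card ^ 2 + A.card * (m : ℝ) ^ (I.card + 1)) *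
      (1 / kap m d) ^ (I.card + 1), by positivity, fun n g hg => ?_⟩
    have hn : 0 < n := hm.trans_le (reach_le hg)
    have h2 := savg_embT_main (Q := Q) (Q' := Q') hm hd hg hI hδ hδd
    have hmR : (m : ℝ) ≠ 0 := by exact_mod_cast hm.ne'
    have e1 : mainNew Q Q' m d n A δ I I g = (emb Q Q' n g A (dec δ I)).card *
      ((m.descFactorial I.card : ℝ) / ((lowDegSet d g n).card : ℝ) ^ I.card) := by
      rw [mainNew, if_pos rfl, mul_div_assoc, mul_div_assoc, ← div_pow, ← div_low_eq hn,
        div_pow]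
      have : (m : ℝ) ^ I.card ≠ 0 := pow_ne_zero _ hmR
      field_simp
    rw [e1]
    refine h2.trans ?_
    rw [mul_comm]
    refine mul_le_mul_of_nonneg_right ?_ (Nat.cast_nonneg _)
    have := inv_low_le hm hd hg (I.card + 1)
    rw [div_eq_mul_one_div, mul_div_assoc]
    gcongr
  · have h2 : J.card + 1 ≤ I.card :=
      Finset.card_lt_card (hJ.ssubset_of_ne fun h => h1 h.symm)
    refine ⟨(m / kap m d) ^ I.card, by positivity, fun n g hg => ?_⟩
    have hn : 1 ≤ n := hm.trans_le (reach_le hg)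
    have hnR : (1 : ℝ) ≤ n := by exact_mod_cast hn
    rw [mainNew, if_neg h1, sub_zero, abs_of_nonneg savg_embT_nonneg]
    refine (savg_embT_le hd hg hI).trans ?_
    rw [mul_comm]
    gcongr
    refine (pow_le_pow_left₀ (by positivity) (div_low_le hm hd hg) _).trans ?_
    rw [div_pow]
    gcongr

end

end

section

lemma tendsto_zpow_ratio (χ : ℤ) :
    Tendsto (fun n : ℕ => (n : ℝ) * (((n : ℝ) / (n + 1)) ^ χ - 1)) atTop (𝓝 (-χ)) := by
  have h1 : HasDerivAt (fun x : ℝ => x ^ (-χ)) (((-χ : ℤ) : ℝ) * (1 : ℝ) ^ (-χ - 1)) 1 :=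
    hasDerivAt_zpow (-χ) 1 (Or.inl one_ne_zero)
  have h2 := h1.tendsto_slope_zero_right.comp
    ((tendsto_inv_atTop_nhdsGT_zero (𝕜 := ℝ)).comp tendsto_natCast_atTop_atTop)
  simp only [one_zpow, mul_one, Int.cast_neg] at h2
  refine h2.congr' ?_
  filter_upwards [eventually_ge_atTop 1] with n hn
  have hn : (0 : ℝ) < n := by exact_mod_cast hn
  simp only [Function.comp_apply, inv_inv, smul_eq_mul]
  rw [show (n : ℝ) / (n + 1) = (1 + (n : ℝ)⁻¹)⁻¹ by field_simp, inv_zpow']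

lemma limit_of_recursion {x : ℕ → ℝ} {χ : ℤ} {a β : ℝ} (hα : 0 < χ + a)
    (hx : ∀ᶠ n in atTop, 0 ≤ x n)
    (h : ∀ ε : ℝ, 0 < ε → ∀ᶠ n : ℕ in atTop,
      |x (n + 1) - (x n - a * x n / n + β * (n : ℝ) ^ χ / n)| ≤ ε * (x n + (n : ℝ) ^ χ) / n) :
    Tendsto (fun n : ℕ => x n / (n : ℝ) ^ χ) atTop (𝓝 (β / (χ + a))) := by
  set y : ℕ → ℝ := fun n => x n / (n : ℝ) ^ χ with hy
  set α : ℝ := χ + a with hαdef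
  set D : ℕ → ℝ := fun n => |y (n + 1) - (y n - (α * y n - β) / n)| with hD
  have key : ∀ ε : ℝ, 0 < ε → ∀ᶠ n : ℕ in atTop, D n * n / (1 + |y n|) ≤ ε := by
    intro ε hε
    set u : ℕ → ℝ := fun n => ((n : ℝ) / (n + 1)) ^ χ with hu
    have hu1 := tendsto_zpow_ratio χ
    have hu2 : Tendsto (fun n => u n - 1) atTop (𝓝 0) := by
      have := hu1.mul (tendsto_inv_atTop_zero.comp (tendsto_natCast_atTop_atTop (R := ℝ)))
      rw [mul_zero] at this
      refine this.congr' ?_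
      filter_upwards [eventually_ge_atTop 1] with n hn
      have hn : (n : ℝ) ≠ 0 := by positivity
      simp only [Function.comp_apply, hu]
      field_simp
    set M := |a| + |β| + 1 with hM
    have hMpos : 0 < M := by positivity
    have e1 := (Metric.tendsto_nhds.1 hu1) (ε / 3) (by positivity)
    have e2 := (Metric.tendsto_nhds.1 hu2) (min 1 (ε / 3 / M)) (by positivity)
    filter_upwards [e1, e2, h (ε / 6) (by positivity), hx, eventually_ge_atTop 1]
      with n h1 h2 h3 h4 h5
    have hn : (0 : ℝ) < n := by exact_mod_cast h5
    have hp : (0 : ℝ) < (n : ℝ) ^ χ := by positivity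
    have hy0 : 0 ≤ y n := by simp only [hy]; positivity
    rw [Real.dist_eq] at h1 h2
    rw [sub_zero] at h2
    rw [div_le_iff₀ (by positivity), abs_of_nonneg hy0]
    set R := x (n + 1) - (x n - a * x n / n + β * (n : ℝ) ^ χ / n) with hR
    have hyn : y (n + 1) = u n * (y n - a * y n / n + β / n + R / (n : ℝ) ^ χ) := by
      simp only [hy, hu, hR, div_zpow]
      push_cast
      field_simp
      ring
    have hR' : |n * (R / (n : ℝ) ^ χ)| ≤ ε / 6 * (1 + y n) := by
      have : ε / 6 * (1 + y n) = n * ((ε / 6 * (x n + (n : ℝ) ^ χ) / n) / (n : ℝ) ^ χ) := by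
        simp only [hy]; field_simp; ring
      rw [this, abs_mul, abs_of_pos hn, abs_div, abs_of_pos hp]
      gcongr
    have e : (y (n + 1) - (y n - (α * y n - β) / n)) * n =
        (n * (u n - 1) - (-χ)) * y n + (u n - 1) * (-a * y n + β) + u n * (n * (R / (n : ℝ) ^ χ)) := by
      rw [hyn, hαdef]; field_simp; ring
    have hu3 : |u n| ≤ 2 := by
      have : u n = (u n - 1) + 1 := by ring
      rw [this]
      refine (abs_add_le _ _).trans ?_
      have := h2.le.trans (min_le_left _ _)
      rw [abs_one]; linarith
    have f1 : |(n * (u n - 1) - (-χ)) * y n| ≤ ε / 3 * y n := by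
      rw [abs_mul, abs_of_nonneg hy0]; gcongr
    have f2 : |(u n - 1) * (-a * y n + β)| ≤ ε / 3 / M * (M * (1 + y n)) := by
      rw [abs_mul]
      refine mul_le_mul (h2.le.trans (min_le_right _ _)) ?_ (abs_nonneg _) (by positivity)
      refine (abs_add_le _ _).trans ?_
      rw [abs_mul, abs_neg, abs_of_nonneg hy0, hM]
      nlinarith [abs_nonneg a, abs_nonneg β]
    have f3 : |u n * (n * (R / (n : ℝ) ^ χ))| ≤ 2 * (ε / 6 * (1 + y n)) := by
      rw [abs_mul]; gcongr
    have f4 : ε / 3 / M * (M * (1 + y n)) = ε / 3 * (1 + y n) := by field_simp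
    have : D n * n = |(y (n + 1) - (y n - (α * y n - β) / n)) * n| := by
      rw [abs_mul, abs_of_pos hn]
    rw [this, e]
    refine (abs_add_le _ _).trans ?_
    have := abs_add_le ((n * (u n - 1) - (-χ)) * y n) ((u n - 1) * (-a * y n + β))
    nlinarith
  refine tendsto_of_linear_recursion hα (N := 1) (ε := fun n => D n * n / (1 + |y n|))
    (fun n => by positivity) ?_ ?_
  · rw [Metric.tendsto_nhds]
    intro ε hε
    filter_upwards [key (ε / 2) (by positivity)] with n hn
    rw [Real.dist_eq, sub_zero, abs_of_nonneg (by positivity)]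
    linarith
  · intro n hn
    have hn : (0 : ℝ) < n := by exact_mod_cast hn
    rw [div_mul_cancel₀ _ (by positivity), mul_div_cancel_right₀ _ hn.ne']

section
variable {m d T : ℕ} {E : ℕ → (SimpleGraph ℕ → ℝ) →ₗ[ℝ] ℝ}

lemma poly_mul_exp_small (C : ℝ) {c : ℝ} (hc : 0 < c) (z : ℤ) :
    ∀ ε : ℝ, 0 < ε → ∀ᶠ n : ℕ in atTop, C * Real.exp (-(c * n)) ≤ ε * (n : ℝ) ^ z := by
  intro ε hε
  have h1 : Tendsto (fun n : ℕ => |C| * ((n : ℝ) ^ (-z).toNat * Real.exp (-(c * n)))) atTop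
      (𝓝 (|C| * 0)) := by
    refine Tendsto.const_mul _ ?_
    have := (tendsto_rpow_mul_exp_neg_mul_atTop_nhds_zero ((-z).toNat : ℝ) c hc).comp
      (tendsto_natCast_atTop_atTop (R := ℝ))
    refine this.congr fun n => ?_
    simp [Real.rpow_natCast, neg_mul]
  rw [mul_zero] at h1
  filter_upwards [h1.eventually (gt_mem_nhds hε), eventually_ge_atTop 1] with n h2 h3
  have hn : (1 : ℝ) ≤ n := by exact_mod_cast h3
  have hn0 : (0 : ℝ) < n := by linarith
  rw [← div_le_iff₀ (by positivity)]
  refine le_trans ?_ h2.le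
  rw [div_eq_mul_inv, ← zpow_neg]
  have : (n : ℝ) ^ (-z) ≤ (n : ℝ) ^ (-z).toNat := by
    rw [← zpow_natCast]
    exact zpow_le_zpow_right₀ hn (Int.self_le_toNat _)
  calc C * Real.exp (-(c * n)) * (n : ℝ) ^ (-z) ≤ |C| * Real.exp (-(c * n)) * (n : ℝ) ^ (-z).toNat := by
        gcongr
        exact le_abs_self C
    _ = _ := by ring

lemma E_mul_rate (hm : 0 < m) (hd : 2 * m < d) {θ : ℝ} (hθm : m ≤ θ)
    (hθ : rateFun m d θ = m) (hE : Chain m d T E) {f : ℕ → SimpleGraph ℕ → ℝ} {q : ℕ}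
    (hf0 : ∀ n g, UAReachable m d n g → 0 ≤ f n g)
    (hf : ∀ n g, UAReachable m d n g → f n g ≤ (n : ℝ) ^ q) (r : ℕ) (z : ℤ) :
    ∀ ε : ℝ, 0 < ε → ∀ᶠ n : ℕ in atTop,
      |E n (fun g => f n g * rate m d n g ^ r) - θ ^ r * E n (f n)| ≤
        ε * (E n (f n) + (n : ℝ) ^ z) := by
  intro ε hε
  have hcont : Tendsto (fun x : ℝ => x ^ r) (𝓝 θ) (𝓝 (θ ^ r)) := (continuous_pow r).tendsto θ
  obtain ⟨η, hη, hη2⟩ := Metric.tendsto_nhds_nhds.1 hcont ε hε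
  obtain ⟨C, c, hC, hc, hN⟩ := rate_concentration hm hd hθm hθ hE (half_pos hη)
  set K := (m / kap m d) ^ r + θ ^ r with hK
  have hθ0 : 0 ≤ θ := le_trans (Nat.cast_nonneg m) hθm
  have hk := kap_pos hd
  have hK0 : 0 ≤ K := by positivity
  filter_upwards [hN, eventually_ge_atTop T, poly_mul_exp_small (K * C) hc (z - q) ε hε,
    eventually_ge_atTop 1] with n h1 h2 h3 h4
  have hn0 : (0 : ℝ) < n := by exact_mod_cast h4
  have hpt : ∀ g, UAReachable m d n g → |f n g * rate m d n g ^ r - θ ^ r * f n g| ≤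
      ε * f n g + K * (n : ℝ) ^ q * ind (η / 2 < |rate m d n g - θ|) := by
    intro g hg
    have hf0' := hf0 n g hg
    have e1 : f n g * rate m d n g ^ r - θ ^ r * f n g = f n g * (rate m d n g ^ r - θ ^ r) := by
      ring
    rw [e1, abs_mul, abs_of_nonneg hf0']
    by_cases hb : η / 2 < |rate m d n g - θ|
    · rw [ind_pos hb]
      have hr0 : 0 ≤ rate m d n g := le_trans (Nat.cast_nonneg m) (le_rate hd hg hm)
      have : |rate m d n g ^ r - θ ^ r| ≤ K := by
        have h5 : rate m d n g ^ r ≤ (m / kap m d) ^ r :=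
          pow_le_pow_left₀ hr0 (rate_le hd hg hm) r
        have h6 : 0 ≤ rate m d n g ^ r := by positivity
        have h7 : 0 ≤ θ ^ r := by positivity
        have h8 : 0 ≤ (m / kap m d) ^ r := by positivity
        rw [abs_le]
        constructor <;> linarith
      have h9 : f n g * |rate m d n g ^ r - θ ^ r| ≤ (n : ℝ) ^ q * K :=
        mul_le_mul (hf n g hg) this (abs_nonneg _) (by positivity)
      nlinarith [mul_nonneg hε.le hf0']
    · rw [ind_neg hb, mul_zero, add_zero, mul_comm]
      refine mul_le_mul_of_nonneg_right ?_ hf0'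
      have : dist (rate m d n g) θ < η := by rw [Real.dist_eq]; linarith
      exact (hη2 this).le
  have h5 : |E n (fun g => f n g * rate m d n g ^ r - θ ^ r * f n g)| ≤
      E n (fun g => ε * f n g + K * (n : ℝ) ^ q * ind (η / 2 < |rate m d n g - θ|)) := by
    rw [abs_le]
    constructor
    · rw [← map_neg]
      refine hE.mono n h2 _ _ fun g hg => ?_
      have := (abs_le.1 (hpt g hg)).1
      exact this
    · exact hE.mono n h2 _ _ fun g hg => (abs_le.1 (hpt g hg)).2
  have e2 : E n (fun g => f n g * rate m d n g ^ r - θ ^ r * f n g) =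
      E n (fun g => f n g * rate m d n g ^ r) - θ ^ r * E n (f n) := by
    rw [← smul_eq_mul, ← map_smul, ← map_sub]; rfl
  have e3 : E n (fun g => ε * f n g + K * (n : ℝ) ^ q * ind (η / 2 < |rate m d n g - θ|)) =
      ε * E n (f n) + K * (n : ℝ) ^ q * E n (fun g => ind (η / 2 < |rate m d n g - θ|)) := by
    rw [← smul_eq_mul ε, ← smul_eq_mul (K * (n : ℝ) ^ q), ← map_smul, ← map_smul, ← map_add]; rfl
  rw [e2, e3] at h5
  refine h5.trans ?_
  rw [mul_add]
  refine add_le_add le_rfl ?_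
  calc K * (n : ℝ) ^ q * E n (fun g => ind (η / 2 < |rate m d n g - θ|)) ≤
      K * (n : ℝ) ^ q * (C * Real.exp (-(c * n))) := by gcongr
    _ = (n : ℝ) ^ q * (K * C * Real.exp (-(c * n))) := by ring
    _ ≤ (n : ℝ) ^ q * (ε * (n : ℝ) ^ (z - q)) := by gcongr
    _ = ε * (n : ℝ) ^ z := by
      rw [zpow_sub₀ hn0.ne', zpow_natCast]; field_simp

lemma tendsto_E_mul_rate (hm : 0 < m) (hd : 2 * m < d) {θ : ℝ} (hθm : m ≤ θ)
    (hθ : rateFun m d θ = m) (hE : Chain m d T E) {f : ℕ → SimpleGraph ℕ → ℝ} {q : ℕ}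
    (hf0 : ∀ n g, UAReachable m d n g → 0 ≤ f n g)
    (hf : ∀ n g, UAReachable m d n g → f n g ≤ (n : ℝ) ^ q) (r : ℕ) {z : ℤ} {t : ℝ}
    (ht : Tendsto (fun n => E n (f n) / (n : ℝ) ^ z) atTop (𝓝 t)) :
    Tendsto (fun n => E n (fun g => f n g * rate m d n g ^ r) / (n : ℝ) ^ z) atTop
      (𝓝 (θ ^ r * t)) := by
  have h1 : Tendsto (fun n => E n (fun g => f n g * rate m d n g ^ r) / (n : ℝ) ^ z -
      θ ^ r * (E n (f n) / (n : ℝ) ^ z)) atTop (𝓝 0) := by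
    rw [Metric.tendsto_nhds]
    intro ε hε
    have h2 := ht.abs.eventually (gt_mem_nhds (lt_add_one |t|))
    filter_upwards [h2, E_mul_rate hm hd hθm hθ hE hf0 hf r z (ε / 2 / (|t| + 2)) (by positivity),
      eventually_ge_atTop 1] with n h2 h3 h4
    have hn0 : (0 : ℝ) < n := by exact_mod_cast h4
    have hp : (0 : ℝ) < (n : ℝ) ^ z := by positivity
    rw [Real.dist_eq, sub_zero, ← mul_div_assoc, ← sub_div, abs_div, abs_of_pos hp, div_lt_iff₀ hp]
    refine lt_of_le_of_lt h3 ?_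
    have h5 : E n (f n) < (|t| + 1) * (n : ℝ) ^ z := by
      rw [← div_lt_iff₀ hp]; exact (le_abs_self _).trans_lt h2
    calc ε / 2 / (|t| + 2) * (E n (f n) + (n : ℝ) ^ z) ≤
        ε / 2 / (|t| + 2) * ((|t| + 1) * (n : ℝ) ^ z + (n : ℝ) ^ z) := by gcongr
      _ = ε / 2 * (n : ℝ) ^ z := by field_simp; ring
      _ < ε * (n : ℝ) ^ z := by nlinarith
  have := h1.add (ht.const_mul (θ ^ r))
  simpa using this

end

end

section

section
variable {V : Type*}

/-- The number of edges of `G` inside `B`. -/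
noncomputable def eC (G : SimpleGraph V) (B : Finset V) : ℕ := (∑ x ∈ B, (nbr G B x).card) / 2

lemma sum_nbr_insert [DecidableEq V] (G : SimpleGraph V) {B : Finset V} {i : V} (hi : i ∉ B) :
    ∑ x ∈ insert i B, (nbr G (insert i B) x).card =
      ∑ x ∈ B, (nbr G B x).card + 2 * (nbr G B i).card := by
  rw [Finset.sum_insert hi]
  have h1 : nbr G (insert i B) i = nbr G B i := by
    rw [nbr, Finset.filter_insert, if_neg (G.loopless.irrefl i), nbr]
  have h2 : ∀ x ∈ B, (nbr G (insert i B) x).card = (nbr G B x).card + if G.Adj i x then 1 else 0 := by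
    intro x hx
    rw [nbr, Finset.filter_insert]
    by_cases h : G.Adj i x
    · rw [if_pos h.symm, if_pos h, Finset.card_insert_of_notMem, nbr]
      simp [hi]
    · rw [if_neg (fun h' => h h'.symm), if_neg h, nbr, add_zero]
  rw [h1, Finset.sum_congr rfl h2, Finset.sum_add_distrib, ← Finset.card_filter]
  change _ + (_ + (nbr G B i).card) = _
  ring

lemma two_mul_eC (G : SimpleGraph V) (B : Finset V) :
    2 * eC G B = ∑ x ∈ B, (nbr G B x).card := by
  refine Nat.mul_div_cancel' ?_
  induction B using Finset.induction_on with
  | empty => simp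
  | insert i B hi ih =>
    rw [sum_nbr_insert G hi]
    exact dvd_add ih (dvd_mul_right _ _)

lemma eC_empty (G : SimpleGraph V) : eC G ∅ = 0 := by simp [eC]

lemma eC_insert [DecidableEq V] (G : SimpleGraph V) {B : Finset V} {i : V} (hi : i ∉ B) :
    eC G (insert i B) = eC G B + (nbr G B i).card := by
  have h1 := two_mul_eC G (insert i B)
  have h2 := two_mul_eC G B
  rw [sum_nbr_insert G hi] at h1
  omega

/-- Vertices minus edges. -/
noncomputable def chi (Q : SimpleGraph V) (A : Finset V) : ℤ := (A.card : ℤ) - eC Q A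

lemma chi_erase (Q : SimpleGraph V) {A : Finset V} {i : V} (hi : i ∈ A) :
    chi Q (A.erase i) = chi Q A - 1 + (nbr Q (A.erase i) i).card := by
  have h1 := eC_insert Q (Finset.notMem_erase i A)
  rw [Finset.insert_erase hi] at h1
  have h2 := Finset.card_erase_add_one hi
  unfold chi
  omega

/-- `B` is a union of components of `Q` restricted to `A`. -/
def ClosedIn (Q : SimpleGraph V) (A B : Finset V) : Prop :=
  ∀ x ∈ B, ∀ y ∈ A, Q.Adj x y → y ∈ B

/-- Patterns whose expected number of copies is of order `n ^ chi`. -/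
structure Good (Q : SimpleGraph V) (d : ℕ) (A : Finset V) (δ : V → ℕ) : Prop where
  le : ∀ i ∈ A, δ i ≤ d
  exc : ∀ B, B ⊆ A → eC Q B ≤ B.card + 1
  cl : ∀ B, B ⊆ A → B.Nonempty → ClosedIn Q A B → eC Q B + 1 ≤ B.card + 2 * low d δ B

lemma dec_le (δ : V → ℕ) (I : Finset V) (i : V) : dec δ I i ≤ δ i := Nat.sub_le _ _

lemma low_mono {d : ℕ} {δ δ' : V → ℕ} {B : Finset V} (h : ∀ i ∈ B, δ' i ≤ δ i) :
    low d δ B ≤ low d δ' B := by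
  refine Finset.card_le_card fun i hi => ?_
  simp only [Finset.mem_filter] at hi ⊢
  exact ⟨hi.1, (h i hi.1).trans_lt hi.2⟩

lemma Good.dec {Q : SimpleGraph V} {d : ℕ} {A : Finset V} {δ : V → ℕ} (h : Good Q d A δ)
    (I : Finset V) : Good Q d A (dec δ I) where
  le i hi := (dec_le δ I i).trans (h.le i hi)
  exc := h.exc
  cl B hB hBn hBc := (h.cl B hB hBn hBc).trans
    (by have := low_mono (d := d) (B := B) fun i _ => dec_le δ I i; omega)

lemma Good.erase {Q : SimpleGraph V} {d : ℕ} {A : Finset V} {δ : V → ℕ} (h : Good Q d A δ)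
    (hδ : ∀ i ∈ A, 1 ≤ δ i) {i₀ : V} {I : Finset V} (hI : nbr Q (A.erase i₀) i₀ ⊆ I) :
    Good Q d (A.erase i₀) (UA.dec δ I) where
  le i hi := (dec_le δ I i).trans (h.le i (Finset.mem_of_mem_erase hi))
  exc B hB := h.exc B (hB.trans (Finset.erase_subset _ _))
  cl B hB hBn hBc := by
    have hBA := hB.trans (Finset.erase_subset i₀ A)
    by_cases hx : ∃ x ∈ B, Q.Adj x i₀
    · obtain ⟨x, hxB, hx⟩ := hx
      have h1 := h.exc B hBA
      have h2 : 1 ≤ low d (UA.dec δ I) B := by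
        refine Finset.card_pos.2 ⟨x, Finset.mem_filter.2 ⟨hxB, ?_⟩⟩
        have hxI : x ∈ I := hI (Finset.mem_filter.2 ⟨hB hxB, hx.symm⟩)
        have := hδ x (hBA hxB)
        have := h.le x (hBA hxB)
        simp only [UA.dec, if_pos hxI]
        omega
      omega
    · push Not at hx
      refine (h.cl B hBA hBn fun x hxB y hy hxy => ?_).trans
        (by have := low_mono (d := d) (B := B) fun i _ => dec_le δ I i; omega)
      refine hBc x hxB y (Finset.mem_erase.2 ⟨?_, hy⟩) hxy
      rintro rfl
      exact hx x hxB hxy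

end

section
variable {m d T : ℕ} {E : ℕ → (SimpleGraph ℕ → ℝ) →ₗ[ℝ] ℝ}

lemma Chain.mul (_ : Chain m d T E) (n : ℕ) (c : ℝ) (f : SimpleGraph ℕ → ℝ) :
    E n (fun g => c * f g) = c * E n f := by
  rw [← smul_eq_mul, ← map_smul]; rfl

lemma Chain.sub (_ : Chain m d T E) (n : ℕ) (f f' : SimpleGraph ℕ → ℝ) :
    E n (fun g => f g - f' g) = E n f - E n f' := by
  rw [← map_sub]; rfl

lemma Chain.add (_ : Chain m d T E) (n : ℕ) (f f' : SimpleGraph ℕ → ℝ) :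
    E n (fun g => f g + f' g) = E n f + E n f' := by
  rw [← map_add]; rfl

lemma Chain.sum (_ : Chain m d T E) (n : ℕ) {ι : Type*} (s : Finset ι)
    (f : ι → SimpleGraph ℕ → ℝ) :
    E n (fun g => ∑ i ∈ s, f i g) = ∑ i ∈ s, E n (f i) := by
  rw [← map_sum]
  congr 1
  funext g
  rw [Finset.sum_apply]

lemma tendsto_E_main (hm : 0 < m) (hd : 2 * m < d) {θ : ℝ} (hθm : m ≤ θ)
    (hθ : rateFun m d θ = m) (hE : Chain m d T E) {f F : ℕ → SimpleGraph ℕ → ℝ} {q : ℕ}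
    (hf0 : ∀ n g, UAReachable m d n g → 0 ≤ f n g)
    (hf : ∀ n g, UAReachable m d n g → f n g ≤ (n : ℝ) ^ q) {r s : ℕ} {z : ℤ} {t c C : ℝ}
    (ht : Tendsto (fun n => E n (f n) / (n : ℝ) ^ z) atTop (𝓝 t))
    (hF : ∀ n g, UAReachable m d n g →
      |F n g - c * (f n g * rate m d n g ^ r) / (n : ℝ) ^ s| ≤ C / (n : ℝ) ^ (s + 1) * f n g) :
    Tendsto (fun n => E n (F n) / (n : ℝ) ^ (z - s)) atTop (𝓝 (c * (θ ^ r * t))) := by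
  have h1 := (tendsto_E_mul_rate hm hd hθm hθ hE hf0 hf r ht).const_mul c
  have h2 : Tendsto (fun n : ℕ => C / (n : ℝ) * (E n (f n) / (n : ℝ) ^ z)) atTop (𝓝 (0 * t)) :=
    (tendsto_const_div_atTop_nhds_zero_nat C).mul ht
  rw [zero_mul] at h2
  have h3 : Tendsto (fun n => E n (F n) / (n : ℝ) ^ (z - s) -
      c * (E n (fun g => f n g * rate m d n g ^ r) / (n : ℝ) ^ z)) atTop (𝓝 0) := by
    refine squeeze_zero_norm' ?_ h2
    filter_upwards [eventually_ge_atTop T, eventually_ge_atTop 1] with n hn hn1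
    have hn0 : (0 : ℝ) < n := by exact_mod_cast hn1
    have h4 := hE.abs_le hn (hF n)
    have e1 : E n (fun g => F n g - c * (f n g * rate m d n g ^ r) / (n : ℝ) ^ s) =
        E n (F n) - c / (n : ℝ) ^ s * E n (fun g => f n g * rate m d n g ^ r) := by
      rw [hE.sub, ← hE.mul]
      congr 2
      funext g
      ring
    rw [e1, hE.mul] at h4
    have e2 : E n (F n) / (n : ℝ) ^ (z - s) -
      c * (E n (fun g => f n g * rate m d n g ^ r) / (n : ℝ) ^ z) =
        (E n (F n) - c / (n : ℝ) ^ s * E n (fun g => f n g * rate m d n g ^ r)) /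
          (n : ℝ) ^ (z - s) := by
      rw [zpow_sub₀ hn0.ne', zpow_natCast]; field_simp
    rw [e2, Real.norm_eq_abs, abs_div, abs_of_pos (zpow_pos hn0 _), div_le_iff₀ (zpow_pos hn0 _)]
    refine h4.trans (le_of_eq ?_)
    rw [zpow_sub₀ hn0.ne', zpow_natCast, pow_succ]
    field_simp
  have h5 := h3.add h1
  rw [zero_add] at h5
  exact h5.congr fun n => by ring

variable {V : Type*} [Fintype V] {Q Q' : SimpleGraph V}

/-- The expected number of copies of the pattern, normalized, has a limit which does not depend
on the chain. -/
def HasLim (m d : ℕ) (Q Q' : SimpleGraph V) (A : Finset V) (δ : V → ℕ) : Prop :=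
  ∃ t : ℝ, ∀ T E, Chain m d T E →
    Tendsto (fun n => E n (fun g => ((emb Q Q' n g A δ).card : ℝ)) / (n : ℝ) ^ chi Q A)
      atTop (𝓝 t)

lemma emb_card_le_real (n : ℕ) (g : SimpleGraph ℕ) (A : Finset V) (δ : V → ℕ) :
    ((emb Q Q' n g A δ).card : ℝ) ≤ (n : ℝ) ^ A.card := by
  exact_mod_cast emb_card_le

lemma lim_old (hm : 0 < m) (hd : 2 * m < d) {A : Finset V} {δ : V → ℕ} {I : Finset V}
    (hI : I ⊆ A) (hI0 : I ≠ ∅) (hδ : ∀ i ∈ A, 1 ≤ δ i) (hδd : ∀ i ∈ A, δ i ≤ d)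
    (h : HasLim m d Q Q' A (dec δ I)) :
    ∃ b : ℝ, ∀ T E, Chain m d T E →
      Tendsto (fun n => E n (fun g => savg (lowDegSet d g n) m (embT Q Q' n g A δ I)) /
        (n : ℝ) ^ (chi Q A - 1)) atTop (𝓝 b) := by
  obtain ⟨θ, hθm, hθ⟩ := exists_rateFun_eq hm hd
  obtain ⟨t, ht⟩ := h
  obtain ⟨C, -, hC⟩ := savg_embT_old (Q := Q) (Q' := Q') hm hd hI hδ hδd
  refine ⟨(if I.card = 1 then 1 else 0) * (θ ^ 1 * t), fun T E hE => ?_⟩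
  refine tendsto_E_main (s := 1) (q := A.card) (C := C) hm hd hθm hθ hE
    (fun n g _ => Nat.cast_nonneg _) (fun n g _ => emb_card_le_real n g A _) (ht T E hE) ?_
  intro n g hg
  refine le_trans (le_of_eq ?_) (hC n g hg)
  rw [mainOld, if_neg hI0]
  split_ifs <;> simp

lemma lim_new (hm : 0 < m) (hd : 2 * m < d) {A : Finset V} {δ : V → ℕ}
    (hδ : ∀ i ∈ A, 1 ≤ δ i) (hδd : ∀ i ∈ A, δ i ≤ d)
    (h : ∀ i₀ ∈ A, ∀ I ∈ newTr Q Q' A i₀, HasLim m d Q Q' (A.erase i₀) (dec δ I)) :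
    ∃ b : ℝ, ∀ T E, Chain m d T E →
      Tendsto (fun n => E n (fun g => ∑ i₀ ∈ A.filter (fun i => δ i = m), ∑ I ∈ newTr Q Q' A i₀,
        savg (lowDegSet d g n) m (embT Q Q' n g (A.erase i₀) δ I)) /
          (n : ℝ) ^ (chi Q A - 1)) atTop (𝓝 b) := by
  obtain ⟨θ, hθm, hθ⟩ := exists_rateFun_eq hm hd
  have key : ∀ i₀ I, i₀ ∈ A → I ∈ newTr Q Q' A i₀ → ∃ b : ℝ, ∀ T E, Chain m d T E →
      Tendsto (fun n => E n (fun g =>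
        savg (lowDegSet d g n) m (embT Q Q' n g (A.erase i₀) δ I)) /
          (n : ℝ) ^ (chi Q A - 1)) atTop (𝓝 b) := by
    intro i₀ I hi₀ hI
    obtain ⟨t, ht⟩ := h i₀ hi₀ I hI
    simp only [newTr, Finset.mem_filter, Finset.mem_powerset] at hI
    obtain ⟨C, -, hC⟩ := savg_embT_new (Q := Q) (Q' := Q') hm hd hI.2.1 hI.1
      (fun i hi => hδ i (Finset.mem_of_mem_erase hi)) (fun i hi => hδd i (Finset.mem_of_mem_erase hi))
    set J := nbr Q (A.erase i₀) i₀ with hJ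
    refine ⟨(if I = J then (m.descFactorial J.card : ℝ) / m ^ J.card else 0) * (θ ^ J.card * t),
      fun T E hE => ?_⟩
    have e : chi Q A - 1 = chi Q (A.erase i₀) - J.card := by
      rw [chi_erase Q hi₀]; ring
    rw [e]
    refine tendsto_E_main (s := J.card) (q := (A.erase i₀).card) (C := C) hm hd hθm hθ hE
      (fun n g _ => Nat.cast_nonneg _) (fun n g _ => emb_card_le_real n g _ _) (ht T E hE) ?_
    intro n g hg
    refine le_trans (le_of_eq ?_) (hC n g hg)
    rw [mainNew]
    split_ifs with hIJ
    · rw [hIJ]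
    · simp
  choose! b hb using key
  refine ⟨∑ i₀ ∈ A.filter (fun i => δ i = m), ∑ I ∈ newTr Q Q' A i₀, b i₀ I, fun T E hE => ?_⟩
  have : Tendsto (fun n => ∑ i₀ ∈ A.filter (fun i => δ i = m), ∑ I ∈ newTr Q Q' A i₀,
      E n (fun g => savg (lowDegSet d g n) m (embT Q Q' n g (A.erase i₀) δ I)) /
          (n : ℝ) ^ (chi Q A - 1)) atTop
      (𝓝 (∑ i₀ ∈ A.filter (fun i => δ i = m), ∑ I ∈ newTr Q Q' A i₀, b i₀ I)) :=
    tendsto_finsetSum _ fun i hi => tendsto_finsetSum _ fun I hI =>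
      hb i I (Finset.mem_filter.1 hi).1 hI T E hE
  refine this.congr fun n => ?_
  rw [hE.sum, Finset.sum_div]
  refine Finset.sum_congr rfl fun i _ => ?_
  rw [hE.sum, Finset.sum_div]

lemma sum_dec_lt {A I : Finset V} {δ : V → ℕ} (hI : I ⊆ A) (hI0 : I ≠ ∅) (hδ : ∀ i ∈ A, 1 ≤ δ i) :
    ∑ i ∈ A, dec δ I i < ∑ i ∈ A, δ i := by
  obtain ⟨i, hi⟩ := Finset.nonempty_iff_ne_empty.2 hI0
  refine Finset.sum_lt_sum (fun i _ => dec_le δ I i) ⟨i, hI hi, ?_⟩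
  have := hδ i (hI hi)
  simp only [dec, if_pos hi]
  omega

/-- Expected numbers of copies of good patterns converge after normalization. -/
theorem pattern_limit (hm : 2 ≤ m) (hd : 2 * m < d) {A : Finset V} {δ : V → ℕ}
    (hG : Good Q d A δ) : HasLim m d Q Q' A δ := by
  have hm0 : 0 < m := by omega
  induction hN : A.card + ∑ i ∈ A, δ i using Nat.strong_induction_on generalizing A δ with
  | _ N ih =>
  by_cases hA : A = ∅
  · subst hA
    refine ⟨1, fun T E hE => ?_⟩
    refine tendsto_const_nhds.congr' ?_
    filter_upwards [eventually_ge_atTop T] with n hn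
    have : ∀ g, ((emb Q Q' n g ∅ δ).card : ℝ) = 1 := by
      intro g
      have : emb Q Q' n g ∅ δ = {fun _ => 0} := by
        ext φ
        rw [mem_emb, Finset.mem_singleton]
        constructor
        · intro h
          funext i
          exact h.zero i (Finset.notMem_empty i)
        · rintro rfl
          exact ⟨by simp, by simp, by simp, by simp, by simp, by simp⟩
      rw [this]; simp
    simp only [this]
    rw [hE.one n hn]
    simp [chi, eC_empty]
  by_cases hδ : ∃ i ∈ A, δ i = 0
  · obtain ⟨i, hi, hi0⟩ := hδ
    refine ⟨0, fun T E hE => ?_⟩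
    refine tendsto_const_nhds.congr' ?_
    filter_upwards [eventually_ge_atTop T] with n hn
    have : E n (fun g => ((emb Q Q' n g A δ).card : ℝ)) = E n (fun _ => 0) := by
      refine hE.congr hn fun g hg => ?_
      rw [Nat.cast_eq_zero, Finset.card_eq_zero, Finset.eq_empty_iff_forall_notMem]
      intro φ hφ
      rw [mem_emb] at hφ
      have h1 := hφ.deg i hi
      have h2 := reach_le_deg hg (hφ.mem i hi)
      omega
    rw [this, hE.const hn, zero_div]
  push Not at hδ
  have hδ1 : ∀ i ∈ A, 1 ≤ δ i := fun i hi => Nat.one_le_iff_ne_zero.2 (hδ i hi)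
  have hold : ∀ I, I ∈ A.powerset.erase ∅ → ∃ b : ℝ, ∀ T E, Chain m d T E →
      Tendsto (fun n => E n (fun g => savg (lowDegSet d g n) m (embT Q Q' n g A δ I)) /
        (n : ℝ) ^ (chi Q A - 1)) atTop (𝓝 b) := by
    intro I hI
    rw [Finset.mem_erase, Finset.mem_powerset] at hI
    refine lim_old hm0 hd hI.2 hI.1 hδ1 hG.le (ih _ ?_ (hG.dec I) rfl)
    have := sum_dec_lt hI.2 hI.1 hδ1
    omega
  obtain ⟨b', hb'⟩ := lim_new (Q := Q) (Q' := Q') hm0 hd hδ1 hG.le (by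
    intro i₀ hi₀ I hI
    simp only [newTr, Finset.mem_filter, Finset.mem_powerset] at hI
    refine ih _ ?_ (hG.erase hδ1 hI.2.1) rfl
    have h1 := Finset.card_erase_add_one hi₀
    have h2 : ∑ i ∈ A.erase i₀, dec δ I i ≤ ∑ i ∈ A, δ i :=
      (Finset.sum_le_sum fun i _ => dec_le δ I i).trans
        (Finset.sum_le_sum_of_subset (Finset.erase_subset _ _))
    omega)
  choose! b hb using hold
  obtain ⟨θ, hθm, hθ⟩ := exists_rateFun_eq hm0 hd
  obtain ⟨C, hC0, hC⟩ := savg_embT_old (Q := Q) (Q' := Q') hm0 hd (Finset.empty_subset A) hδ1 hG.le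
  set β : ℝ := ∑ I ∈ A.powerset.erase ∅, b I + b' with hβ
  refine ⟨β / (chi Q A + low d δ A * θ), fun T E hE => ?_⟩
  set x : ℕ → ℝ := fun n => E n (fun g => ((emb Q Q' n g A δ).card : ℝ)) with hx
  have hx0 : ∀ n, T ≤ n → 0 ≤ x n := fun n hn => hE.nonneg hn fun g _ => Nat.cast_nonneg _
  refine limit_of_recursion (x := x) ?_ ?_ ?_
  · have h1 := hG.cl A subset_rfl (Finset.nonempty_iff_ne_empty.2 hA) (fun x _ y hy _ => hy)
    have h2 : (1 : ℝ) ≤ chi Q A + low d δ A * 2 := by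
      have : (1 : ℤ) ≤ chi Q A + low d δ A * 2 := by unfold chi; omega
      exact_mod_cast this
    have h3 : (2 : ℝ) ≤ θ := le_trans (by exact_mod_cast hm) hθm
    nlinarith [mul_le_mul_of_nonneg_left h3 (Nat.cast_nonneg (α := ℝ) (low d δ A))]
  · filter_upwards [eventually_ge_atTop T] with n hn using hx0 n hn
  intro ε hε
  have hrest : Tendsto (fun n => (∑ I ∈ A.powerset.erase ∅,
      E n (fun g => savg (lowDegSet d g n) m (embT Q Q' n g A δ I)) +
      E n (fun g => ∑ i₀ ∈ A.filter (fun i => δ i = m), ∑ I ∈ newTr Q Q' A i₀,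
        savg (lowDegSet d g n) m (embT Q Q' n g (A.erase i₀) δ I))) /
          (n : ℝ) ^ (chi Q A - 1)) atTop (𝓝 β) := by
    have := (tendsto_finsetSum (A.powerset.erase ∅) fun I hI => hb I hI T E hE).add (hb' T E hE)
    refine this.congr fun n => ?_
    rw [add_div, Finset.sum_div]
  have hrate := E_mul_rate hm0 hd hθm hθ hE (f := fun n g => ((emb Q Q' n g A δ).card : ℝ))
    (q := A.card) (fun n g _ => Nat.cast_nonneg _) (fun n g _ => emb_card_le_real n g A δ) 1
    (chi Q A) (ε / 3 / (low d δ A + 1)) (by positivity)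
  have hCsmall : ∀ᶠ n : ℕ in atTop, C / (n : ℝ) ≤ ε / 3 :=
    ((tendsto_const_div_atTop_nhds_zero_nat C).eventually_lt_const
      (show (0 : ℝ) < ε / 3 by positivity)).mono fun n h => h.le
  filter_upwards [eventually_ge_atTop T, eventually_ge_atTop 1,
    (Metric.tendsto_nhds.1 hrest) (ε / 3) (by positivity), hrate, hCsmall] with n hn hn1 h1 h2 h3
  have hn0 : (0 : ℝ) < n := by exact_mod_cast hn1
  set R := ∑ I ∈ A.powerset.erase ∅,
      E n (fun g => savg (lowDegSet d g n) m (embT Q Q' n g A δ I)) +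
      E n (fun g => ∑ i₀ ∈ A.filter (fun i => δ i = m), ∑ I ∈ newTr Q Q' A i₀,
        savg (lowDegSet d g n) m (embT Q Q' n g (A.erase i₀) δ I)) with hR
  set E0 := E n (fun g => savg (lowDegSet d g n) m (embT Q Q' n g A δ ∅)) with hE0
  have hxs : x (n + 1) = E0 + R := by
    rw [hx, hR, ← add_assoc, hE0]
    simp only
    rw [hE.step n hn, Finset.add_sum_erase A.powerset (fun I => E n (fun g =>
      savg (lowDegSet d g n) m (embT Q Q' n g A δ I))) (Finset.empty_mem_powerset A),
      ← hE.sum, ← hE.add]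
    refine hE.congr hn fun g hg => ?_
    rw [stepL_apply]
    simp only [← savg_sum]
    rw [← savg_add]
    exact savg_congr fun S hS hSm => emb_attach hg hS hSm hδ1
  have hp : (0 : ℝ) < (n : ℝ) ^ chi Q A := zpow_pos hn0 _
  have hR1 : |R - β * (n : ℝ) ^ chi Q A / n| ≤ ε / 3 * (n : ℝ) ^ chi Q A / n := by
    rw [Real.dist_eq, zpow_sub_one₀ hn0.ne'] at h1
    have e : R - β * (n : ℝ) ^ chi Q A / n =
        (R / ((n : ℝ) ^ chi Q A * (n : ℝ)⁻¹) - β) * ((n : ℝ) ^ chi Q A / n) := by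
      field_simp
    rw [e, abs_mul, abs_of_pos (div_pos hp hn0), mul_div_assoc]
    exact mul_le_mul_of_nonneg_right h1.le (div_pos hp hn0).le
  have hE1 : |E0 - (x n - low d δ A / n * E n (fun g => ((emb Q Q' n g A δ).card : ℝ) *
      rate m d n g))| ≤ C / (n : ℝ) ^ 2 * x n := by
    have := hE.abs_le hn (hC n)
    simp only [mainOld, if_true, dec_empty] at this
    rw [hE.sub, hE.sub, hE.mul, hE.mul] at this
    exact this
  simp only [pow_one] at h2
  set P := E n (fun g => ((emb Q Q' n g A δ).card : ℝ) * rate m d n g) with hP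
  change |P - θ * x n| ≤ ε / 3 / (low d δ A + 1) * (x n + (n : ℝ) ^ chi Q A) at h2
  set L : ℝ := (low d δ A : ℝ) with hL
  have hL0 : 0 ≤ L := Nat.cast_nonneg _
  have hxn := hx0 n hn
  have h4 : |L / n * (P - θ * x n)| ≤ ε / 3 * (x n + (n : ℝ) ^ chi Q A) / n := by
    rw [abs_mul, abs_of_nonneg (by positivity)]
    calc L / n * |P - θ * x n| ≤ L / n * (ε / 3 / (L + 1) * (x n + (n : ℝ) ^ chi Q A)) :=
          mul_le_mul_of_nonneg_left h2 (by positivity)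
      _ = (L / (L + 1)) * (ε / 3 * (x n + (n : ℝ) ^ chi Q A) / n) := by field_simp
      _ ≤ 1 * (ε / 3 * (x n + (n : ℝ) ^ chi Q A) / n) := by
          refine mul_le_mul_of_nonneg_right ?_ (by positivity)
          rw [div_le_one (by positivity)]; linarith
      _ = _ := one_mul _
  have h5 : C / (n : ℝ) ^ 2 * x n ≤ ε / 3 * x n / n := by
    have : C / (n : ℝ) ^ 2 * x n = (C / n) * (x n / n) := by field_simp
    rw [this, mul_div_assoc]
    exact mul_le_mul_of_nonneg_right h3 (by positivity)
  have e : x (n + 1) - (x n - L * θ * x n / n + β * (n : ℝ) ^ chi Q A / n) =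
      (E0 - (x n - L / n * P)) - L / n * (P - θ * x n) + (R - β * (n : ℝ) ^ chi Q A / n) := by
    rw [hxs]; field_simp; ring
  rw [e]
  refine (abs_add_le _ _).trans ((add_le_add (abs_sub _ _) le_rfl).trans ?_)
  have e2 : ε * (x n + (n : ℝ) ^ chi Q A) / n = ε / 3 * x n / n +
      ε / 3 * (x n + (n : ℝ) ^ chi Q A) / n + ε / 3 * (n : ℝ) ^ chi Q A / n +
      (ε / 3 * x n / n + ε / 3 * (n : ℝ) ^ chi Q A / n) := by ring
  have e3 : 0 ≤ ε / 3 * x n / n + ε / 3 * (n : ℝ) ^ chi Q A / n := by positivity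
  rw [e2]
  linarith

lemma pattern_bound (hm : 2 ≤ m) (hd : 2 * m < d) {A : Finset V} {δ : V → ℕ}
    (hG : Good Q d A δ) (Q' : SimpleGraph V) : ∃ C : ℝ, 0 ≤ C ∧ ∀ T E, Chain m d T E →
      ∀ᶠ n in atTop, E n (fun g => ((emb Q Q' n g A δ).card : ℝ)) ≤ C * (n : ℝ) ^ chi Q A := by
  obtain ⟨t, ht⟩ := pattern_limit (Q' := Q') hm hd hG
  refine ⟨|t| + 1, by positivity, fun T E hE => ?_⟩
  filter_upwards [(ht T E hE).eventually_lt_const ((le_abs_self t).trans_lt (lt_add_one _)),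
    eventually_ge_atTop 1] with n hn hn1
  have hn0 : (0 : ℝ) < n := by exact_mod_cast hn1
  exact ((div_lt_iff₀ (zpow_pos hn0 _)).1 hn).le

lemma pattern_new_bound (hm : 2 ≤ m) (hd : 2 * m < d) {A : Finset V} {δ : V → ℕ}
    (hG : Good Q d A δ) (hδ : ∀ i ∈ A, 1 ≤ δ i) (Q' : SimpleGraph V) :
    ∃ C : ℝ, 0 ≤ C ∧ ∀ T E, Chain m d T E →
      ∀ᶠ n in atTop, E (n + 1) (fun g => ((embNew Q Q' (n + 1) g A δ).card : ℝ)) ≤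
        C * (n : ℝ) ^ (chi Q A - 1) := by
  obtain ⟨t, ht⟩ := lim_new (Q := Q) (Q' := Q') (by omega) hd hδ hG.le (fun i₀ _ I hI =>
    pattern_limit hm hd (hG.erase hδ (by
      simp only [newTr, Finset.mem_filter, Finset.mem_powerset] at hI
      exact hI.2.1)))
  refine ⟨|t| + 1, by positivity, fun T E hE => ?_⟩
  filter_upwards [(ht T E hE).eventually_lt_const ((le_abs_self t).trans_lt (lt_add_one _)),
    eventually_ge_atTop 1, eventually_ge_atTop T] with n hn hn1 hnT
  have hn0 : (0 : ℝ) < n := by exact_mod_cast hn1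
  have := ((div_lt_iff₀ (zpow_pos hn0 _)).1 hn).le
  refine le_trans (le_of_eq ?_) this
  rw [hE.step n hnT]
  refine hE.congr hnT fun g hg => ?_
  rw [stepL_apply]
  simp only [← savg_sum]
  exact savg_congr fun S hS hSm => embNew_attach hg hS hSm hδ

end

end

section

section
variable {V : Type*} {G : SimpleGraph V}

lemma nbr_mono {A B : Finset V} (h : A ⊆ B) (x : V) : nbr G A x ⊆ nbr G B x :=
  Finset.filter_subset_filter _ h

lemma mem_nbr {A : Finset V} {x y : V} : y ∈ nbr G A x ↔ y ∈ A ∧ G.Adj x y := Finset.mem_filter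

lemma card_sdiff_insert_add_one {A B : Finset V} {y : V} (hy : y ∈ A) (hyB : y ∉ B) :
    (A \ insert y B).card + 1 = (A \ B).card := by
  rw [Finset.sdiff_insert, Finset.card_erase_add_one (Finset.mem_sdiff.2 ⟨hy, hyB⟩)]

/-- Every proper nonempty part of `W` is joined to the rest of `W`. -/
def CutConn (G : SimpleGraph V) (W : Finset V) : Prop :=
  ∀ B, B ⊆ W → B.Nonempty → B ≠ W → ∃ x ∈ B, ∃ y ∈ W, y ∉ B ∧ G.Adj x y

lemma mono_excess {W : Finset V} (hW : CutConn G W) {B : Finset V} (hB : B ⊆ W)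
    (hBn : B.Nonempty) : eC G B + W.card ≤ eC G W + B.card := by
  induction hk : (W \ B).card generalizing B with
  | zero =>
    rw [Finset.card_eq_zero, Finset.sdiff_eq_empty_iff_subset] at hk
    rw [hB.antisymm hk]
  | succ k ih =>
    have hne : B ≠ W := by rintro rfl; simp at hk
    obtain ⟨x, hx, y, hyW, hyB, hxy⟩ := hW B hB hBn hne
    have h1 := ih (B := insert y B) (Finset.insert_subset hyW hB) (Finset.insert_nonempty _ _) (by
      have := card_sdiff_insert_add_one hyW hyB
      omega)
    rw [eC_insert G hyB, Finset.card_insert_of_notMem hyB] at h1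
    have h2 : 1 ≤ (nbr G B y).card := Finset.card_pos.2 ⟨x, mem_nbr.2 ⟨hx, hxy.symm⟩⟩
    omega

lemma eC_super [DecidableEq V] {A I D : Finset V} (hI : I ⊆ A) (hD : Disjoint A D) :
    eC G A + eC G (I ∪ D) ≤ eC G (A ∪ D) + eC G I := by
  induction D using Finset.induction_on with
  | empty => simp
  | insert y D hy ih =>
    rw [Finset.disjoint_insert_right] at hD
    have h1 := ih hD.2
    have h2 : y ∉ I ∪ D := by
      rw [Finset.mem_union, not_or]; exact ⟨fun h => hD.1 (hI h), hy⟩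
    have h3 : y ∉ A ∪ D := by
      rw [Finset.mem_union, not_or]; exact ⟨hD.1, hy⟩
    rw [Finset.union_insert, Finset.union_insert, eC_insert G h2, eC_insert G h3]
    have := Finset.card_le_card (nbr_mono (G := G) (Finset.union_subset_union_left (t := D) hI) y)
    omega

lemma excess_union [DecidableEq V] {A W : Finset V} (hW : CutConn G W) (hW1 : W.card ≤ eC G W)
    (hA : A.card ≤ eC G A) : (A ∪ W).card ≤ eC G (A ∪ W) := by
  have h1 := eC_super (G := G) (A := A) (I := A ∩ W) (D := W \ A) Finset.inter_subset_left
    Finset.disjoint_sdiff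
  have e1 : A ∩ W ∪ W \ A = W := by
    ext x; simp only [Finset.mem_union, Finset.mem_inter, Finset.mem_sdiff]; tauto
  have e2 : A ∪ W \ A = A ∪ W := Finset.union_sdiff_self_eq_union
  rw [e1, e2] at h1
  have h2 := Finset.card_union_add_card_inter A W
  by_cases hn : (A ∩ W).Nonempty
  · have := mono_excess hW Finset.inter_subset_right hn
    omega
  · rw [Finset.not_nonempty_iff_eq_empty.1 hn] at h1 h2
    rw [eC_empty] at h1
    simp at h2
    omega

lemma eC_union_of_not_adj [DecidableEq V] {C D : Finset V} (hCD : Disjoint C D)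
    (h : ∀ x ∈ C, ∀ y ∈ D, ¬ G.Adj x y) : eC G (C ∪ D) = eC G C + eC G D := by
  induction D using Finset.induction_on with
  | empty => simp [eC_empty]
  | insert y D hy ih =>
    rw [Finset.disjoint_insert_right] at hCD
    have h3 : y ∉ C ∪ D := by
      rw [Finset.mem_union, not_or]; exact ⟨hCD.1, hy⟩
    rw [Finset.union_insert, eC_insert G h3, eC_insert G hy,
      ih hCD.2 fun x hx z hz => h x hx z (Finset.mem_insert_of_mem hz)]
    have : nbr G (C ∪ D) y = nbr G D y := by
      ext z
      simp only [mem_nbr, Finset.mem_union]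
      refine ⟨fun hz => ⟨hz.1.resolve_left fun hzC => ?_, hz.2⟩, fun hz => ⟨Or.inr hz.1, hz.2⟩⟩
      exact h z hzC y (Finset.mem_insert_self _ _) hz.2.symm
    rw [this, add_assoc]

lemma cutConn_insert [DecidableEq V] {C : Finset V} (hC : CutConn G C) {x y : V} (hx : x ∈ C) (hxy : G.Adj x y) :
    CutConn G (insert y C) := by
  by_cases hyC : y ∈ C
  · rwa [Finset.insert_eq_of_mem hyC]
  intro B hB hBn hne
  by_cases hyB : y ∈ B
  · by_cases hxB : x ∈ B
    · have h1 : B.erase y ⊆ C := fun z hz => by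
        rw [Finset.mem_erase] at hz
        exact (Finset.mem_insert.1 (hB hz.2)).resolve_left hz.1
      have h2 : B.erase y ≠ C := by
        intro h; apply hne; rw [← h, Finset.insert_erase hyB]
      have hxy' : x ≠ y := G.ne_of_adj hxy
      obtain ⟨a, ha, b, hb, hbB, hab⟩ := hC _ h1 ⟨x, Finset.mem_erase.2 ⟨hxy', hxB⟩⟩ h2
      refine ⟨a, Finset.mem_of_mem_erase ha, b, Finset.mem_insert_of_mem hb, fun h => ?_, hab⟩
      refine hbB (Finset.mem_erase.2 ⟨?_, h⟩)
      rintro rfl; exact hyC hb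
    · exact ⟨y, hyB, x, Finset.mem_insert_of_mem hx, hxB, hxy.symm⟩
  · have h1 : B ⊆ C := fun z hz => (Finset.mem_insert.1 (hB hz)).resolve_left (by
      rintro rfl; exact hyB hz)
    by_cases hBC : B = C
    · subst hBC
      exact ⟨x, hx, y, Finset.mem_insert_self _ _, hyB, hxy⟩
    · obtain ⟨a, ha, b, hb, hbB, hab⟩ := hC B h1 hBn hBC
      exact ⟨a, ha, b, Finset.mem_insert_of_mem hb, hbB, hab⟩

lemma exists_closed_cutConn {A B : Finset V} (hBA : B ⊆ A) (hB : CutConn G B) :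
    ∃ C, B ⊆ C ∧ C ⊆ A ∧ CutConn G C ∧ ClosedIn G A C := by
  induction hk : (A \ B).card using Nat.strong_induction_on generalizing B with
  | _ k ih =>
  by_cases hc : ClosedIn G A B
  · exact ⟨B, subset_rfl, hBA, hB, hc⟩
  · unfold ClosedIn at hc
    push Not at hc
    obtain ⟨x, hx, y, hy, hxy, hyB⟩ := hc
    obtain ⟨C, h1, h2⟩ := ih _ (by
      have := card_sdiff_insert_add_one hy hyB
      exact hk ▸ Nat.lt_of_succ_le this.le) (Finset.insert_subset hy hBA) (cutConn_insert hB hx hxy) rfl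
    exact ⟨C, (Finset.subset_insert _ _).trans h1, h2⟩

lemma exists_cutConn_closed_subset {W B : Finset V} (hBW : B ⊆ W) (hB : ClosedIn G W B)
    (hBn : B.Nonempty) : ∃ C, C ⊆ B ∧ C.Nonempty ∧ CutConn G C ∧ ClosedIn G W C := by
  induction hk : B.card using Nat.strong_induction_on generalizing B with
  | _ k ih =>
  by_cases hc : CutConn G B
  · exact ⟨B, subset_rfl, hBn, hc, hB⟩
  · unfold CutConn at hc
    push Not at hc
    obtain ⟨D, hDB, hDn, hne, hD⟩ := hc
    obtain ⟨C, h1, h2⟩ := ih _ (by rw [← hk]; exact Finset.card_lt_card (hDB.ssubset_of_ne hne))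
      (hDB.trans hBW) (fun x hx y hy hxy => by
        by_contra hyD
        exact hD x hx y (hB x (hDB hx) y hy hxy) hyD hxy) hDn rfl
    exact ⟨C, h1.trans hDB, h2⟩

lemma exists_cutConn_complex {B : Finset V} (hB : B.card + 1 ≤ eC G B) :
    ∃ C, C ⊆ B ∧ C.Nonempty ∧ CutConn G C ∧ C.card + 1 ≤ eC G C := by
  induction hk : B.card using Nat.strong_induction_on generalizing B with
  | _ k ih =>
  by_cases hc : CutConn G B
  · refine ⟨B, subset_rfl, ?_, hc, hB⟩
    by_contra h
    rw [Finset.not_nonempty_iff_eq_empty.1 h, eC_empty] at hB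
    omega
  · unfold CutConn at hc
    push Not at hc
    obtain ⟨D, hDB, hDn, hne, hD⟩ := hc
    have h1 : eC G B = eC G D + eC G (B \ D) := by
      rw [← eC_union_of_not_adj Finset.disjoint_sdiff, Finset.union_sdiff_of_subset hDB]
      intro x hx y hy
      rw [Finset.mem_sdiff] at hy
      exact hD x hx y hy.1 hy.2
    have h2 := Finset.card_sdiff_add_card_eq_card hDB
    have h3 : D.card < B.card := Finset.card_lt_card (hDB.ssubset_of_ne hne)
    have h4 := hDn.card_pos
    rcases le_or_gt (D.card + 1) (eC G D) with h | h
    · obtain ⟨C, h5, h6⟩ := ih _ (hk ▸ h3) h rfl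
      exact ⟨C, h5.trans hDB, h6⟩
    · obtain ⟨C, h5, h6⟩ := ih (B \ D).card (by omega) (by omega) rfl
      exact ⟨C, h5.trans Finset.sdiff_subset, h6⟩

variable {V' : Type*} {φ : V' → V}

lemma nbr_image [DecidableEq V] (B : Finset V') (x : V') :
    nbr G (B.image φ) (φ x) = (nbr (G.comap φ) B x).image φ := by
  ext y
  simp only [mem_nbr, Finset.mem_image, SimpleGraph.comap_adj]
  constructor
  · rintro ⟨⟨z, hz, rfl⟩, h⟩
    exact ⟨z, ⟨hz, h⟩, rfl⟩
  · rintro ⟨z, ⟨hz, h⟩, rfl⟩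
    exact ⟨⟨z, hz, rfl⟩, h⟩

lemma eC_image [DecidableEq V] (hφ : Function.Injective φ) (B : Finset V') :
    eC G (B.image φ) = eC (G.comap φ) B := by
  rw [eC, Finset.sum_image fun x _ y _ h => hφ h, eC]
  simp only [nbr_image, Finset.card_image_of_injective _ hφ]

lemma cutConn_image [DecidableEq V] (hφ : Function.Injective φ) (B : Finset V') :
    CutConn G (B.image φ) ↔ CutConn (G.comap φ) B := by
  constructor
  · intro h D hD hDn hne
    obtain ⟨x, hx, y, hy, hyD, hxy⟩ := h (D.image φ) (Finset.image_subset_image hD)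
      (hDn.image φ) (fun h => hne (Finset.image_injective hφ h))
    obtain ⟨x, hx', rfl⟩ := Finset.mem_image.1 hx
    obtain ⟨y, hy', rfl⟩ := Finset.mem_image.1 hy
    exact ⟨x, hx', y, hy', fun h => hyD (Finset.mem_image_of_mem _ h), hxy⟩
  · intro h D hD hDn hne
    obtain ⟨D, hD', rfl⟩ := Finset.subset_image_iff.1 hD
    obtain ⟨x, hx, y, hy, hyD, hxy⟩ := h D hD' (Finset.image_nonempty.1 hDn)
      (fun h => hne (by rw [h]))
    exact ⟨φ x, Finset.mem_image_of_mem _ hx, φ y, Finset.mem_image_of_mem _ hy,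
      fun h => hyD (hφ.mem_finset_image.1 h), hxy⟩

variable [Fintype V]

lemma cutConn_univ_of_connected (h : G.Connected) : CutConn G Finset.univ := by
  intro B _ hBn hne
  obtain ⟨x, hx⟩ := hBn
  obtain ⟨y, hy⟩ : ∃ y, y ∉ B := by
    by_contra hc; push Not at hc; exact hne (Finset.eq_univ_iff_forall.2 hc)
  obtain ⟨w⟩ := h.preconnected x y
  obtain ⟨e, -, h1, h2⟩ := w.exists_boundary_dart (B : Set V) hx hy
  exact ⟨e.fst, h1, e.snd, Finset.mem_univ _, h2, e.adj⟩

lemma connected_of_cutConn_univ [Nonempty V] (h : CutConn G Finset.univ) : G.Connected := by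
  refine (SimpleGraph.connected_iff G).2 ⟨fun x y => ?_, inferInstance⟩
  by_contra hxy
  obtain ⟨a, ha, b, -, hb, hab⟩ := h (Finset.univ.filter (G.Reachable x)) (Finset.subset_univ _)
    ⟨x, by simp⟩ (fun he => hxy (by
      have := Finset.mem_univ y
      rw [← he, Finset.mem_filter] at this
      exact this.2))
  simp only [Finset.mem_filter, Finset.mem_univ, true_and] at ha hb
  exact hb (ha.trans hab.reachable)

lemma eC_univ : eC G Finset.univ = G.edgeSet.ncard := by
  rw [← SimpleGraph.coe_edgeFinset, Set.ncard_coe_finset]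
  have h := G.sum_degrees_eq_twice_card_edges
  have h2 := two_mul_eC G Finset.univ
  have : ∀ x, (nbr G Finset.univ x).card = G.degree x := by
    intro x
    rw [← SimpleGraph.card_neighborFinset_eq_degree]
    congr 1
    ext y
    simp [mem_nbr]
  simp only [this] at h2
  omega

/-- A connected graph with at least two independent cycles contains a spanning connected subgraph
with exactly two independent cycles. -/
lemma exists_bicyclic_le [Nonempty V] (hc : CutConn G Finset.univ)
    (he : Fintype.card V + 1 ≤ eC G Finset.univ) :
    ∃ Q ≤ G, CutConn Q Finset.univ ∧ eC Q Finset.univ = Fintype.card V + 1 := by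
  obtain ⟨T, hT, hTt⟩ := (connected_of_cutConn_univ hc).exists_isTree_le
  have h1 := hTt.card_edgeFinset
  rw [eC_univ, ← SimpleGraph.coe_edgeFinset, Set.ncard_coe_finset] at he
  obtain ⟨s, hs1, hs2, hs3⟩ := Finset.exists_subsuperset_card_eq
    (SimpleGraph.edgeFinset_subset_edgeFinset.2 hT) (n := Fintype.card V + 1) (by omega) he
  have hse : (SimpleGraph.fromEdgeSet (s : Set (Sym2 V))).edgeSet = s := by
    rw [SimpleGraph.edgeSet_fromEdgeSet]
    refine sdiff_eq_left.2 (Set.disjoint_left.2 fun e he hd => ?_)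
    exact G.not_isDiag_of_mem_edgeSet (SimpleGraph.mem_edgeFinset.1 (hs2 he)) hd
  refine ⟨SimpleGraph.fromEdgeSet (s : Set (Sym2 V)), ?_, ?_, ?_⟩
  · rw [← SimpleGraph.edgeSet_subset_edgeSet, hse]
    intro e he
    exact SimpleGraph.mem_edgeFinset.1 (hs2 he)
  · refine cutConn_univ_of_connected (hTt.connected.mono ?_)
    rw [← SimpleGraph.edgeSet_subset_edgeSet, hse]
    intro e he
    exact hs1 (SimpleGraph.mem_edgeFinset.2 he)
  · rw [eC_univ, hse, Set.ncard_coe_finset, hs3]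

end

end

section

/-- `W` is connected and contains at least two independent cycles. -/
def Cplx {V : Type*} (g : SimpleGraph V) (W : Finset V) : Prop :=
  CutConn g W ∧ W.card + 1 ≤ eC g W

lemma eC_singleton {V : Type*} (g : SimpleGraph V) (x : V) : eC g {x} = 0 := by
  rw [← insert_empty_eq, eC_insert g (Finset.notMem_empty x), eC_empty]
  simp [nbr]

lemma CutConn.subset_Icc {m d n : ℕ} {g : SimpleGraph ℕ} {W : Finset ℕ} (hg : UAReachable m d n g)
    (h : CutConn g W) (h2 : W.card ≤ eC g W) : W ⊆ Finset.Icc 1 n := by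
  intro x hx
  have hne : ({x} : Finset ℕ) ≠ W := by
    rintro rfl
    rw [eC_singleton] at h2
    simp at h2
  obtain ⟨y, hy, z, -, -, hyz⟩ := h {x} (Finset.singleton_subset_iff.2 hx)
    (Finset.singleton_nonempty x) hne
  rw [Finset.mem_singleton] at hy
  rw [← hy, Finset.mem_Icc]
  exact (reach_adj hg hyz).1

/-- Patterns on at most `R` vertices. -/
abbrev Pat (R d : ℕ) : Type :=
  Σ q : Fin (R + 1), SimpleGraph (Fin q.1) × (Fin q.1 → Fin (d + 1))

/-- The prescribed degrees of a pattern. -/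
def Pat.deg {R d : ℕ} (p : Pat R d) : Fin p.1.1 → ℕ := fun i => (p.2.2 i).1

/-- The patterns of connected graphs with two independent cycles and a vertex of low degree. -/
def Pat.Bicyclic {R d : ℕ} (p : Pat R d) : Prop :=
  CutConn p.2.1 Finset.univ ∧ eC p.2.1 Finset.univ = p.1.1 + 1 ∧ (∀ i, 1 ≤ p.deg i) ∧
    ∃ i, p.deg i < d

lemma Pat.Bicyclic.good {R d : ℕ} {p : Pat R d} (h : p.Bicyclic) :
    Good p.2.1 d Finset.univ p.deg where
  le i _ := Nat.lt_succ_iff.1 (p.2.2 i).2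
  exc B hB := by
    by_cases hn : B.Nonempty
    · have h1 := mono_excess h.1 hB hn
      rw [h.2.1, Finset.card_univ, Fintype.card_fin] at h1
      omega
    · rw [Finset.not_nonempty_iff_eq_empty.1 hn, eC_empty]
      omega
  cl B hB hn hc := by
    have hBu : B = Finset.univ := by
      by_contra hne
      obtain ⟨x, hx, y, hy, hyB, hxy⟩ := h.1 B hB hn hne
      exact hyB (hc x hx y hy hxy)
    subst hBu
    obtain ⟨i, hi⟩ := h.2.2.2
    have : 1 ≤ low d p.deg Finset.univ := Finset.card_pos.2 ⟨i, by simp [hi]⟩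
    rw [h.2.1, Finset.card_univ, Fintype.card_fin]
    omega

lemma Pat.Bicyclic.chi {R d : ℕ} {p : Pat R d} (h : p.Bicyclic) :
    chi p.2.1 Finset.univ = -1 := by
  rw [UA.chi, h.2.1, Finset.card_univ, Fintype.card_fin]
  push_cast
  ring

/-- An enumeration of a finite set. -/
noncomputable def enum (W : Finset ℕ) : Fin W.card → ℕ := fun i => (W.equivFin.symm i : ℕ)

lemma enum_injective (W : Finset ℕ) : Function.Injective (enum W) :=
  Subtype.val_injective.comp W.equivFin.symm.injective

lemma enum_mem (W : Finset ℕ) (i : Fin W.card) : enum W i ∈ W := (W.equivFin.symm i).2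

lemma enum_image (W : Finset ℕ) : Finset.univ.image (enum W) = W := by
  refine Finset.eq_of_subset_of_card_le (fun x hx => ?_) ?_
  · obtain ⟨i, -, rfl⟩ := Finset.mem_image.1 hx
    exact enum_mem W i
  · rw [Finset.card_image_of_injective _ (enum_injective W), Finset.card_univ, Fintype.card_fin]

lemma exists_pat {m d n R : ℕ} (hm : 2 ≤ m) (hd : 2 * m < d) {g : SimpleGraph ℕ}
    (hg : UAReachable m d n g) {W : Finset ℕ} (hW : Cplx g W) (hR : W.card ≤ R)
    (hx : ∃ x ∈ W, graphDeg g x < d) :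
    ∃ p : Pat R d, p.Bicyclic ∧ ∃ φ ∈ emb p.2.1 ⊤ n g Finset.univ p.deg,
      Finset.univ.image φ = W := by
  have hsub := hW.1.subset_Icc hg (by have := hW.2; omega)
  obtain ⟨x, hxW, hxd⟩ := hx
  have hne : Nonempty (Fin W.card) := ⟨⟨0, Finset.card_pos.2 ⟨x, hxW⟩⟩⟩
  have h1 := (cutConn_image (G := g) (enum_injective W) Finset.univ).1 (by rw [enum_image]; exact hW.1)
  obtain ⟨Q, hQ, hQc, hQe⟩ := exists_bicyclic_le h1 (by
    rw [← eC_image (enum_injective W), enum_image, Fintype.card_fin]; exact hW.2)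
  refine ⟨⟨⟨W.card, by omega⟩, Q, fun i => ⟨graphDeg g (enum W i),
    Nat.lt_succ_iff.2 (reach_deg_le hd hg _)⟩⟩, ⟨hQc, ?_, ?_, ?_⟩, enum W, ?_, enum_image W⟩
  · rw [hQe, Fintype.card_fin]
  · intro i
    have := reach_le_deg hg (Finset.mem_Icc.1 (hsub (enum_mem W i)))
    simp only [Pat.deg]
    omega
  · have hx' := hxW
    rw [← enum_image W] at hx'
    obtain ⟨i, -, rfl⟩ := Finset.mem_image.1 hx'
    exact ⟨i, hxd⟩
  · rw [mem_emb]
    exact ⟨fun i _ => Finset.mem_Icc.1 (hsub (enum_mem W i)),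
      fun i hi => absurd (Finset.mem_univ i) hi, fun i _ j _ h => enum_injective W h,
      fun i _ j _ h => hQ h, fun i _ j _ h => fun he => (g.ne_of_adj h) (congrArg _ he),
      fun i _ => rfl⟩

lemma mem_embNew {V : Type*} [Fintype V] {Q Q' : SimpleGraph V} {n : ℕ} {g : SimpleGraph ℕ}
    {A : Finset V} {δ : V → ℕ} {φ : V → ℕ} :
    φ ∈ embNew Q Q' n g A δ ↔ φ ∈ emb Q Q' n g A δ ∧ ∃ i ∈ A, φ i = n := by
  rw [embNew, Finset.mem_filter]

/-- There is a small complex set containing a vertex of low degree. -/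
def Bad (d R : ℕ) (g : SimpleGraph ℕ) : Prop :=
  ∃ W : Finset ℕ, Cplx g W ∧ W.card ≤ R ∧ ∃ x ∈ W, graphDeg g x < d

/-- There is a small complex set containing the vertex `v`. -/
def CplxAt (R : ℕ) (g : SimpleGraph ℕ) (v : ℕ) : Prop :=
  ∃ W : Finset ℕ, Cplx g W ∧ W.card ≤ R ∧ v ∈ W

lemma exists_sum_bound {ι : Type*} (s : Finset ι) (m d : ℕ)
    (P : ℕ → SimpleGraph ℕ → Prop) (F : ι → ℕ → SimpleGraph ℕ → ℝ) (r : ℕ → ℝ)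
    (hP : ∀ n g, UAReachable m d n g → ind (P n g) ≤ ∑ i ∈ s, F i n g)
    (hF : ∀ i ∈ s, ∃ C : ℝ, 0 ≤ C ∧ ∀ T E, Chain m d T E → ∀ᶠ n in atTop, E n (F i n) ≤ C * r n) :
    ∃ C : ℝ, 0 ≤ C ∧ ∀ T E, Chain m d T E → ∀ᶠ n in atTop, E n (fun g => ind (P n g)) ≤ C * r n := by
  choose! C hC0 hC using hF
  refine ⟨∑ i ∈ s, C i, Finset.sum_nonneg hC0, fun T E hE => ?_⟩
  have : ∀ᶠ n in atTop, ∀ i ∈ s, E n (F i n) ≤ C i * r n := by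
    rw [Filter.eventually_all_finset]
    exact fun i hi => hC i hi T E hE
  filter_upwards [this, eventually_ge_atTop T] with n hn hT
  rw [Finset.sum_mul]
  refine (hE.mono n hT _ _ (hP n)).trans ?_
  rw [hE.sum]
  exact Finset.sum_le_sum hn

lemma bad_bound {m d : ℕ} (hm : 2 ≤ m) (hd : 2 * m < d) (R : ℕ) :
    ∃ C : ℝ, 0 ≤ C ∧ ∀ T E, Chain m d T E →
      ∀ᶠ n in atTop, E n (fun g => ind (Bad d R g)) ≤ C * (n : ℝ)⁻¹ := by
  refine exists_sum_bound ((Finset.univ : Finset (Pat R d)).filter Pat.Bicyclic) m d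
    (fun _ g => Bad d R g)
    (fun p n g => ((emb p.2.1 ⊤ n g Finset.univ p.deg).card : ℝ)) (fun n => (n : ℝ)⁻¹) ?_ ?_
  · intro n g hg
    by_cases hB : Bad d R g
    · obtain ⟨W, hW, hR, hx⟩ := hB
      obtain ⟨p, hp, φ, hφ, -⟩ := exists_pat hm hd hg hW hR hx
      refine (ind_le_one _).trans (le_trans ?_ (Finset.single_le_sum
        (f := fun p : Pat R d => ((emb p.2.1 ⊤ n g Finset.univ p.deg).card : ℝ))
        (fun p _ => Nat.cast_nonneg _) (Finset.mem_filter.2 ⟨Finset.mem_univ p, hp⟩)))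
      exact_mod_cast Finset.card_pos.2 ⟨φ, hφ⟩
    · rw [ind_neg hB]
      exact Finset.sum_nonneg fun p _ => Nat.cast_nonneg _
  · intro p hp
    have hp := (Finset.mem_filter.1 hp).2
    have := pattern_bound hm hd hp.good ⊤
    rw [hp.chi] at this
    simpa using this

lemma cplxAt_bound {m d : ℕ} (hm : 2 ≤ m) (hd : 2 * m < d) (R : ℕ) :
    ∃ C : ℝ, 0 ≤ C ∧ ∀ T E, Chain m d T E →
      ∀ᶠ n in atTop, E (n + 1) (fun g => ind (CplxAt R g (n + 1))) ≤ C * ((n : ℝ) ^ 2)⁻¹ := by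
  have := exists_sum_bound ((Finset.univ : Finset (Pat R d)).filter Pat.Bicyclic) m d
    (fun n g => CplxAt R g n ∧ m + 1 ≤ n)
    (fun p n g => ((embNew p.2.1 ⊤ n g Finset.univ p.deg).card : ℝ))
    (fun n => (((n - 1 : ℕ) : ℝ) ^ 2)⁻¹) ?_ ?_
  · obtain ⟨C, hC, h⟩ := this
    refine ⟨C, hC, fun T E hE => ?_⟩
    filter_upwards [(tendsto_add_atTop_nat 1).eventually (h T E hE), eventually_ge_atTop T,
      eventually_ge_atTop m] with n hn h2 h3
    rw [Nat.add_sub_cancel] at hn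
    refine le_trans (hE.mono _ (h2.trans (Nat.le_succ n)) _ _ fun g _ => ind_mono fun h => ?_) hn
    exact ⟨h, by omega⟩
  · intro n g hg
    by_cases hB : CplxAt R g n ∧ m + 1 ≤ n
    · obtain ⟨⟨W, hW, hR, hx⟩, hmn⟩ := hB
      have hdeg : graphDeg g n < d := by
        cases hg with
        | init => omega
        | step h1 h2 h3 h4 =>
          rw [deg_attach_new h2 h3, h4]; omega
      obtain ⟨p, hp, φ, hφ, hφW⟩ := exists_pat hm hd hg hW hR ⟨n, hx, hdeg⟩
      refine (ind_le_one _).trans (le_trans ?_ (Finset.single_le_sum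
        (f := fun p : Pat R d => ((embNew p.2.1 ⊤ n g Finset.univ p.deg).card : ℝ))
        (fun p _ => Nat.cast_nonneg _) (Finset.mem_filter.2 ⟨Finset.mem_univ p, hp⟩)))
      rw [← hφW] at hx
      obtain ⟨i, hi, hin⟩ := Finset.mem_image.1 hx
      have hmem : φ ∈ embNew p.2.1 ⊤ n g Finset.univ p.deg := by
        exact mem_embNew.2 ⟨hφ, i, hi, hin⟩
      exact_mod_cast Finset.card_pos.2 ⟨φ, hmem⟩
    · rw [ind_neg hB]
      exact Finset.sum_nonneg fun p _ => Nat.cast_nonneg _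
  · intro p hp
    have hp := (Finset.mem_filter.1 hp).2
    obtain ⟨C, hC, h⟩ := pattern_new_bound hm hd hp.good (fun i _ => hp.2.2.1 i) ⊤
    refine ⟨C, hC, fun T E hE => ?_⟩
    obtain ⟨N, hN⟩ := eventually_atTop.1 (h T E hE)
    filter_upwards [eventually_ge_atTop (N + 1)] with n hn
    obtain ⟨k, rfl⟩ : ∃ k, n = k + 1 := ⟨n - 1, by omega⟩
    have := hN k (by omega)
    rw [hp.chi] at this
    rw [Nat.add_sub_cancel]
    refine this.trans (le_of_eq ?_)
    congr 1

end

section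

section ball
variable {m d n : ℕ} {g : SimpleGraph ℕ}

/-- The ball of radius `k` around `v` in the graph `g` on `[n]`. -/
noncomputable def ball (g : SimpleGraph ℕ) (n : ℕ) : ℕ → ℕ → Finset ℕ
  | 0, v => {v}
  | k + 1, v => ball g n k v ∪ (ball g n k v).biUnion (fun x => (Finset.Icc 1 n).filter (g.Adj x))

lemma mem_ball (k v : ℕ) : v ∈ ball g n k v := by
  induction k with
  | zero => simp [ball]
  | succ k ih => exact Finset.mem_union_left _ ih

lemma ball_card (hd : 2 * m < d) (hg : UAReachable m d n g) (k v : ℕ) :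
    (ball g n k v).card ≤ (d + 1) ^ k := by
  induction k with
  | zero => simp [ball]
  | succ k ih =>
    calc (ball g n (k + 1) v).card ≤ (ball g n k v).card + (ball g n k v).card * d := by
          refine (Finset.card_union_le _ _).trans (Nat.add_le_add_left ?_ _)
          refine Finset.card_biUnion_le_card_mul _ _ _ fun x _ => ?_
          rw [← reach_deg hg]
          exact reach_deg_le hd hg x
      _ = (ball g n k v).card * (d + 1) := by ring
      _ ≤ (d + 1) ^ (k + 1) := by rw [pow_succ]; gcongr

lemma CutConn.subset_ball (hg : UAReachable m d n g) {W : Finset ℕ} (hW : CutConn g W) {v : ℕ}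
    (hv : v ∈ W) {R : ℕ} (hR : W.card ≤ R) : W ⊆ ball g n R v := by
  have key : ∀ k, W.card ≤ (W ∩ ball g n k v).card ∨ k + 1 ≤ (W ∩ ball g n k v).card := by
    intro k
    induction k with
    | zero => exact Or.inr (Finset.card_pos.2 ⟨v, Finset.mem_inter.2 ⟨hv, mem_ball _ _⟩⟩)
    | succ k ih =>
      have hss : W ∩ ball g n k v ⊆ W ∩ ball g n (k + 1) v :=
        Finset.inter_subset_inter_left Finset.subset_union_left
      by_cases he : W ∩ ball g n k v = W
      · left
        rw [he] at hss
        exact Finset.card_le_card hss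
      · right
        obtain ⟨x, hx, y, hy, hyB, hxy⟩ := hW _ Finset.inter_subset_left
          ⟨v, Finset.mem_inter.2 ⟨hv, mem_ball _ _⟩⟩ he
        have hlt : (W ∩ ball g n k v).card < (W ∩ ball g n (k + 1) v).card := by
          refine Finset.card_lt_card (Finset.ssubset_iff_of_subset hss |>.2 ⟨y, ?_, hyB⟩)
          refine Finset.mem_inter.2 ⟨hy, Finset.mem_union_right _ (Finset.mem_biUnion.2
            ⟨x, (Finset.mem_inter.1 hx).2, Finset.mem_filter.2 ⟨?_, hxy⟩⟩)⟩
          exact Finset.mem_Icc.2 (reach_adj hg hxy).2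
        rcases ih with h | h
        · have := Finset.card_le_card (Finset.inter_subset_left : W ∩ ball g n (k + 1) v ⊆ W)
          omega
        · omega
  have h2 : W ∩ ball g n R v = W := by
    refine Finset.eq_of_subset_of_card_le Finset.inter_subset_left ?_
    rcases key R with h | h <;> omega
  exact Finset.inter_eq_left.1 h2

end ball

section local_structure
variable {m d n R : ℕ} {g : SimpleGraph ℕ} {S : Finset ℕ}

lemma nbr_attach_old {W : Finset ℕ} (hW : n + 1 ∉ W) {x : ℕ} (hx : x ∈ W) :
    nbr (attachStep g (n + 1) S) W x = nbr g W x := by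
  ext y
  simp only [mem_nbr, attach_adj]
  constructor
  · rintro ⟨hy, h | ⟨-, ⟨rfl, -⟩ | ⟨rfl, -⟩⟩⟩
    · exact ⟨hy, h⟩
    · exact absurd hx hW
    · exact absurd hy hW
  · rintro ⟨hy, h⟩
    exact ⟨hy, Or.inl h⟩

lemma eC_attach_old {W : Finset ℕ} (hW : n + 1 ∉ W) :
    eC (attachStep g (n + 1) S) W = eC g W := by
  unfold eC
  rw [Finset.sum_congr rfl fun x hx => by rw [nbr_attach_old hW hx]]

lemma attach_adj_old {a b : ℕ} (ha : a ≠ n + 1) (hb : b ≠ n + 1) :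
    (attachStep g (n + 1) S).Adj a b ↔ g.Adj a b := by
  rw [attach_adj]; tauto

lemma cutConn_attach_old {W : Finset ℕ} (hW : n + 1 ∉ W) :
    CutConn (attachStep g (n + 1) S) W ↔ CutConn g W := by
  have key : ∀ x ∈ W, ∀ y ∈ W, (attachStep g (n + 1) S).Adj x y ↔ g.Adj x y :=
    fun x hx y hy => attach_adj_old (fun h => hW (h ▸ hx)) (fun h => hW (h ▸ hy))
  constructor
  · intro h B hB hBn hne
    obtain ⟨x, hx, y, hy, hyB, hxy⟩ := h B hB hBn hne
    exact ⟨x, hx, y, hy, hyB, (key x (hB hx) y hy).1 hxy⟩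
  · intro h B hB hBn hne
    obtain ⟨x, hx, y, hy, hyB, hxy⟩ := h B hB hBn hne
    exact ⟨x, hx, y, hy, hyB, (key x (hB hx) y hy).2 hxy⟩

/-- Two distinct elements of `S` are close to each other. -/
def Link (g : SimpleGraph ℕ) (n R : ℕ) (S : Finset ℕ) : Prop :=
  ∃ x ∈ S, ∃ y ∈ S, x ≠ y ∧ y ∈ ball g n R x

lemma savg_link (hm : 0 < m) (hd : 2 * m < d) (hg : UAReachable m d n g) (R : ℕ) :
    savg (lowDegSet d g n) m (fun S => ind (Link g n R S)) ≤
      (d + 1 : ℝ) ^ R * (m / kap m d) ^ 2 / n := by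
  have hn : (0 : ℝ) < n := by exact_mod_cast hm.trans_le (reach_le hg)
  have hk := kap_pos hd
  set X := lowDegSet d g n with hX
  have h1 : savg X m (fun S => ind (Link g n R S)) ≤ savg X m (fun S =>
      ∑ x ∈ Finset.Icc 1 n, ∑ y ∈ (ball g n R x).erase x, if ({x, y} : Finset ℕ) ⊆ S then (1 : ℝ) else 0) := by
    refine savg_mono fun S hS _ => ?_
    by_cases hL : Link g n R S
    · obtain ⟨x, hx, y, hy, hxy, hyb⟩ := hL
      have hxI : x ∈ Finset.Icc 1 n := Finset.mem_Icc.2 (mem_lowDegSet.1 (hS hx)).1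
      refine (ind_le_one _).trans ?_
      have hnn : ∀ x ∈ Finset.Icc 1 n, (0 : ℝ) ≤ ∑ y ∈ (ball g n R x).erase x,
          if ({x, y} : Finset ℕ) ⊆ S then (1 : ℝ) else 0 :=
        fun x _ => Finset.sum_nonneg fun y _ => by split_ifs <;> norm_num
      refine le_trans ?_ (Finset.single_le_sum hnn hxI)
      refine le_trans ?_ (Finset.single_le_sum (fun y _ => by split_ifs <;> norm_num)
        (Finset.mem_erase.2 ⟨hxy.symm, hyb⟩))
      rw [if_pos (Finset.insert_subset hx (Finset.singleton_subset_iff.2 hy))]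
    · rw [ind_neg hL]
      exact Finset.sum_nonneg fun x _ => Finset.sum_nonneg fun y _ => by split_ifs <;> norm_num
  refine h1.trans ?_
  rw [savg_sum]
  have h2 : ∀ x ∈ Finset.Icc 1 n, savg X m (fun S => ∑ y ∈ (ball g n R x).erase x,
      if ({x, y} : Finset ℕ) ⊆ S then (1 : ℝ) else 0) ≤
      (d + 1 : ℝ) ^ R * (m / kap m d / n) ^ 2 := by
    intro x _
    rw [savg_sum]
    have h3 : ∀ y ∈ (ball g n R x).erase x, savg X m (fun S =>
        if ({x, y} : Finset ℕ) ⊆ S then (1 : ℝ) else 0) ≤ (m / kap m d / n) ^ 2 := by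
      intro y hy
      refine (savg_le_of_subset (I := {x, y}) (le_lowDegSet_card hd hg) _ fun S _ h => h).trans ?_
      rw [Finset.card_pair (Finset.ne_of_mem_erase hy).symm]
      exact pow_le_pow_left₀ (by positivity) (div_low_le hm hd hg) 2
    refine (Finset.sum_le_sum h3).trans ?_
    rw [Finset.sum_const, nsmul_eq_mul]
    gcongr
    exact_mod_cast (Finset.card_le_card (Finset.erase_subset _ _)).trans (ball_card hd hg R x)
  refine (Finset.sum_le_sum h2).trans (le_of_eq ?_)
  rw [Finset.sum_const, nsmul_eq_mul, Nat.card_Icc, Nat.add_sub_cancel]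
  field_simp

lemma exists_old_cycle (hg : UAReachable m d n g) (hL : ¬ Link g n R S) {W : Finset ℕ} (hv : n + 1 ∉ W)
    (hc : CutConn (attachStep g (n + 1) S) (insert (n + 1) W)) (hR : (insert (n + 1) W).card ≤ R)
    (he : (insert (n + 1) W).card ≤ eC (attachStep g (n + 1) S) (insert (n + 1) W))
    (hS : n + 1 ∉ S) :
    ∃ C ⊆ W, CutConn g C ∧ C.card ≤ eC g C ∧ (C ∩ S).Nonempty := by
  by_contra hno
  push Not at hno
  rw [Finset.card_insert_of_notMem hv] at hR he
  have key : ∀ k, ∀ B, B.card = k → B ⊆ W → ClosedIn g W B → eC g B + (B ∩ S).card ≤ B.card := by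
    intro k
    induction k using Nat.strong_induction_on with
    | _ k ih =>
    intro B hk hBW hB
    rcases B.eq_empty_or_nonempty with rfl | hBn
    · simp [eC_empty]
    obtain ⟨C, hCB, hCn, hCc, hCW⟩ := exists_cutConn_closed_subset hBW hB hBn
    have hvC : n + 1 ∉ C := fun h => hv (hBW (hCB h))
    have hCS : (C ∩ S).Nonempty := by
      obtain ⟨x, hx, y, hy, hyC, hxy⟩ := hc C
        ((hCB.trans hBW).trans (Finset.subset_insert _ _)) hCn
        (fun h => hvC (h ▸ Finset.mem_insert_self _ _))
      rw [attach_adj] at hxy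
      have hxv : x ≠ n + 1 := fun h => hvC (h ▸ hx)
      rcases hxy with h | ⟨-, ⟨rfl, -⟩ | ⟨-, h⟩⟩
      · rcases Finset.mem_insert.1 hy with rfl | hy
        · have := (reach_adj hg h).2; omega
        · exact absurd (hCW x hx y hy h) hyC
      · exact absurd rfl hxv
      · exact ⟨x, Finset.mem_inter.2 ⟨hx, h⟩⟩
    have hCS1 : (C ∩ S).card ≤ 1 := by
      rw [Finset.card_le_one]
      intro x hx y hy
      by_contra hxy
      rw [Finset.mem_inter] at hx hy
      refine hL ⟨x, hx.2, y, hy.2, hxy, hCc.subset_ball hg hx.1 ?_ hy.1⟩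
      have := Finset.card_le_card (hCB.trans hBW)
      omega
    have hCe : eC g C < C.card := by
      by_contra hcon
      exact hCS.ne_empty (hno C (hCB.trans hBW) hCc (not_lt.1 hcon))
    have hcard := Finset.card_sdiff_add_card_eq_card hCB
    have hpos := Finset.card_pos.2 hCn
    have h2 := ih (B \ C).card (by omega) (B \ C) rfl (Finset.sdiff_subset.trans hBW) (by
      intro x hx y hy hxy
      rw [Finset.mem_sdiff] at hx ⊢
      exact ⟨hB x hx.1 y hy hxy, fun hyC => hx.2 (hCW y hyC x (hBW hx.1) hxy.symm)⟩)
    have h3 : eC g B = eC g C + eC g (B \ C) := by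
      rw [← eC_union_of_not_adj Finset.disjoint_sdiff, Finset.union_sdiff_of_subset hCB]
      intro x hx y hy hxy
      rw [Finset.mem_sdiff] at hy
      exact hy.2 (hCW x hx y (hBW hy.1) hxy)
    have h4 : (B ∩ S).card ≤ (C ∩ S).card + ((B \ C) ∩ S).card := by
      refine (Finset.card_le_card fun x hx => ?_).trans (Finset.card_union_le _ _)
      simp only [Finset.mem_inter, Finset.mem_union, Finset.mem_sdiff] at hx ⊢
      tauto
    omega
  have h1 := key W.card W rfl subset_rfl (fun _ _ y hy _ => hy)
  rw [eC_insert _ hv, eC_attach_old hv] at he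
  have h2 : nbr (attachStep g (n + 1) S) W (n + 1) ⊆ W ∩ S := by
    intro y hy
    rw [mem_nbr, attach_adj] at hy
    refine Finset.mem_inter.2 ⟨hy.1, ?_⟩
    rcases hy.2 with h | ⟨-, ⟨-, h⟩ | ⟨-, h⟩⟩
    · have := (reach_adj hg h).1; omega
    · exact h
    · exact absurd h hS
  have := Finset.card_le_card h2
  omega

end local_structure

end

section

variable {m d n R : ℕ} {g : SimpleGraph ℕ} {S : Finset ℕ}

/-- The small connected sets of vertices containing a cycle. -/
noncomputable def cyc (R n : ℕ) (g : SimpleGraph ℕ) : Finset (Finset ℕ) :=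
  (Finset.Icc 1 n).powerset.filter (fun W => CutConn g W ∧ W.card ≤ R ∧ W.card ≤ eC g W)

lemma mem_cyc {W : Finset ℕ} :
    W ∈ cyc R n g ↔ W ⊆ Finset.Icc 1 n ∧ CutConn g W ∧ W.card ≤ R ∧ W.card ≤ eC g W := by
  rw [cyc, Finset.mem_filter, Finset.mem_powerset]

/-- The maximal number of small connected sets containing a given vertex. -/
def nbd (d R : ℕ) : ℕ := 2 ^ ((d + 1) ^ R)

lemma cyc_card_le (hd : 2 * m < d) (hg : UAReachable m d n g) (R v : ℕ) :
    ((cyc R n g).filter (fun W => v ∈ W)).card ≤ nbd d R := by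
  calc ((cyc R n g).filter (fun W => v ∈ W)).card ≤ (ball g n R v).powerset.card := by
        refine Finset.card_le_card fun W hW => ?_
        rw [Finset.mem_filter, mem_cyc] at hW
        exact Finset.mem_powerset.2 (hW.1.2.1.subset_ball hg hW.2 hW.1.2.2.1)
    _ ≤ nbd d R := by
        rw [Finset.card_powerset]
        exact Nat.pow_le_pow_right (by norm_num) (ball_card hd hg R v)

/-- The weight of a vertex in the potential function. -/
noncomputable def eps (d R : ℕ) : ℝ := 1 / (2 * (d + 1) * (R + 1) * nbd d R)

lemma nbd_pos (d R : ℕ) : (0 : ℝ) < nbd d R := by unfold nbd; positivity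

lemma eps_pos (d R : ℕ) : 0 < eps d R := by
  have := nbd_pos d R
  unfold eps; positivity

lemma eps_mul_le (d R : ℕ) : nbd d R * (eps d R * (R * d)) ≤ 1 / 2 := by
  have h := nbd_pos d R
  unfold eps
  rw [one_div, inv_mul_eq_div, mul_div_assoc', div_le_iff₀ (by positivity)]
  have : (R : ℝ) * d ≤ (d + 1) * (R + 1) := by nlinarith [(Nat.cast_nonneg R : (0 : ℝ) ≤ R), (Nat.cast_nonneg d : (0 : ℝ) ≤ d)]
  nlinarith

lemma eps_le_one (d R : ℕ) : eps d R ≤ 1 := by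
  unfold eps
  have h : (1 : ℝ) ≤ nbd d R := by exact_mod_cast Nat.one_le_two_pow
  rw [div_le_one (by positivity)]
  have h1 : (1 : ℝ) ≤ 2 * (d + 1) * (R + 1) := by nlinarith [(Nat.cast_nonneg R : (0 : ℝ) ≤ R), (Nat.cast_nonneg d : (0 : ℝ) ≤ d)]
  nlinarith

/-- The potential function: the weighted amount of free degree near short cycles. -/
noncomputable def pot (d R n : ℕ) (g : SimpleGraph ℕ) : ℝ :=
  ∑ W ∈ cyc R n g, eps d R ^ W.card * ∑ x ∈ W, ((d : ℝ) - graphDeg g x)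

lemma free_nonneg (hd : 2 * m < d) (hg : UAReachable m d n g) (x : ℕ) :
    (0 : ℝ) ≤ (d : ℝ) - graphDeg g x := by
  have : (graphDeg g x : ℝ) ≤ d := by exact_mod_cast reach_deg_le hd hg x
  linarith

lemma pot_nonneg (hd : 2 * m < d) (hg : UAReachable m d n g) : 0 ≤ pot d R n g :=
  Finset.sum_nonneg fun _ _ => mul_nonneg (pow_nonneg (eps_pos d R).le _)
    (Finset.sum_nonneg fun x _ => free_nonneg hd hg x)

/-- The vertices of low degree near short cycles. -/
noncomputable def act (d R n : ℕ) (g : SimpleGraph ℕ) : Finset ℕ :=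
  (lowDegSet d g n).filter (fun x => ∃ W ∈ cyc R n g, x ∈ W)

lemma pot_le (hd : 2 * m < d) (hg : UAReachable m d n g) :
    pot d R n g ≤ nbd d R * d * (act d R n g).card := by
  have h1 : pot d R n g ≤ ∑ W ∈ cyc R n g, ∑ x ∈ act d R n g, if x ∈ W then (d : ℝ) else 0 := by
    refine Finset.sum_le_sum fun W hW => ?_
    have hnn : (0 : ℝ) ≤ ∑ x ∈ W, ((d : ℝ) - graphDeg g x) :=
      Finset.sum_nonneg fun x _ => free_nonneg hd hg x
    refine (mul_le_of_le_one_left hnn (pow_le_one₀ (eps_pos d R).le (eps_le_one d R))).trans ?_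
    rw [← Finset.sum_filter]
    have hsub : (act d R n g).filter (· ∈ W) ⊆ W := fun x hx => (Finset.mem_filter.1 hx).2
    rw [← Finset.sum_subset hsub (f := fun x => (d : ℝ) - graphDeg g x)]
    · exact Finset.sum_le_sum fun x _ => sub_le_self _ (Nat.cast_nonneg _)
    · intro x hx hxn
      have : ¬ graphDeg g x < d := by
        intro hlt
        refine hxn (Finset.mem_filter.2 ⟨Finset.mem_filter.2 ⟨mem_lowDegSet.2 ⟨?_, hlt⟩, W, hW, hx⟩, hx⟩)
        exact Finset.mem_Icc.1 ((mem_cyc.1 hW).1 hx)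
      have h2 := reach_deg_le hd hg x
      rw [show graphDeg g x = d by omega, sub_self]
  refine h1.trans ?_
  rw [Finset.sum_comm]
  have h2 : ∀ x ∈ act d R n g, (∑ W ∈ cyc R n g, if x ∈ W then (d : ℝ) else 0) ≤ nbd d R * d := by
    intro x _
    rw [← Finset.sum_filter, Finset.sum_const, nsmul_eq_mul]
    gcongr
    exact_mod_cast cyc_card_le hd hg R x
  refine (Finset.sum_le_sum h2).trans (le_of_eq ?_)
  rw [Finset.sum_const, nsmul_eq_mul]
  ring

lemma cyc_filter_attach :
    (cyc R (n + 1) (attachStep g (n + 1) S)).filter (fun W => n + 1 ∉ W) = cyc R n g := by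
  ext W
  rw [Finset.mem_filter, mem_cyc, mem_cyc]
  constructor
  · rintro ⟨⟨h1, h2, h3, h4⟩, h5⟩
    refine ⟨fun x hx => ?_, (cutConn_attach_old h5).1 h2, h3, by rwa [eC_attach_old h5] at h4⟩
    have := Finset.mem_Icc.1 (h1 hx)
    have hne : x ≠ n + 1 := fun h => h5 (h ▸ hx)
    exact Finset.mem_Icc.2 (by omega)
  · rintro ⟨h1, h2, h3, h4⟩
    have h5 : n + 1 ∉ W := fun h => by have := Finset.mem_Icc.1 (h1 h); omega
    refine ⟨⟨fun x hx => ?_, (cutConn_attach_old h5).2 h2, h3, by rwa [eC_attach_old h5]⟩, h5⟩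
    have := Finset.mem_Icc.1 (h1 hx)
    exact Finset.mem_Icc.2 (by omega)

lemma pot_attach_le (hd : 2 * m < d) (hg : UAReachable m d n g) (hS : S ⊆ lowDegSet d g n)
    (hc : S.card = m) :
    pot d R (n + 1) (attachStep g (n + 1) S) ≤ pot d R n g + (nbd d R * (R * d)) * ind (Link g n R S) -
      eps d R ^ R / 2 * ind ((act d R n g ∩ S).Nonempty) := by
  have hg' : UAReachable m d (n + 1) (attachStep g (n + 1) S) := .step (reach_le hg) hg hS hc
  have hvS : n + 1 ∉ S := fun h => by have := (mem_lowDegSet.1 (hS h)).1; omega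
  have he0 := eps_pos d R
  have he1 := eps_le_one d R
  set D : ℝ := ∑ W ∈ cyc R n g, eps d R ^ W.card * (W ∩ S).card with hD
  have hDnn : ∀ W ∈ cyc R n g, 0 ≤ eps d R ^ W.card * ((W ∩ S).card : ℝ) := fun W _ => by positivity
  have hDle : ∀ C ∈ cyc R n g, (C ∩ S).Nonempty → eps d R ^ C.card ≤ D := by
    intro C hC hne
    refine le_trans ?_ (Finset.single_le_sum hDnn hC)
    refine le_mul_of_one_le_right (by positivity) ?_
    exact_mod_cast Finset.card_pos.2 hne
  have hD0 : 0 ≤ D := Finset.sum_nonneg hDnn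
  have hold : ∑ W ∈ cyc R n g, eps d R ^ W.card *
      ∑ x ∈ W, ((d : ℝ) - graphDeg (attachStep g (n + 1) S) x) = pot d R n g - D := by
    rw [pot, hD, ← Finset.sum_sub_distrib]
    refine Finset.sum_congr rfl fun W hW => ?_
    rw [← mul_sub]
    congr 1
    rw [← Finset.filter_mem_eq_inter, Finset.card_filter]
    push_cast
    rw [← Finset.sum_sub_distrib]
    refine Finset.sum_congr rfl fun x hx => ?_
    have hne : x ≠ n + 1 := fun h => by have := Finset.mem_Icc.1 ((mem_cyc.1 hW).1 hx); omega
    rw [deg_attach_old hg hne]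
    push_cast
    ring
  have hbd : ∀ W ∈ cyc R (n + 1) (attachStep g (n + 1) S),
      ∑ x ∈ W, ((d : ℝ) - graphDeg (attachStep g (n + 1) S) x) ≤ R * d := by
    intro W hW
    calc ∑ x ∈ W, ((d : ℝ) - graphDeg (attachStep g (n + 1) S) x) ≤ ∑ x ∈ W, (d : ℝ) :=
          Finset.sum_le_sum fun x _ => sub_le_self _ (Nat.cast_nonneg _)
      _ = W.card * d := by rw [Finset.sum_const, nsmul_eq_mul]
      _ ≤ R * d := by
          have : (W.card : ℝ) ≤ R := by exact_mod_cast (mem_cyc.1 hW).2.2.1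
          gcongr
  have hsplit : pot d R (n + 1) (attachStep g (n + 1) S) = (pot d R n g - D) +
      ∑ W ∈ (cyc R (n + 1) (attachStep g (n + 1) S)).filter (fun W => n + 1 ∈ W),
        eps d R ^ W.card * ∑ x ∈ W, ((d : ℝ) - graphDeg (attachStep g (n + 1) S) x) := by
    rw [← hold, ← cyc_filter_attach (S := S), pot]
    exact (Finset.sum_filter_not_add_sum_filter _ _ _).symm
  have hnew : ∀ b : ℝ, 0 ≤ b →
      (∀ W ∈ (cyc R (n + 1) (attachStep g (n + 1) S)).filter (fun W => n + 1 ∈ W),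
        eps d R ^ W.card ≤ b) →
      ∑ W ∈ (cyc R (n + 1) (attachStep g (n + 1) S)).filter (fun W => n + 1 ∈ W),
        eps d R ^ W.card * ∑ x ∈ W, ((d : ℝ) - graphDeg (attachStep g (n + 1) S) x) ≤
      nbd d R * (b * (R * d)) := by
    intro b hb hW
    calc _ ≤ ∑ W ∈ (cyc R (n + 1) (attachStep g (n + 1) S)).filter (fun W => n + 1 ∈ W),
            b * (R * d) := by
          refine Finset.sum_le_sum fun W hW' => ?_
          exact mul_le_mul (hW W hW') (hbd W (Finset.mem_filter.1 hW').1)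
            (Finset.sum_nonneg fun x _ => free_nonneg hd hg' x) hb
      _ ≤ _ := by
          rw [Finset.sum_const, nsmul_eq_mul]
          have : (((cyc R (n + 1) (attachStep g (n + 1) S)).filter (fun W => n + 1 ∈ W)).card : ℝ) ≤
            nbd d R := by exact_mod_cast cyc_card_le hd hg' R (n + 1)
          gcongr
  have hhit : eps d R ^ R * ind ((act d R n g ∩ S).Nonempty) ≤ D := by
    by_cases hh : (act d R n g ∩ S).Nonempty
    · obtain ⟨x, hx⟩ := id hh
      rw [Finset.mem_inter, act, Finset.mem_filter] at hx
      obtain ⟨⟨-, W, hW, hxW⟩, hxS⟩ := hx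
      rw [ind_pos hh, mul_one]
      refine le_trans ?_ (hDle W hW ⟨x, Finset.mem_inter.2 ⟨hxW, hxS⟩⟩)
      exact pow_le_pow_of_le_one he0.le he1 (mem_cyc.1 hW).2.2.1
    · rw [ind_neg hh, mul_zero]
      exact hD0
  have hfin : ∑ W ∈ (cyc R (n + 1) (attachStep g (n + 1) S)).filter (fun W => n + 1 ∈ W),
        eps d R ^ W.card * ∑ x ∈ W, ((d : ℝ) - graphDeg (attachStep g (n + 1) S) x) ≤
      (nbd d R * (R * d)) * ind (Link g n R S) + D / 2 := by
    by_cases hL : Link g n R S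
    · have := hnew 1 zero_le_one fun _ _ => pow_le_one₀ he0.le he1
      rw [ind_pos hL, mul_one]
      rw [one_mul] at this
      exact this.trans (le_add_of_nonneg_right (div_nonneg hD0 zero_le_two))
    · have := hnew (eps d R * D) (mul_nonneg he0.le hD0) fun W hW => ?_
      · rw [ind_neg hL, mul_zero, zero_add]
        refine this.trans ?_
        calc nbd d R * (eps d R * D * (R * d)) = nbd d R * (eps d R * (R * d)) * D := by ring
          _ ≤ 1 / 2 * D := mul_le_mul_of_nonneg_right (eps_mul_le d R) hD0
          _ = D / 2 := by ring
      · rw [Finset.mem_filter, mem_cyc] at hW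
        obtain ⟨⟨h1, h2, h3, h4⟩, h5⟩ := hW
        have hins : insert (n + 1) (W.erase (n + 1)) = W := Finset.insert_erase h5
        obtain ⟨C, hCW, hCc, hCe, hCS⟩ := exists_old_cycle (W := W.erase (n + 1)) hg hL
          (Finset.notMem_erase _ _) (by rwa [hins]) (by rwa [hins]) (by rwa [hins]) hvS
        have hcard := Finset.card_erase_add_one h5
        have hCcard := Finset.card_le_card hCW
        have hC : C ∈ cyc R n g := mem_cyc.2 ⟨hCc.subset_Icc hg hCe, hCc, by omega, hCe⟩
        rw [← hcard, pow_succ, mul_comm]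
        gcongr
        exact (pow_le_pow_of_le_one he0.le he1 hCcard).trans (hDle C hC hCS)
  rw [hsplit]
  refine (add_le_add_right hfin _).trans ?_
  have h2 : eps d R ^ R / 2 * ind ((act d R n g ∩ S).Nonempty) ≤ D / 2 := by
    rw [div_mul_eq_mul_div]; gcongr
  refine (le_of_eq ?_).trans (sub_le_sub_left h2 _)
  ring

lemma savg_hit (hm : 0 < m) (hd : 2 * m < d) (hg : UAReachable m d n g) :
    ((act d R n g).card : ℝ) / n ≤
      savg (lowDegSet d g n) m (fun S => ind ((act d R n g ∩ S).Nonempty)) := by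
  have hle := le_lowDegSet_card hd hg
  have hm' : (0 : ℝ) < m := by exact_mod_cast hm
  have hX : (0 : ℝ) < (lowDegSet d g n).card := by exact_mod_cast hm.trans_le hle
  have h1 := savg_card_inter (B := act d R n g) hle
  have h2 : act d R n g ∩ lowDegSet d g n = act d R n g :=
    Finset.inter_eq_left.2 (Finset.filter_subset _ _)
  rw [h2] at h1
  have h3 : savg (lowDegSet d g n) m (fun S => ((act d R n g ∩ S).card : ℝ)) ≤
      m * savg (lowDegSet d g n) m (fun S => ind ((act d R n g ∩ S).Nonempty)) := by
    rw [← savg_mul]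
    refine savg_mono fun S _ hc => ?_
    by_cases hh : (act d R n g ∩ S).Nonempty
    · rw [ind_pos hh, mul_one, ← hc]
      exact_mod_cast Finset.card_le_card Finset.inter_subset_right
    · rw [ind_neg hh, Finset.not_nonempty_iff_eq_empty.1 hh]
      simp
  rw [h1, mul_div_assoc] at h3
  refine le_trans ?_ (le_of_mul_le_mul_left h3 hm')
  gcongr
  exact_mod_cast lowDegSet_card_le

lemma exp_le_of_ind (p q : Prop) {x y : ℝ} (hx : 0 ≤ x) (hy : 0 ≤ y) :
    Real.exp (x * ind p - y * ind q) ≤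
      1 + (Real.exp x - 1) * ind p - (1 - Real.exp (-y)) * ind q := by
  have h1 : 1 ≤ Real.exp x := Real.one_le_exp hx
  have h2 : Real.exp (-y) ≤ 1 := Real.exp_le_one_iff.2 (by linarith)
  by_cases hp : p <;> by_cases hq : q <;> simp only [ind_pos, ind_neg, hp, hq, not_false_eq_true]
  · rw [mul_one, mul_one, sub_eq_add_neg, Real.exp_add]
    nlinarith
  · simp
  · simp
  · simp

lemma exp_mul_bound {a c A : ℝ} (ha : 0 ≤ a) (hc : 0 < c) (hA : 0 ≤ A) {v : ℝ} :
    Real.exp (a * v) * (A - c * v) ≤ Real.exp (a * (A / c)) * A + 0 * v ∨ v < 0 := by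
  rcases lt_or_ge v 0 with h | h
  · exact Or.inr h
  left
  rw [zero_mul, add_zero]
  rcases le_or_gt (A / c) v with h1 | h1
  · have h2 : A ≤ c * v := by rwa [div_le_iff₀' hc] at h1
    have : Real.exp (a * v) * (A - c * v) ≤ 0 :=
      mul_nonpos_of_nonneg_of_nonpos (Real.exp_pos _).le (by linarith)
    exact this.trans (by positivity)
  · refine mul_le_mul (Real.exp_le_exp.2 (by gcongr)) (by nlinarith) ?_ (Real.exp_pos _).le
    have := (lt_div_iff₀' hc).1 h1
    linarith

lemma exp_pot_bound (hm : 2 ≤ m) (hd : 2 * m < d) (R : ℕ) {a : ℝ} (ha : 0 < a) {T : ℕ}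
    {E : ℕ → (SimpleGraph ℕ → ℝ) →ₗ[ℝ] ℝ} (hE : Chain m d T E) :
    ∃ D, ∀ n, E n (fun g => Real.exp (a * pot d R n g)) ≤ D := by
  have hm0 : 0 < m := by omega
  have hk := kap_pos hd
  set M : ℝ := nbd d R * (R * d) with hM
  set η : ℝ := eps d R ^ R / 2 with hη
  have hη0 : 0 < η := by have := eps_pos d R; positivity
  set L : ℝ := Real.exp (a * M) - 1 with hL
  have hL0 : 0 ≤ L := sub_nonneg.2 (Real.one_le_exp (by positivity))
  set H : ℝ := 1 - Real.exp (-(a * η)) with hH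
  have hH0 : 0 < H := sub_pos.2 (Real.exp_lt_one_iff.2 (neg_lt_zero.2 (mul_pos ha hη0)))
  set K : ℝ := (d + 1 : ℝ) ^ R * (m / kap m d) ^ 2 with hK
  have hK0 : 0 ≤ K := by positivity
  have hBd : (0 : ℝ) < nbd d R * d := mul_pos (nbd_pos d R) (by exact_mod_cast (by omega))
  set c : ℝ := H / (nbd d R * d) with hcdef
  have hc : 0 < c := by positivity
  set A : ℝ := L * K + 1 with hA
  have hA0 : 0 ≤ A := by positivity
  refine bounded_of_contract (α := 1) (C := Real.exp (a * (A / c)) * A) one_pos (N := T) fun n hn => ?_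
  rw [hE.step n hn]
  have hstep : ∀ g, UAReachable m d n g →
      stepL m d n (fun g => Real.exp (a * pot d R (n + 1) g)) g ≤
        (1 - 1 / (n : ℝ)) * Real.exp (a * pot d R n g) + Real.exp (a * (A / c)) * A / n * 1 := by
    intro g hg
    have hn0 : (0 : ℝ) < n := by exact_mod_cast hm0.trans_le (reach_le hg)
    rw [stepL_apply]
    have hle := le_lowDegSet_card hd hg
    have h1 : savg (lowDegSet d g n) m
        (fun S => Real.exp (a * pot d R (n + 1) (attachStep g (n + 1) S))) ≤
        savg (lowDegSet d g n) m (fun S => Real.exp (a * pot d R n g) *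
          (1 + L * ind (Link g n R S) - H * ind ((act d R n g ∩ S).Nonempty))) := by
      refine savg_mono fun S hS hcS => ?_
      have h2 := pot_attach_le (R := R) hd hg hS hcS
      have h3 := exp_le_of_ind (Link g n R S) ((act d R n g ∩ S).Nonempty)
        (x := a * M) (y := a * η) (by positivity) (by positivity)
      refine le_trans ?_ (mul_le_mul_of_nonneg_left h3 (Real.exp_pos _).le)
      rw [← Real.exp_add]
      refine Real.exp_le_exp.2 ?_
      refine (mul_le_mul_of_nonneg_left h2 ha.le).trans (le_of_eq ?_)
      rw [hM, hη]
      ring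
    refine h1.trans ?_
    rw [savg_mul, savg_sub, savg_add, savg_const hle, savg_mul, savg_mul]
    have h4 := savg_link hm0 hd hg R
    have h5 := savg_hit (R := R) hm0 hd hg
    have h6 := pot_le (R := R) hd hg
    have h7 := pot_nonneg (R := R) hd hg
    have h8 : c * pot d R n g / n ≤
        H * savg (lowDegSet d g n) m (fun S => ind ((act d R n g ∩ S).Nonempty)) := by
      calc c * pot d R n g / n = H * (pot d R n g / (nbd d R * d) / n) := by
            rw [hcdef]; field_simp
        _ ≤ H * ((act d R n g).card / n) := by
            gcongr
            rwa [div_le_iff₀' hBd]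
        _ ≤ _ := by gcongr
    have h9 : L * savg (lowDegSet d g n) m (fun S => ind (Link g n R S)) ≤ L * K / n := by
      rw [mul_div_assoc]; gcongr
    have h10 := (exp_mul_bound ha.le hc hA0 (v := pot d R n g)).resolve_right (not_lt.2 h7)
    calc _ ≤ Real.exp (a * pot d R n g) * (1 + L * K / n - c * pot d R n g / n) := by
          refine mul_le_mul_of_nonneg_left (by linarith) (Real.exp_pos _).le
      _ = (1 - 1 / (n : ℝ)) * Real.exp (a * pot d R n g) +
          Real.exp (a * pot d R n g) * (A - c * pot d R n g) / n := by
            rw [hA]; field_simp; ring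
      _ ≤ _ := by
          rw [mul_one]
          rw [zero_mul, add_zero] at h10
          gcongr
  refine (hE.mono n hn _ _ hstep).trans (le_of_eq ?_)
  rw [hE.add, hE.mul, hE.mul, hE.one n hn, mul_one]

end

section

/-- Weights of finite sets of vertices in graphs with prescribed degrees. -/
abbrev Weight : Type 1 := ∀ V : Type, SimpleGraph V → (V → ℕ) → Finset V → ℝ

/-- The total weight of all sets of vertices of a graph on `[n]`. -/
noncomputable def Weight.tot (F : Weight) (n : ℕ) (g : SimpleGraph ℕ) : ℝ :=
  ∑ W ∈ (Finset.Icc 1 n).powerset, F ℕ g (graphDeg g) W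

/-- Isomorphism-invariant weights carried by small sets without tree components or saturated
components. -/
structure Weight.IsLocal (F : Weight) (d R : ℕ) : Prop where
  nonneg : ∀ V G D W, 0 ≤ F V G D W
  image : ∀ {V V' : Type} [DecidableEq V] (G : SimpleGraph V) (D : V → ℕ) {φ : V' → V},
    Function.Injective φ → ∀ W : Finset V', F V G D (W.image φ) = F V' (G.comap φ) (D ∘ φ) W
  supp : ∀ V G D W, (∀ x, D x ≤ d) → F V G D W ≠ 0 → W.card ≤ R ∧ W.card ≤ eC G W ∧
    ∀ B, B ⊆ W → B.Nonempty → ClosedIn G W B → ∃ x ∈ B, D x < d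

/-- No part of `W` has excess larger than one. -/
def Exc {V : Type*} (G : SimpleGraph V) (W : Finset V) : Prop :=
  ∀ B, B ⊆ W → eC G B ≤ B.card + 1

lemma exc_image {V V' : Type*} [DecidableEq V] (G : SimpleGraph V) {φ : V' → V}
    (hφ : Function.Injective φ) (W : Finset V') :
    Exc G (W.image φ) ↔ Exc (G.comap φ) W := by
  constructor
  · intro h B hB
    have := h (B.image φ) (Finset.image_subset_image hB)
    rwa [eC_image hφ, Finset.card_image_of_injective _ hφ] at this
  · intro h B hB
    obtain ⟨B', hsub, rfl⟩ := Finset.subset_image_iff.1 hB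
    rw [eC_image hφ, Finset.card_image_of_injective _ hφ]
    exact h B' (by exact_mod_cast hsub)

/-- The restriction of a weight to sets of small excess. -/
noncomputable def Weight.exc (F : Weight) : Weight := fun V G D W => F V G D W * ind (Exc G W)

variable {m d n R : ℕ} {g : SimpleGraph ℕ} {F : Weight}

lemma Weight.IsLocal.exc (hF : F.IsLocal d R) : F.exc.IsLocal d R where
  nonneg V G D W := mul_nonneg (hF.nonneg V G D W) (ind_nonneg _)
  image G D φ hφ W := by
    simp only [Weight.exc]
    rw [hF.image G D hφ, exc_image G hφ]
  supp V G D W hD h := hF.supp V G D W hD (left_ne_zero_of_mul h)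

/-- The injections of `Fin q` into `[n]`. -/
noncomputable def injs (q n : ℕ) : Finset (Fin q → ℕ) :=
  (Fintype.piFinset fun _ => Finset.Icc 1 n).filter Function.Injective

lemma mem_injs {q n : ℕ} {φ : Fin q → ℕ} :
    φ ∈ injs q n ↔ (∀ i, φ i ∈ Finset.Icc 1 n) ∧ Function.Injective φ := by
  rw [injs, Finset.mem_filter, Fintype.mem_piFinset]

lemma card_injs_image {q : ℕ} {W : Finset ℕ} (hW : W ∈ (Finset.Icc 1 n).powersetCard q) :
    ((injs q n).filter (fun φ => Finset.univ.image φ = W)).card = q.factorial := by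
  rw [Finset.mem_powersetCard] at hW
  obtain ⟨hW, hq⟩ := hW
  have hc : Fintype.card (Fin q) = Fintype.card W := by simp [hq]
  have e0 : Fin q ≃ W := Fintype.equivOfCardEq hc
  have h1 : Fintype.card (Fin q ≃ W) = q.factorial := by
    rw [Fintype.card_equiv e0, Fintype.card_fin]
  rw [← h1, ← Finset.card_univ]
  symm
  refine Finset.card_bij (fun e _ => fun i => ((e i : W) : ℕ)) ?_ ?_ ?_
  · intro e _
    rw [Finset.mem_filter, mem_injs]
    refine ⟨⟨fun i => hW (e i).2, fun i j h => e.injective (Subtype.ext h)⟩, ?_⟩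
    ext x
    simp only [Finset.mem_image, Finset.mem_univ, true_and]
    constructor
    · rintro ⟨i, rfl⟩; exact (e i).2
    · intro hx; exact ⟨e.symm ⟨x, hx⟩, by simp⟩
  · intro e _ e' _ h
    ext i
    exact congrFun h i
  · intro φ hφ
    rw [Finset.mem_filter, mem_injs] at hφ
    have hmem : ∀ i, φ i ∈ W := fun i => by
      rw [← hφ.2]; exact Finset.mem_image_of_mem _ (Finset.mem_univ i)
    have hinj : Function.Injective (fun i => (⟨φ i, hmem i⟩ : W)) := fun i j h =>
      hφ.1.2 (congrArg Subtype.val h)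
    refine ⟨Equiv.ofBijective _ ((Fintype.bijective_iff_injective_and_card _).2 ⟨hinj, hc⟩),
      Finset.mem_univ _, ?_⟩
    rfl

lemma sum_injs_image (q n : ℕ) (H : Finset ℕ → ℝ) :
    ∑ φ ∈ injs q n, H (Finset.univ.image φ) =
      q.factorial * ∑ W ∈ (Finset.Icc 1 n).powersetCard q, H W := by
  rw [← Finset.sum_fiberwise_of_maps_to' (t := (Finset.Icc 1 n).powersetCard q)
    (g := fun φ : Fin q → ℕ => Finset.univ.image φ) _ H, Finset.mul_sum]
  · refine Finset.sum_congr rfl fun W hW => ?_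
    rw [Finset.sum_const, nsmul_eq_mul, card_injs_image hW]
  · intro φ hφ
    rw [mem_injs] at hφ
    rw [Finset.mem_powersetCard, Finset.card_image_of_injective _ hφ.2, Finset.card_univ,
      Fintype.card_fin]
    refine ⟨fun x hx => ?_, rfl⟩
    obtain ⟨i, -, rfl⟩ := Finset.mem_image.1 hx
    exact hφ.1 i

lemma sum_injs_pattern (hd : 2 * m < d) (hg : UAReachable m d n g) (q : ℕ)
    (H : SimpleGraph (Fin q) → (Fin q → ℕ) → ℝ) :
    ∑ φ ∈ injs q n, H (g.comap φ) (graphDeg g ∘ φ) =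
      ∑ p : SimpleGraph (Fin q) × (Fin q → Fin (d + 1)),
        H p.1 (fun i => p.2 i) * (emb p.1 p.1 n g Finset.univ (fun i => (p.2 i : ℕ))).card := by
  have hlt : ∀ x, graphDeg g x < d + 1 := fun x => Nat.lt_succ_iff.2 (reach_deg_le hd hg x)
  rw [← Finset.sum_fiberwise_of_maps_to
    (t := (Finset.univ : Finset (SimpleGraph (Fin q) × (Fin q → Fin (d + 1)))))
    (g := fun φ : Fin q → ℕ => (g.comap φ, fun i => (⟨graphDeg g (φ i), hlt _⟩ : Fin (d + 1))))
    (fun _ _ => Finset.mem_univ _)]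
  refine Finset.sum_congr rfl fun p _ => ?_
  have hset : (injs q n).filter (fun φ =>
      (g.comap φ, fun i => (⟨graphDeg g (φ i), hlt _⟩ : Fin (d + 1))) = p) =
      emb p.1 p.1 n g Finset.univ (fun i => (p.2 i : ℕ)) := by
    ext φ
    rw [Finset.mem_filter, mem_injs, mem_emb]
    constructor
    · rintro ⟨⟨h1, h2⟩, rfl⟩
      exact ⟨fun i _ => Finset.mem_Icc.1 (h1 i), fun i hi => absurd (Finset.mem_univ i) hi,
        fun i _ j _ h => h2 h, fun i _ j _ h => h, fun i _ j _ h => h, fun i _ => rfl⟩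
    · intro h
      refine ⟨⟨fun i => Finset.mem_Icc.2 (h.mem i (Finset.mem_univ i)),
        fun i j hij => h.inj i (Finset.mem_univ i) j (Finset.mem_univ j) hij⟩, ?_⟩
      refine Prod.ext ?_ ?_
      · ext i j
        exact ⟨h.adj' i (Finset.mem_univ i) j (Finset.mem_univ j),
          h.adj i (Finset.mem_univ i) j (Finset.mem_univ j)⟩
      · funext i
        exact Fin.ext (h.deg i (Finset.mem_univ i))
  rw [← hset, mul_comm, ← nsmul_eq_mul, ← Finset.sum_const]
  refine Finset.sum_congr rfl fun φ hφ => ?_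
  rw [← (Finset.mem_filter.1 hφ).2]
  rfl

lemma Weight.IsLocal.tot_eq (hF : F.IsLocal d R) (hd : 2 * m < d) (hg : UAReachable m d n g) :
    F.tot n g = ∑ q ∈ Finset.range (R + 1), ∑ p : SimpleGraph (Fin q) × (Fin q → Fin (d + 1)),
      (q.factorial : ℝ)⁻¹ * F (Fin q) p.1 (fun i => p.2 i) Finset.univ *
        (emb p.1 p.1 n g Finset.univ (fun i => (p.2 i : ℕ))).card := by
  have h1 : F.tot n g = ∑ q ∈ Finset.range (R + 1),
      ∑ W ∈ (Finset.Icc 1 n).powersetCard q, F ℕ g (graphDeg g) W := by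
    rw [Weight.tot, ← Finset.sum_filter_add_sum_filter_not (Finset.Icc 1 n).powerset
      (fun W => W.card ∈ Finset.range (R + 1))]
    rw [Finset.sum_eq_zero (s := Finset.filter
      (fun W : Finset ℕ => ¬ W.card ∈ Finset.range (R + 1)) (Finset.Icc 1 n).powerset), add_zero]
    · rw [← Finset.sum_fiberwise_of_maps_to (t := Finset.range (R + 1)) (g := Finset.card)
        (fun W hW => (Finset.mem_filter.1 hW).2)]
      refine Finset.sum_congr rfl fun q hq => Finset.sum_congr ?_ fun _ _ => rfl
      ext W
      simp only [Finset.mem_filter, Finset.mem_powerset, Finset.mem_powersetCard]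
      constructor
      · rintro ⟨⟨h1, -⟩, h3⟩; exact ⟨h1, h3⟩
      · rintro ⟨h1, h3⟩; exact ⟨⟨h1, h3 ▸ hq⟩, h3⟩
    · intro W hW
      by_contra hne
      have := (hF.supp ℕ g (graphDeg g) W (reach_deg_le hd hg) hne).1
      exact (Finset.mem_filter.1 hW).2 (Finset.mem_range.2 (by omega))
  rw [h1]
  refine Finset.sum_congr rfl fun q _ => ?_
  have hq : (q.factorial : ℝ) ≠ 0 := by exact_mod_cast q.factorial_ne_zero
  have h2 := sum_injs_image q n (F ℕ g (graphDeg g))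
  rw [← inv_mul_eq_iff_eq_mul₀ hq] at h2
  rw [← h2, Finset.sum_congr rfl fun φ hφ => hF.image g (graphDeg g) (mem_injs.1 hφ).2 Finset.univ,
    sum_injs_pattern hd hg q (fun Q δ => F (Fin q) Q δ Finset.univ), Finset.mul_sum]
  exact Finset.sum_congr rfl fun p _ => by ring

lemma Weight.IsLocal.pattern_tendsto (hF : F.IsLocal d R) (hm : 2 ≤ m) (hd : 2 * m < d) {q : ℕ}
    (p : SimpleGraph (Fin q) × (Fin q → Fin (d + 1))) :
    ∃ t : ℝ, ∀ T E, Chain m d T E → Tendsto (fun n => E n (fun g =>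
      F.exc (Fin q) p.1 (fun i => p.2 i) Finset.univ *
        ((emb p.1 p.1 n g Finset.univ (fun i => (p.2 i : ℕ))).card : ℝ))) atTop (𝓝 t) := by
  by_cases h0 : F.exc (Fin q) p.1 (fun i => p.2 i) Finset.univ = 0
  · refine ⟨0, fun T E hE => ?_⟩
    simp only [h0, zero_mul]
    have : ∀ n, E n (fun _ => (0 : ℝ)) = 0 := fun n => map_zero (E n)
    simp only [this]
    exact tendsto_const_nhds
  have hle : ∀ i, ((p.2 i : Fin (d + 1)) : ℕ) ≤ d := fun i => Nat.lt_succ_iff.1 (p.2 i).2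
  obtain ⟨-, h2, h3⟩ := hF.supp _ _ _ _ hle (left_ne_zero_of_mul h0)
  have hexc : Exc p.1 Finset.univ := by
    by_contra hne
    exact right_ne_zero_of_mul h0 (ind_neg hne)
  have hgood : Good p.1 d Finset.univ (fun i => (p.2 i : ℕ)) := by
    refine ⟨fun i _ => hle i, hexc, fun B hB hn hc => ?_⟩
    obtain ⟨x, hx, hxd⟩ := h3 B hB hn hc
    have : 1 ≤ low d (fun i => (p.2 i : ℕ)) B := Finset.card_pos.2 ⟨x, by simp [hx, hxd]⟩
    have := hexc B hB
    omega
  obtain ⟨t, ht⟩ := pattern_limit (Q' := p.1) hm hd hgood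
  have hchi : chi p.1 Finset.univ ≤ 0 := by
    rw [chi]; have : ((Finset.univ : Finset (Fin q)).card : ℤ) ≤ eC p.1 Finset.univ := by exact_mod_cast h2
    omega
  obtain ⟨u, hu⟩ : ∃ u : ℝ, Tendsto (fun n : ℕ => (n : ℝ) ^ chi p.1 (Finset.univ : Finset (Fin q)))
      atTop (𝓝 u) := by
    rcases hchi.lt_or_eq with h | h
    · exact ⟨0, (tendsto_zpow_atTop_zero h).comp tendsto_natCast_atTop_atTop⟩
    · rw [h]; exact ⟨1, by simp⟩
  refine ⟨F.exc (Fin q) p.1 (fun i => p.2 i) Finset.univ * (t * u), fun T E hE => ?_⟩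
  simp only [hE.mul]
  refine Tendsto.const_mul _ (((ht T E hE).mul hu).congr' ?_)
  filter_upwards [eventually_gt_atTop 0] with n hn
  have : (0 : ℝ) < n := by exact_mod_cast hn
  rw [div_mul_cancel₀ _ (zpow_pos this _).ne']

lemma Weight.IsLocal.exc_tendsto (hF : F.IsLocal d R) (hm : 2 ≤ m) (hd : 2 * m < d) :
    ∃ t : ℝ, ∀ T E, Chain m d T E → Tendsto (fun n => E n (fun g => F.exc.tot n g)) atTop (𝓝 t) := by
  choose t ht using fun (q : ℕ) (p : SimpleGraph (Fin q) × (Fin q → Fin (d + 1))) =>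
    hF.pattern_tendsto hm hd p
  refine ⟨∑ q ∈ Finset.range (R + 1), ∑ p : SimpleGraph (Fin q) × (Fin q → Fin (d + 1)),
    (q.factorial : ℝ)⁻¹ * t q p, fun T E hE => ?_⟩
  have h1 : Tendsto (fun n => ∑ q ∈ Finset.range (R + 1),
      ∑ p : SimpleGraph (Fin q) × (Fin q → Fin (d + 1)), (q.factorial : ℝ)⁻¹ * E n (fun g =>
      F.exc (Fin q) p.1 (fun i => p.2 i) Finset.univ *
        ((emb p.1 p.1 n g Finset.univ (fun i => (p.2 i : ℕ))).card : ℝ))) atTop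
      (𝓝 (∑ q ∈ Finset.range (R + 1), ∑ p : SimpleGraph (Fin q) × (Fin q → Fin (d + 1)),
    (q.factorial : ℝ)⁻¹ * t q p)) :=
    tendsto_finsetSum _ fun q _ => tendsto_finsetSum _ fun p _ => (ht q p T E hE).const_mul _
  refine h1.congr' ?_
  filter_upwards [eventually_ge_atTop T] with n hn
  rw [hE.congr hn fun g hg => hF.exc.tot_eq hd hg, hE.sum]
  refine Finset.sum_congr rfl fun q _ => ?_
  rw [hE.sum]
  refine Finset.sum_congr rfl fun p _ => ?_
  rw [← hE.mul]
  simp only [mul_assoc]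

lemma Weight.IsLocal.bad_of_not_exc (hF : F.IsLocal d R) (hd : 2 * m < d) (hg : UAReachable m d n g)
    {W : Finset ℕ} (h0 : F ℕ g (graphDeg g) W ≠ 0) (hW : ¬ Exc g W) : Bad d R g := by
  obtain ⟨h1, -, h3⟩ := hF.supp _ _ _ _ (reach_deg_le hd hg) h0
  unfold Exc at hW
  push Not at hW
  obtain ⟨B, hB, hBe⟩ := hW
  obtain ⟨C, hCB, hCn, hCc, hCe⟩ := exists_cutConn_complex (G := g) (B := B) (by omega)
  obtain ⟨C', hCC', hC'W, hC'c, hC'cl⟩ := exists_closed_cutConn (hCB.trans hB) hCc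
  have h4 := mono_excess hC'c hCC' hCn
  exact ⟨C', ⟨hC'c, by omega⟩, (Finset.card_le_card hC'W).trans h1,
    h3 C' hC'W (hCn.mono hCC') hC'cl⟩

lemma Weight.IsLocal.tot_le (hF : F.IsLocal d R) (hd : 2 * m < d) (hg : UAReachable m d n g) :
    F.exc.tot n g ≤ F.tot n g ∧ F.tot n g ≤ F.exc.tot n g + F.tot n g * ind (Bad d R g) := by
  constructor
  · exact Finset.sum_le_sum fun W _ => mul_le_of_le_one_right (hF.nonneg _ _ _ _) (ind_le_one _)
  · rw [Weight.tot, Weight.tot, Finset.sum_mul, ← Finset.sum_add_distrib]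
    refine Finset.sum_le_sum fun W _ => ?_
    have h0 := hF.nonneg ℕ g (graphDeg g) W
    by_cases hE : Exc g W
    · simp only [Weight.exc]
      rw [ind_pos hE, mul_one]
      exact le_add_of_nonneg_right (mul_nonneg h0 (ind_nonneg _))
    · by_cases hz : F ℕ g (graphDeg g) W = 0
      · simp [Weight.exc, hz]
      · simp only [Weight.exc]
        rw [ind_neg hE, ind_pos (hF.bad_of_not_exc hd hg hz hE), mul_zero, zero_add, mul_one]

end

section

/-- Bounded isomorphism-invariant weights carried by small connected sets which contain a cycle and
an unsaturated vertex. -/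
structure Weight.IsConn (w : Weight) (d R : ℕ) (C : ℝ) : Prop where
  nonneg : ∀ V G D W, 0 ≤ w V G D W
  image : ∀ {V V' : Type} [DecidableEq V] (G : SimpleGraph V) (D : V → ℕ) {φ : V' → V},
    Function.Injective φ → ∀ W : Finset V', w V G D (W.image φ) = w V' (G.comap φ) (D ∘ φ) W
  supp : ∀ V G D W, (∀ x, D x ≤ d) → w V G D W ≠ 0 → CutConn G W ∧ W.card ≤ R ∧
    W.card ≤ eC G W ∧ ∃ x ∈ W, D x < d
  le : ∀ V G D W, w V G D W ≤ C

/-- The convolution of two weights with respect to unions of sets. -/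
noncomputable def Weight.conv (F w : Weight) : Weight := fun V G D W =>
  ∑ p ∈ (W.powerset ×ˢ W.powerset).filter (fun p => p.1 ∪ p.2 = W), F V G D p.1 * w V G D p.2

/-- The convolution powers of a weight. -/
noncomputable def Weight.convPow (w : Weight) : ℕ → Weight
  | 0 => fun _ _ _ W => ind (W = ∅)
  | r + 1 => (w.convPow r).conv w

variable {m d n R R' : ℕ} {g : SimpleGraph ℕ} {F w : Weight} {C : ℝ}

lemma Weight.tot_conv (F w : Weight) (n : ℕ) (g : SimpleGraph ℕ) :
    (F.conv w).tot n g = F.tot n g * w.tot n g := by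
  rw [Weight.tot, Weight.tot, Weight.tot, Finset.sum_mul_sum, ← Finset.sum_product',
    ← Finset.sum_fiberwise_of_maps_to (t := (Finset.Icc 1 n).powerset)
      (g := fun p : Finset ℕ × Finset ℕ => p.1 ∪ p.2)]
  · refine Finset.sum_congr rfl fun W hW => ?_
    rw [Finset.mem_powerset] at hW
    refine Finset.sum_congr ?_ fun _ _ => rfl
    ext p
    simp only [Finset.mem_filter, Finset.mem_product, Finset.mem_powerset]
    constructor
    · rintro ⟨⟨h1, h2⟩, h3⟩; exact ⟨⟨h1.trans hW, h2.trans hW⟩, by convert h3⟩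
    · rintro ⟨-, rfl⟩
      refine ⟨⟨Finset.subset_union_left, Finset.subset_union_right⟩, ?_⟩
      congr!
  · intro p hp
    simp only [Finset.mem_product, Finset.mem_powerset] at hp ⊢
    exact Finset.union_subset hp.1 hp.2

lemma Weight.tot_convPow (w : Weight) (r n : ℕ) (g : SimpleGraph ℕ) :
    (w.convPow r).tot n g = w.tot n g ^ r := by
  induction r with
  | zero =>
    rw [Weight.tot, pow_zero, Finset.sum_eq_single ∅]
    · exact ind_pos rfl
    · intro W _ hW; exact ind_neg hW
    · intro h; simp at h
  | succ r ih => rw [Weight.convPow, Weight.tot_conv, ih, pow_succ]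

lemma Weight.IsLocal.conv (hF : F.IsLocal d R') (hw : w.IsConn d R C) :
    (F.conv w).IsLocal d (R' + R) where
  nonneg V G D W := Finset.sum_nonneg fun p _ => mul_nonneg (hF.nonneg _ _ _ _) (hw.nonneg _ _ _ _)
  image {V V' inst} G D φ hφ W := by
    obtain rfl : inst = fun a b => Classical.propDecidable _ := Subsingleton.elim _ _
    refine (Finset.sum_bij (fun p _ => (p.1.image φ, p.2.image φ)) ?_ ?_ ?_ ?_).symm
    · intro p hp
      simp only [Finset.mem_filter, Finset.mem_product, Finset.mem_powerset] at hp ⊢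
      refine ⟨⟨Finset.image_subset_image hp.1.1, Finset.image_subset_image hp.1.2⟩, ?_⟩
      rw [← Finset.image_union, hp.2]
    · intro p _ q _ h
      rw [Prod.mk.injEq] at h
      exact Prod.ext (Finset.image_injective hφ h.1) (Finset.image_injective hφ h.2)
    · intro p hp
      simp only [Finset.mem_filter, Finset.mem_product, Finset.mem_powerset] at hp
      obtain ⟨A, hA, hA'⟩ := Finset.subset_image_iff.1 hp.1.1
      obtain ⟨B, hB, hB'⟩ := Finset.subset_image_iff.1 hp.1.2
      refine ⟨(A, B), ?_, Prod.ext hA' hB'⟩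
      simp only [Finset.mem_filter, Finset.mem_product, Finset.mem_powerset]
      refine ⟨⟨by exact_mod_cast hA, by exact_mod_cast hB⟩, Finset.image_injective hφ ?_⟩
      rw [Finset.image_union, hA', hB', hp.2]
    · intro p _
      rw [hF.image G D hφ, hw.image G D hφ]
  supp V G D W hD h := by
    obtain ⟨p, hp, hne⟩ := Finset.exists_ne_zero_of_sum_ne_zero h
    simp only [Finset.mem_filter] at hp
    obtain ⟨a1, a2, a3⟩ := hF.supp V G D p.1 hD (left_ne_zero_of_mul hne)
    obtain ⟨b1, b2, b3, b4⟩ := hw.supp V G D p.2 hD (right_ne_zero_of_mul hne)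
    obtain ⟨A, W'⟩ := p
    obtain ⟨-, rfl⟩ := hp
    refine ⟨(Finset.card_union_le _ _).trans (by simp only at *; omega),
      excess_union b1 b3 a2, fun B hB hBn hBc => ?_⟩
    by_cases hA : (B ∩ A).Nonempty
    · obtain ⟨x, hx, hxd⟩ := a3 (B ∩ A) Finset.inter_subset_right hA (fun x hx y hy hxy =>
        Finset.mem_inter.2 ⟨hBc x (Finset.mem_inter.1 hx).1 y (Finset.mem_union_left _ hy) hxy, hy⟩)
      exact ⟨x, (Finset.mem_inter.1 hx).1, hxd⟩
    · have hBW : B ⊆ W' := fun x hx => by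
        rcases Finset.mem_union.1 (hB hx) with h | h
        · exact absurd ⟨x, Finset.mem_inter.2 ⟨hx, h⟩⟩ hA
        · exact h
      have : B = W' := by
        by_contra hne
        obtain ⟨x, hx, y, hy, hyB, hxy⟩ := b1 B hBW hBn hne
        exact hyB (hBc x hx y (Finset.mem_union_right _ hy) hxy)
      rw [this]; exact b4

lemma Weight.IsConn.convPow (hw : w.IsConn d R C) (r : ℕ) : (w.convPow r).IsLocal d (r * R) := by
  induction r with
  | zero =>
    refine ⟨fun _ _ _ _ => ind_nonneg _, ?_, ?_⟩
    · intro V V' _ G D φ _ W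
      simp only [Weight.convPow, Finset.image_eq_empty]
    · intro V G D W _ h
      have hW : W = ∅ := by by_contra hne; exact h (ind_neg hne)
      subst hW
      refine ⟨by simp, by simp, fun B hB hn => ?_⟩
      rw [Finset.subset_empty.1 hB] at hn
      simp at hn
  | succ r ih => rw [Nat.succ_mul]; exact ih.conv hw

lemma Weight.IsConn.tot_nonneg (hw : w.IsConn d R C) (n : ℕ) (g : SimpleGraph ℕ) : 0 ≤ w.tot n g :=
  Finset.sum_nonneg fun _ _ => hw.nonneg _ _ _ _

lemma Weight.IsConn.tot_le_pot (hw : w.IsConn d R C) (hd : 2 * m < d) (hg : UAReachable m d n g) :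
    w.tot n g ≤ C / eps d R ^ R * pot d R n g := by
  have hC : 0 ≤ C := (hw.nonneg ℕ ⊥ (fun _ => 0) ∅).trans (hw.le _ _ _ _)
  have hε := eps_pos d R
  have hs : cyc R n g ⊆ (Finset.Icc 1 n).powerset := fun W hW =>
    Finset.mem_powerset.2 (mem_cyc.1 hW).1
  rw [Weight.tot, ← Finset.sum_subset hs, pot, Finset.mul_sum]
  · refine Finset.sum_le_sum fun W hW => ?_
    have hnn : ∀ x ∈ W, (0 : ℝ) ≤ (d : ℝ) - graphDeg g x := fun x _ => free_nonneg hd hg x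
    by_cases h0 : w ℕ g (graphDeg g) W = 0
    · rw [h0]
      exact mul_nonneg (div_nonneg hC (pow_nonneg hε.le _))
        (mul_nonneg (pow_nonneg hε.le _) (Finset.sum_nonneg hnn))
    · obtain ⟨-, h2, -, x, hx, hxd⟩ := hw.supp _ _ _ _ (reach_deg_le hd hg) h0
      have h1 : (1 : ℝ) ≤ ∑ x ∈ W, ((d : ℝ) - graphDeg g x) := by
        refine le_trans ?_ (Finset.single_le_sum hnn hx)
        have : (graphDeg g x : ℝ) + 1 ≤ d := by exact_mod_cast hxd
        linarith
      have h3 : eps d R ^ R ≤ eps d R ^ W.card := pow_le_pow_of_le_one hε.le (eps_le_one d R) h2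
      have h4 : eps d R ^ R ≤ eps d R ^ W.card * ∑ x ∈ W, ((d : ℝ) - graphDeg g x) :=
        h3.trans (le_mul_of_one_le_right (pow_nonneg hε.le _) h1)
      refine (hw.le _ _ _ _).trans ?_
      rw [div_mul_eq_mul_div, le_div_iff₀ (pow_pos hε _)]
      exact mul_le_mul_of_nonneg_left h4 hC
  · intro W hW hc
    by_contra h0
    obtain ⟨h1, h2, h3, -⟩ := hw.supp _ _ _ _ (reach_deg_le hd hg) h0
    exact hc (mem_cyc.2 ⟨Finset.mem_powerset.1 hW, h1, h2, h3⟩)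

variable {T : ℕ} {E : ℕ → (SimpleGraph ℕ → ℝ) →ₗ[ℝ] ℝ}

lemma Weight.IsConn.exp_bound (hw : w.IsConn d R C) (hm : 2 ≤ m) (hd : 2 * m < d)
    (hE : Chain m d T E) (a : ℝ) (ha : 0 ≤ a) :
    ∃ D, 0 ≤ D ∧ ∀ n, T ≤ n → E n (fun g => Real.exp (a * w.tot n g)) ≤ D := by
  have hC : 0 ≤ C := (hw.nonneg ℕ ⊥ (fun _ => 0) ∅).trans (hw.le _ _ _ _)
  have hε := eps_pos d R
  have hA : 0 ≤ C / eps d R ^ R := by positivity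
  obtain ⟨D, hD⟩ := exp_pot_bound hm hd R (a := a * (C / eps d R ^ R) + 1) (by positivity) hE
  have key : ∀ n, T ≤ n → E n (fun g => Real.exp (a * w.tot n g)) ≤ D := fun n hn => by
    refine (hE.mono n hn _ _ fun g hg => Real.exp_le_exp.2 ?_).trans (hD n)
    have h1 := mul_le_mul_of_nonneg_left (hw.tot_le_pot hd hg) ha
    have h2 := pot_nonneg (R := R) hd hg
    nlinarith
  exact ⟨D, (hE.nonneg le_rfl fun g _ => (Real.exp_pos _).le).trans (key T le_rfl), key⟩

lemma Weight.IsConn.pow_bound (hw : w.IsConn d R C) (hm : 2 ≤ m) (hd : 2 * m < d)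
    (hE : Chain m d T E) (r : ℕ) :
    ∃ D, 0 ≤ D ∧ ∀ n, T ≤ n → E n (fun g => w.tot n g ^ r) ≤ D := by
  obtain ⟨D, hD0, hD⟩ := hw.exp_bound hm hd hE 1 zero_le_one
  refine ⟨r.factorial * D, by positivity, fun n hn => ?_⟩
  refine le_trans ?_ (mul_le_mul_of_nonneg_left (hD n hn) (by positivity))
  rw [← hE.mul]
  refine hE.mono n hn _ _ fun g _ => ?_
  have h := Real.pow_div_factorial_le_exp (w.tot n g) (hw.tot_nonneg n g) r
  rw [div_le_iff₀ (by positivity)] at h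
  rw [one_mul]
  linarith

lemma Weight.IsConn.pow_bad_tendsto (hw : w.IsConn d R C) (hm : 2 ≤ m) (hd : 2 * m < d)
    (hE : Chain m d T E) (r R' : ℕ) :
    Tendsto (fun n => E n (fun g => w.tot n g ^ r * ind (Bad d R' g))) atTop (𝓝 0) := by
  obtain ⟨D, hD0, hD⟩ := hw.pow_bound hm hd hE (r * 2)
  obtain ⟨C', hC', hB⟩ := bad_bound hm hd R'
  rw [Metric.tendsto_atTop']
  intro δ hδ
  have hε : 0 < δ / (2 * (D + 1)) := by positivity
  set ε := δ / (2 * (D + 1)) with hεdef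
  have hεD : ε * D < δ / 2 := by
    have : ε * (D + 1) = δ / 2 := by rw [hεdef]; field_simp
    nlinarith
  have hlim : Tendsto (fun n : ℕ => 1 / (4 * ε) * (C' * (n : ℝ)⁻¹)) atTop (𝓝 0) := by
    have := (tendsto_inv_atTop_nhds_zero_nat (𝕜 := ℝ)).const_mul C' |>.const_mul (1 / (4 * ε))
    simpa using this
  have hev := (hlim.eventually (gt_mem_nhds (half_pos hδ))).and
    ((hB T E hE).and (eventually_ge_atTop T))
  obtain ⟨N, hN⟩ := eventually_atTop.1 hev
  refine ⟨N, fun n hn => ?_⟩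
  obtain ⟨h1, h2, hTn⟩ := hN n hn.le
  have h0 : 0 ≤ E n (fun g => w.tot n g ^ r * ind (Bad d R' g)) :=
    hE.nonneg hTn fun g _ => mul_nonneg (pow_nonneg (hw.tot_nonneg n g) _) (ind_nonneg _)
  rw [Real.dist_eq, sub_zero, abs_of_nonneg h0]
  have h3 : E n (fun g => w.tot n g ^ r * ind (Bad d R' g)) ≤
      E n (fun g => ε * w.tot n g ^ (r * 2) + 1 / (4 * ε) * ind (Bad d R' g)) := by
    refine hE.mono n hTn _ _ fun g _ => ?_
    have hx := pow_nonneg (hw.tot_nonneg n g) r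
    rw [pow_mul]
    generalize w.tot n g ^ r = x at *
    by_cases hb : Bad d R' g
    · rw [ind_pos hb, mul_one, mul_one]
      have : ε * x ^ 2 + 1 / (4 * ε) - x = (2 * ε * x - 1) ^ 2 / (4 * ε) := by field_simp; ring
      have : 0 ≤ (2 * ε * x - 1) ^ 2 / (4 * ε) := by positivity
      linarith
    · rw [ind_neg hb, mul_zero, mul_zero, add_zero]
      positivity
  rw [hE.add, hE.mul, hE.mul] at h3
  have h4 := mul_le_mul_of_nonneg_left (hD n hTn) hε.le
  have h5 := mul_le_mul_of_nonneg_left h2 (by positivity : 0 ≤ 1 / (4 * ε))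
  linarith

lemma Weight.IsConn.pow_tendsto (hw : w.IsConn d R C) (hm : 2 ≤ m) (hd : 2 * m < d) (r : ℕ) :
    ∃ t : ℝ, ∀ T E, Chain m d T E →
      Tendsto (fun n => E n (fun g => w.tot n g ^ r)) atTop (𝓝 t) := by
  obtain ⟨t, ht⟩ := (hw.convPow r).exc_tendsto hm hd
  refine ⟨t, fun T E hE => ?_⟩
  have h1 := ht T E hE
  have h2 := h1.add (hw.pow_bad_tendsto hm hd hE r (r * R))
  rw [add_zero] at h2
  refine tendsto_of_tendsto_of_tendsto_of_le_of_le' h1 h2 ?_ ?_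
  · filter_upwards [eventually_ge_atTop T] with n hn
    refine hE.mono n hn _ _ fun g hg => ?_
    rw [← w.tot_convPow]
    exact ((hw.convPow r).tot_le hd hg).1
  · filter_upwards [eventually_ge_atTop T] with n hn
    rw [← hE.add]
    refine hE.mono n hn _ _ fun g hg => ?_
    rw [← w.tot_convPow]
    exact ((hw.convPow r).tot_le hd hg).2

lemma exp_sub_sum_le {x : ℝ} (hx : 0 ≤ x) (s : ℕ) :
    Real.exp x - ∑ r ∈ Finset.range s, x ^ r / r.factorial ≤ (1 / 2) ^ s * Real.exp (2 * x) := by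
  have h1 : Tendsto (fun N => ∑ r ∈ Finset.range N, x ^ r / (r.factorial : ℝ)) atTop
      (𝓝 (Real.exp x)) := by
    have := (NormedSpace.expSeries_div_hasSum_exp (𝔸 := ℝ) x).tendsto_sum_nat
    rwa [← Real.exp_eq_exp_ℝ] at this
  refine le_of_tendsto (h1.sub_const _) ?_
  filter_upwards [eventually_ge_atTop s] with N hN
  refine le_trans ?_ (mul_le_mul_of_nonneg_left
    (Real.sum_le_exp_of_nonneg (by positivity : (0 : ℝ) ≤ 2 * x) N) (by positivity))
  rw [← Finset.sum_range_add_sum_Ico _ hN, add_sub_cancel_left,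
    ← Finset.sum_range_add_sum_Ico (fun r => (2 * x) ^ r / (r.factorial : ℝ)) hN, mul_add]
  refine le_add_of_nonneg_of_le (by positivity) ?_
  rw [Finset.mul_sum]
  refine Finset.sum_le_sum fun r hr => ?_
  rw [Finset.mem_Ico] at hr
  rw [mul_pow, mul_div_assoc, ← mul_assoc]
  refine le_mul_of_one_le_left (by positivity) ?_
  rw [div_pow, one_pow, one_div, inv_mul_eq_div, le_div_iff₀ (by positivity), one_mul]
  exact pow_le_pow_right₀ (by norm_num) hr.1

lemma abs_exp_neg_sub_sum_le {x : ℝ} (hx : 0 ≤ x) (s : ℕ) :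
    |Real.exp (-x) - ∑ r ∈ Finset.range s, (-x) ^ r / r.factorial| ≤
      (1 / 2) ^ s * Real.exp (2 * x) := by
  refine le_trans ?_ (exp_sub_sum_le hx s)
  have h := Complex.norm_exp_sub_sum_le_exp_norm_sub_sum ((-x : ℝ) : ℂ) s
  rw [Complex.norm_real, norm_neg, Real.norm_of_nonneg hx] at h
  refine le_trans (le_of_eq ?_) h
  rw [← Real.norm_eq_abs, ← Complex.norm_real]
  push_cast
  rfl

/-- Interchange of limits under uniform approximation. -/
lemma tendsto_of_approx {a : ℕ → ℝ} {b : ℕ → ℕ → ℝ} {p e : ℕ → ℝ} (he : Tendsto e atTop (𝓝 0))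
    (h : ∀ᶠ s in atTop, ∀ᶠ n in atTop, |a n - b s n| ≤ e s)
    (hb : ∀ s, Tendsto (b s) atTop (𝓝 (p s))) :
    ∃ Φ, Tendsto a atTop (𝓝 Φ) ∧ Tendsto p atTop (𝓝 Φ) := by
  obtain ⟨S, hS⟩ := eventually_atTop.1 h
  have hpp : ∀ s ≥ S, ∀ t ≥ S, |p s - p t| ≤ e s + e t := by
    intro s hs t ht
    refine le_of_tendsto ((hb s).sub (hb t)).abs ?_
    filter_upwards [hS s hs, hS t ht] with n h1 h2
    have := abs_sub_le (b s n) (a n) (b t n)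
    rw [abs_sub_comm (b s n) (a n)] at this
    linarith
  have hc : CauchySeq p := by
    rw [Metric.cauchySeq_iff]
    intro ε hε
    obtain ⟨N, hN⟩ := eventually_atTop.1 (he.eventually (gt_mem_nhds (half_pos hε)))
    refine ⟨max N S, fun s hs t ht => ?_⟩
    have h1 := hN s ((le_max_left _ _).trans hs)
    have h2 := hN t ((le_max_left _ _).trans ht)
    have h3 := hpp s ((le_max_right _ _).trans hs) t ((le_max_right _ _).trans ht)
    rw [Real.dist_eq]; linarith
  obtain ⟨Φ, hΦ⟩ := cauchySeq_tendsto_of_complete hc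
  refine ⟨Φ, ?_, hΦ⟩
  rw [Metric.tendsto_atTop']
  intro ε hε
  have h1 := he.eventually (gt_mem_nhds (by positivity : 0 < ε / 3))
  have h2 := (Metric.tendsto_nhds.1 hΦ) (ε / 3) (by positivity)
  obtain ⟨s, h1, h2, hs⟩ := (h1.and (h2.and (eventually_ge_atTop S))).exists
  obtain ⟨N, hN⟩ := eventually_atTop.1
    (((Metric.tendsto_nhds.1 (hb s)) (ε / 3) (by positivity)).and (hS s hs))
  refine ⟨N, fun n hn => ?_⟩
  obtain ⟨h3, h4⟩ := hN n hn.le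
  rw [Real.dist_eq] at *
  have := abs_sub_le (a n) (b s n) Φ
  have := abs_sub_le (b s n) (p s) Φ
  linarith

/-- The Laplace transform of a local statistic converges, to a limit which does not depend on the
initial graph. -/
theorem Weight.IsConn.laplace_tendsto (hw : w.IsConn d R C) (hm : 2 ≤ m) (hd : 2 * m < d) :
    ∃ Φ : ℝ, ∀ T E, Chain m d T E →
      Tendsto (fun n => E n (fun g => Real.exp (-w.tot n g))) atTop (𝓝 Φ) := by
  choose t ht using hw.pow_tendsto hm hd
  have key : ∀ T E, Chain m d T E → ∃ Φ : ℝ,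
      Tendsto (fun n => E n (fun g => Real.exp (-w.tot n g))) atTop (𝓝 Φ) ∧
      Tendsto (fun s => ∑ r ∈ Finset.range s, (-1) ^ r / (r.factorial : ℝ) * t r) atTop (𝓝 Φ) := by
    intro T E hE
    obtain ⟨D, hD0, hD⟩ := hw.exp_bound hm hd hE 2 zero_le_two
    refine tendsto_of_approx (e := fun s => (1 / 2) ^ s * D)
      (b := fun s n => ∑ r ∈ Finset.range s, (-1) ^ r / (r.factorial : ℝ) *
        E n (fun g => w.tot n g ^ r)) ?_ (Eventually.of_forall fun s => ?_) fun s => ?_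
    · simpa using (tendsto_pow_atTop_nhds_zero_of_lt_one (by norm_num : (0 : ℝ) ≤ 1 / 2)
        (by norm_num)).mul_const D
    · filter_upwards [eventually_ge_atTop T] with n hn
      have h1 : ∑ r ∈ Finset.range s, (-1) ^ r / (r.factorial : ℝ) * E n (fun g => w.tot n g ^ r) =
          E n (fun g => ∑ r ∈ Finset.range s, (-w.tot n g) ^ r / (r.factorial : ℝ)) := by
        rw [hE.sum]
        refine Finset.sum_congr rfl fun r _ => ?_
        rw [← hE.mul]
        congr 1
        funext g
        rw [neg_pow (w.tot n g)]
        ring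
      rw [h1, ← hE.sub]
      refine le_trans (hE.abs_le hn fun g _ => abs_exp_neg_sub_sum_le (hw.tot_nonneg n g) s) ?_
      rw [hE.mul]
      exact mul_le_mul_of_nonneg_left (hD n hn) (by positivity)
    · exact tendsto_finsetSum _ fun r _ => (ht r T E hE).const_mul _
  obtain ⟨Φ, -, hΦ⟩ := key m _ (chain_evE hd UAReachable.init)
  refine ⟨Φ, fun T E hE => ?_⟩
  obtain ⟨Φ', h1, h2⟩ := key T E hE
  rwa [tendsto_nhds_unique hΦ h2]

end

section

/-- `W` spans an induced copy of `U` whose vertices of degree at least two have all their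
neighbours in `W`, where `D` prescribes the degrees. -/
def Clean {t : ℕ} (U : SimpleGraph (Fin t)) {V : Type} (G : SimpleGraph V) (D : V → ℕ)
    (W : Finset V) : Prop :=
  (∃ e : Fin t → V, Function.Injective e ∧ Set.range e = W ∧ G.comap e = U) ∧
    ∀ x ∈ W, 2 ≤ (nbr G W x).card → D x = (nbr G W x).card

variable {t : ℕ} {U : SimpleGraph (Fin t)}

lemma clean_image {V V' : Type} [DecidableEq V] (G : SimpleGraph V) (D : V → ℕ) {φ : V' → V}
    (hφ : Function.Injective φ) (W : Finset V') :
    Clean U G D (W.image φ) ↔ Clean U (G.comap φ) (D ∘ φ) W := by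
  unfold Clean
  refine and_congr ⟨?_, ?_⟩ ?_
  · rintro ⟨e, h1, h2, h3⟩
    have h4 : ∀ a, ∃ z, z ∈ W ∧ φ z = e a := fun a => by
      have : e a ∈ ((W.image φ : Finset V) : Set V) := h2 ▸ Set.mem_range_self a
      simpa using this
    choose f hf hfe using h4
    have hcomp : φ ∘ f = e := funext hfe
    refine ⟨f, fun a b h => h1 (by rw [← hfe, ← hfe, h]), ?_, ?_⟩
    · ext z
      constructor
      · rintro ⟨a, rfl⟩; exact hf a
      · intro hz
        have : φ z ∈ Set.range e := by
          rw [h2]; exact Finset.mem_coe.2 (Finset.mem_image_of_mem φ hz)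
        obtain ⟨a, ha⟩ := this
        exact ⟨a, hφ (by rw [hfe, ha])⟩
    · rw [SimpleGraph.comap_comap, hcomp, h3]
  · rintro ⟨e, h1, h2, h3⟩
    refine ⟨φ ∘ e, hφ.comp h1, ?_, ?_⟩
    · rw [Set.range_comp, h2, Finset.coe_image]
    · rw [← SimpleGraph.comap_comap, h3]
  · simp only [Finset.forall_mem_image, nbr_image, Finset.card_image_of_injective _ hφ,
      Function.comp]

lemma nbr_univ_card {V : Type*} [Fintype V] (G : SimpleGraph V) (v : V) :
    (nbr G Finset.univ v).card = (G.neighborSet v).ncard := by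
  rw [← Set.ncard_coe_finset]
  congr 1
  ext y
  simp [mem_nbr]

/-- The sum of the weights `s j` of the clean copies of the graphs `U j`. -/
noncomputable def cleanWeight {K : ℕ} {t : Fin K → ℕ} (U : ∀ j, SimpleGraph (Fin (t j)))
    (s : Fin K → ℝ) : Weight := fun _ G D W => ∑ j, s j * ind (Clean (U j) G D W)

lemma Clean.supp {d : ℕ} (hU : IsUnicyclic U) (hUd : ¬ UnicyclicComplete U d) {V : Type}
    {G : SimpleGraph V} {D : V → ℕ} {W : Finset V} (hD : ∀ x, D x ≤ d) (h : Clean U G D W) :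
    CutConn G W ∧ W.card = t ∧ W.card ≤ eC G W ∧ ∃ x ∈ W, D x < d := by
  obtain ⟨⟨e, h1, h2, h3⟩, h4⟩ := h
  have hW : W = Finset.univ.image e := by
    apply Finset.coe_injective; rw [← h2]; simp
  subst hW
  have hc : (Finset.univ.image e).card = t := by
    rw [Finset.card_image_of_injective _ h1, Finset.card_univ, Fintype.card_fin]
  refine ⟨?_, hc, ?_, ?_⟩
  · rw [cutConn_image h1, h3]; exact cutConn_univ_of_connected hU.1
  · rw [hc, eC_image h1, h3, eC_univ, hU.2]
  · unfold UnicyclicComplete at hUd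
    push Not at hUd
    obtain ⟨v, hv, hvd⟩ := hUd
    have hmem : e v ∈ Finset.univ.image e := Finset.mem_image_of_mem _ (Finset.mem_univ v)
    have h5 : (nbr G (Finset.univ.image e) (e v)).card = (U.neighborSet v).ncard := by
      rw [nbr_image, Finset.card_image_of_injective _ h1, h3, nbr_univ_card]
    have h6 := h4 (e v) hmem (by rw [h5]; exact hv)
    exact ⟨e v, hmem, lt_of_le_of_ne (hD _) (by rw [h6, h5]; exact hvd)⟩

lemma cleanWeight_isConn {K d : ℕ} {t : Fin K → ℕ} {U : ∀ j, SimpleGraph (Fin (t j))}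
    (hU : ∀ j, IsUnicyclic (U j)) (hUd : ∀ j, ¬ UnicyclicComplete (U j) d) {s : Fin K → ℝ}
    (hs : ∀ j, 0 ≤ s j) : (cleanWeight U s).IsConn d (∑ j, t j) (∑ j, s j) where
  nonneg V G D W := Finset.sum_nonneg fun j _ => mul_nonneg (hs j) (ind_nonneg _)
  image G D φ hφ W := by simp only [cleanWeight, clean_image G D hφ]
  supp V G D W hD h := by
    obtain ⟨j, -, hj⟩ := Finset.exists_ne_zero_of_sum_ne_zero h
    have hc : Clean (U j) G D W := by
      by_contra hne; exact right_ne_zero_of_mul hj (ind_neg hne)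
    obtain ⟨h1, h2, h3, h4⟩ := hc.supp (hU j) (hUd j) hD
    exact ⟨h1, h2.trans_le (Finset.single_le_sum (f := t) (fun _ _ => Nat.zero_le _)
      (Finset.mem_univ j)), h3, h4⟩
  le V G D W := Finset.sum_le_sum fun j _ => mul_le_of_le_one_right (hs j) (ind_le_one _)

/-- The maximal copies of `U` in `g`, as pairs of a vertex set and a graph. -/
def maxCopies (g : SimpleGraph ℕ) (U : SimpleGraph (Fin t)) : Set (Finset ℕ × SimpleGraph ℕ) :=
  {p | (∃ e : Fin t ↪ ℕ, Finset.univ.map e = p.1 ∧ U.map e = p.2) ∧ p.2 ≤ g ∧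
    ∀ u ∈ p.1, 2 ≤ (p.2.neighborSet u).ncard → ∀ w, g.Adj u w → w ∈ p.1}

lemma unicyclicCount_eq (hU : IsUnicyclic U) (g : SimpleGraph ℕ) :
    unicyclicCount g U = (maxCopies g U).ncard := by
  refine Set.ncard_congr (fun H hH => (hH.1.1.toFinset, H.spanningCoe)) ?_ ?_ ?_
  · rintro H ⟨⟨h1, h2, h3, h4⟩, ⟨φ⟩⟩
    refine ⟨⟨⟨fun a => (φ a).1, fun a b h => φ.injective (Subtype.ext h)⟩, ?_, ?_⟩,
      H.spanningCoe_le, ?_⟩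
    · ext x
      simp only [Finset.mem_map, Finset.mem_univ, true_and,
        Set.Finite.mem_toFinset]
      constructor
      · rintro ⟨a, rfl⟩; exact (φ a).2
      · intro hx; exact ⟨φ.symm ⟨x, hx⟩, congrArg Subtype.val (φ.apply_symm_apply ⟨x, hx⟩)⟩
    · ext x y
      simp only [SimpleGraph.map_adj, SimpleGraph.Subgraph.spanningCoe_adj]
      constructor
      · rintro ⟨a, b, hab, rfl, rfl⟩
        exact (φ.map_adj_iff.2 hab)
      · intro hxy
        refine ⟨φ.symm ⟨x, H.edge_vert hxy⟩, φ.symm ⟨y, H.edge_vert hxy.symm⟩, ?_,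
          congrArg Subtype.val (φ.apply_symm_apply ⟨x, _⟩),
          congrArg Subtype.val (φ.apply_symm_apply ⟨y, _⟩)⟩
        rw [φ.symm.map_adj_iff]
        exact hxy
    · intro u hu h w hw
      rw [Set.Finite.mem_toFinset] at hu ⊢
      exact h4 u hu h w hw
  · intro H H' hH hH' h
    rw [Prod.mk.injEq, Set.Finite.toFinset_inj] at h
    refine SimpleGraph.Subgraph.ext h.1 ?_
    funext x y
    have := congrArg (fun K : SimpleGraph ℕ => K.Adj x y) h.2
    exact this
  · rintro ⟨W, K⟩ ⟨⟨e, h1, h2⟩, h3, h4⟩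
    simp only at h1 h2 h3 h4
    have hmem : ∀ a, e a ∈ W := fun a => by
      rw [← h1]; exact Finset.mem_map_of_mem e (Finset.mem_univ a)
    have hadj : ∀ {x y}, K.Adj x y → x ∈ W := by
      intro x y hxy
      rw [← h2, SimpleGraph.map_adj] at hxy
      obtain ⟨a, b, -, rfl, -⟩ := hxy
      exact hmem a
    let H : g.Subgraph :=
      { verts := W, Adj := K.Adj, adj_sub := fun h => h3 h, edge_vert := fun h => hadj h,
        symm := K.symm }
    have hbij : Function.Bijective (fun a => (⟨e a, hmem a⟩ : H.verts)) := by
      refine ⟨fun a b h => e.injective (congrArg Subtype.val h), ?_⟩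
      rintro ⟨x, hx⟩
      have hx' : x ∈ Finset.univ.map e := by rw [h1]; exact hx
      obtain ⟨a, -, rfl⟩ := Finset.mem_map.1 hx'
      exact ⟨a, rfl⟩
    let φ : U ≃g H.coe :=
      { toEquiv := Equiv.ofBijective _ hbij
        map_rel_iff' := by
          intro a b
          change K.Adj (e a) (e b) ↔ U.Adj a b
          rw [← h2, SimpleGraph.map_adj_apply] }
    refine ⟨H, ⟨⟨W.finite_toSet, φ.connected_iff.1 hU.1, ?_, ?_⟩, ⟨φ⟩⟩, ?_⟩
    · have h5 : H.edgeSet = K.edgeSet := by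
        ext z
        induction z with | _ x y => exact Iff.rfl
      have h6 : H.verts.ncard = W.card := Set.ncard_coe_finset W
      rw [h5, h6, ← h2, SimpleGraph.edgeSet_map, Set.ncard_image_of_injective _ e.sym2Map.injective,
        hU.2, ← h1, Finset.card_map, Finset.card_univ, Fintype.card_fin]
    · exact h4
    · refine Prod.ext ?_ rfl
      ext x
      simp [H]

/-- The maximal copies of `U` in `g` which are not induced. -/
def dirtyCopies (g : SimpleGraph ℕ) (U : SimpleGraph (Fin t)) : Set (Finset ℕ × SimpleGraph ℕ) :=
  {p | p ∈ maxCopies g U ∧ ∃ x ∈ p.1, ∃ y ∈ p.1, g.Adj x y ∧ ¬ p.2.Adj x y}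

variable {m d n : ℕ} {g : SimpleGraph ℕ}

lemma cutConn_mono {V : Type*} {G G' : SimpleGraph V} (h : G ≤ G') {W : Finset V}
    (hW : CutConn G W) : CutConn G' W := fun B hB hBn hne => by
  obtain ⟨x, hx, y, hy, hyB, hxy⟩ := hW B hB hBn hne
  exact ⟨x, hx, y, hy, hyB, h hxy⟩

lemma eC_mono {V : Type*} {G G' : SimpleGraph V} (h : G ≤ G') (W : Finset V) :
    eC G W ≤ eC G' W := by
  refine Nat.div_le_div_right (Finset.sum_le_sum fun x _ => Finset.card_le_card fun y hy => ?_)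
  rw [mem_nbr] at hy ⊢
  exact ⟨hy.1, h hy.2⟩

lemma eC_lt {V : Type*} {G G' : SimpleGraph V} (h : G ≤ G') {W : Finset V} {x y : V} (hx : x ∈ W)
    (hy : y ∈ W) (h1 : G'.Adj x y) (h2 : ¬ G.Adj x y) : eC G W < eC G' W := by
  have h3 : ∑ x ∈ W, (nbr G W x).card < ∑ x ∈ W, (nbr G' W x).card := by
    refine Finset.sum_lt_sum (fun z _ => Finset.card_le_card fun w hw => ?_) ⟨x, hx,
      Finset.card_lt_card (Finset.ssubset_iff_subset_ne.2 ⟨fun w hw => ?_, fun he => ?_⟩)⟩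
    · rw [mem_nbr] at hw ⊢; exact ⟨hw.1, h hw.2⟩
    · rw [mem_nbr] at hw ⊢; exact ⟨hw.1, h hw.2⟩
    · have : y ∈ nbr G W x := by rw [he, mem_nbr]; exact ⟨hy, h1⟩
      exact h2 (mem_nbr.1 this).2
  have h4 := two_mul_eC G W
  have h5 := two_mul_eC G' W
  omega

lemma copy_conn (hU : IsUnicyclic U) (e : Fin t ↪ ℕ) :
    CutConn (U.map e) (Finset.univ.map e) ∧ (Finset.univ.map e).card = t ∧
      eC (U.map e) (Finset.univ.map e) = t := by
  rw [Finset.map_eq_image, cutConn_image e.injective, eC_image e.injective,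
    SimpleGraph.comap_map_eq, eC_univ, hU.2, Finset.card_image_of_injective _ e.injective,
    Finset.card_univ, Fintype.card_fin]
  exact ⟨cutConn_univ_of_connected hU.1, rfl, rfl⟩

lemma maxCopies_conn (hU : IsUnicyclic U) {p : Finset ℕ × SimpleGraph ℕ} (hp : p ∈ maxCopies g U) :
    CutConn p.2 p.1 ∧ p.1.card = t ∧ eC p.2 p.1 = t := by
  obtain ⟨⟨e, h1, h2⟩, -⟩ := hp
  rw [← h1, ← h2]
  exact copy_conn hU e

lemma maxCopies_subset_Icc (hU : IsUnicyclic U) (hg : UAReachable m d n g)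
    {p : Finset ℕ × SimpleGraph ℕ} (hp : p ∈ maxCopies g U) : p.1 ⊆ Finset.Icc 1 n := by
  obtain ⟨h1, h2, h3⟩ := maxCopies_conn hU hp
  have := eC_mono hp.2.1 p.1
  exact (cutConn_mono hp.2.1 h1).subset_Icc hg (by omega)

lemma maxCopies_finite (hU : IsUnicyclic U) (hg : UAReachable m d n g) :
    (maxCopies g U).Finite := by
  have hf : {e : Fin t ↪ ℕ | ∀ a, e a ∈ Finset.Icc 1 n}.Finite := by
    have h1 : ((Fintype.piFinset fun _ : Fin t => Finset.Icc 1 n : Finset (Fin t → ℕ)) :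
      Set (Fin t → ℕ)).Finite := Finset.finite_toSet _
    refine (h1.preimage (f := fun e : Fin t ↪ ℕ => (e : Fin t → ℕ))
      DFunLike.coe_injective.injOn).subset fun e he => ?_
    simp only [Set.mem_preimage, Finset.mem_coe, Fintype.mem_piFinset]
    exact he
  refine (hf.image fun e => (Finset.univ.map e, U.map e)).subset fun p hp => ?_
  obtain ⟨e, h1, h2⟩ := hp.1
  refine ⟨e, fun a => maxCopies_subset_Icc hU hg hp ?_, Prod.ext h1 h2⟩
  rw [← h1]
  exact Finset.mem_map_of_mem e (Finset.mem_univ a)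

lemma dirtyCopies_cplx (hU : IsUnicyclic U) {p : Finset ℕ × SimpleGraph ℕ}
    (hp : p ∈ dirtyCopies g U) : Cplx g p.1 := by
  obtain ⟨h1, h2, h3⟩ := maxCopies_conn hU hp.1
  obtain ⟨x, hx, y, hy, hxy, hn⟩ := hp.2
  have := eC_lt hp.1.2.1 hx hy hxy hn
  exact ⟨cutConn_mono hp.1.2.1 h1, by omega⟩

lemma graphDeg_eq_nbr_iff (hg : UAReachable m d n g) (W : Finset ℕ) (x : ℕ) :
    graphDeg g x = (nbr g W x).card ↔ ∀ y, g.Adj x y → y ∈ W := by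
  have hsub : ((nbr g W x : Finset ℕ) : Set ℕ) ⊆ g.neighborSet x := fun y hy =>
    (mem_nbr.1 (Finset.mem_coe.1 hy)).2
  rw [graphDeg, ← Set.ncard_coe_finset]
  constructor
  · intro h y hy
    have := Set.eq_of_subset_of_ncard_le hsub h.le (reach_finite hg x)
    have hy' : y ∈ g.neighborSet x := hy
    rw [← this] at hy'
    exact (mem_nbr.1 (Finset.mem_coe.1 hy')).1
  · intro h
    congr 1
    refine Set.Subset.antisymm (fun y hy => Finset.mem_coe.2 (mem_nbr.2 ⟨h y hy, hy⟩)) hsub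

lemma clean_ncard (hU : IsUnicyclic U) (hg : UAReachable m d n g) :
    (maxCopies g U \ dirtyCopies g U).ncard =
      ((Finset.Icc 1 n).powerset.filter (Clean U g (graphDeg g))).card := by
  rw [← Set.ncard_coe_finset]
  have hclean : ∀ p ∈ maxCopies g U \ dirtyCopies g U, ∀ x y,
      p.2.Adj x y ↔ x ∈ p.1 ∧ y ∈ p.1 ∧ g.Adj x y := by
    rintro p ⟨h1, h2⟩ x y
    constructor
    · intro h
      have hm : x ∈ p.1 ∧ y ∈ p.1 := by
        obtain ⟨⟨e, h3, h4⟩, -⟩ := h1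
        rw [← h4, SimpleGraph.map_adj] at h
        obtain ⟨a, b, -, rfl, rfl⟩ := h
        rw [← h3]
        exact ⟨Finset.mem_map_of_mem e (Finset.mem_univ a),
          Finset.mem_map_of_mem e (Finset.mem_univ b)⟩
      exact ⟨hm.1, hm.2, h1.2.1 h⟩
    · rintro ⟨hx, hy, h⟩
      by_contra hne
      exact h2 ⟨h1, x, hx, y, hy, h, hne⟩
  have hnb : ∀ W : Finset ℕ, ∀ K : SimpleGraph ℕ, (∀ x y, K.Adj x y ↔ x ∈ W ∧ y ∈ W ∧ g.Adj x y) →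
      ∀ x ∈ W, (K.neighborSet x).ncard = (nbr g W x).card := by
    intro W K hK x hx
    rw [← Set.ncard_coe_finset]
    congr 1
    ext y
    simp only [SimpleGraph.mem_neighborSet, hK, Finset.mem_coe, mem_nbr, hx, true_and]
  refine Set.ncard_congr (fun p _ => p.1) ?_ ?_ ?_
  · intro p hp
    have hK := hclean p hp
    rw [Finset.mem_coe, Finset.mem_filter, Finset.mem_powerset]
    refine ⟨maxCopies_subset_Icc hU hg hp.1, ?_, ?_⟩
    · obtain ⟨e, h3, h4⟩ := hp.1.1
      have hmem : ∀ a, e a ∈ p.1 := fun a => by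
        rw [← h3]; exact Finset.mem_map_of_mem e (Finset.mem_univ a)
      refine ⟨e, e.injective, ?_, ?_⟩
      · rw [← h3]; simp
      · ext a b
        rw [SimpleGraph.comap_adj, ← SimpleGraph.map_adj_apply (f := e), h4, hK]
        exact ⟨fun h => ⟨hmem a, hmem b, h⟩, fun h => h.2.2⟩
    · intro x hx h
      rw [graphDeg_eq_nbr_iff hg]
      exact hp.1.2.2 x hx (by rw [hnb _ _ hK x hx]; exact h)
  · intro p q hp hq h
    refine Prod.ext h ?_
    ext x y
    rw [hclean p hp, hclean q hq, h]
  · intro W hW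
    rw [Finset.mem_coe, Finset.mem_filter] at hW
    obtain ⟨-, ⟨e, h1, h2, h3⟩, h4⟩ := hW
    have hWm : Finset.univ.map ⟨e, h1⟩ = W := by
      apply Finset.coe_injective; rw [← h2]; simp
    have hK : ∀ x y, (U.map (⟨e, h1⟩ : Fin t ↪ ℕ)).Adj x y ↔ x ∈ W ∧ y ∈ W ∧ g.Adj x y := by
      intro x y
      rw [SimpleGraph.map_adj, ← h3, ← Finset.mem_coe, ← Finset.mem_coe, ← h2]
      constructor
      · rintro ⟨a, b, hab, rfl, rfl⟩
        exact ⟨⟨a, rfl⟩, ⟨b, rfl⟩, hab⟩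
      · rintro ⟨⟨a, rfl⟩, ⟨b, rfl⟩, hab⟩
        exact ⟨a, b, hab, rfl, rfl⟩
    refine ⟨(W, U.map (⟨e, h1⟩ : Fin t ↪ ℕ)), ⟨⟨⟨⟨e, h1⟩, hWm, rfl⟩, fun x y h => ((hK x y).1 h).2.2, ?_⟩, ?_⟩, rfl⟩
    · intro u hu h
      exact (graphDeg_eq_nbr_iff hg W u).1 (h4 u hu (by rw [← hnb W _ hK u hu]; exact h))
    · rintro ⟨-, x, hx, y, hy, hxy, hn⟩
      exact hn ((hK x y).2 ⟨hx, hy, hxy⟩)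

lemma unicyclicCount_split (hU : IsUnicyclic U) (hg : UAReachable m d n g) :
    (unicyclicCount g U : ℝ) = ∑ W ∈ (Finset.Icc 1 n).powerset, ind (Clean U g (graphDeg g) W) +
      ((dirtyCopies g U).ncard : ℝ) := by
  have h := Set.ncard_sdiff_add_ncard_of_subset (s := dirtyCopies g U) (t := maxCopies g U)
    (fun p hp => hp.1) (maxCopies_finite hU hg)
  rw [unicyclicCount_eq hU, ← h, clean_ncard hU hg, Nat.cast_add]
  congr 1
  rw [Finset.card_filter, Nat.cast_sum]
  refine Finset.sum_congr rfl fun W _ => ?_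
  rw [← ite_eq_ind]
  push_cast
  rfl

lemma dirtyCopies_attach (hU : IsUnicyclic U) (hg : UAReachable m d n g) {S : Finset ℕ} {R : ℕ} (hR : t + 1 ≤ R)
    (hn : ¬ CplxAt R (attachStep g (n + 1) S) (n + 1)) :
    dirtyCopies (attachStep g (n + 1) S) U = dirtyCopies g U := by
  have hle : g ≤ attachStep g (n + 1) S := le_sup_left
  have hnadj : ∀ W : Finset ℕ, Cplx (attachStep g (n + 1) S) W → W.card ≤ t → n + 1 ∉ W →
      ∀ x ∈ W, ¬ (attachStep g (n + 1) S).Adj x (n + 1) := by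
    intro W hW hWt hWn x hx hadj
    refine hn ⟨insert (n + 1) W, ⟨cutConn_insert hW.1 hx hadj, ?_⟩, ?_, Finset.mem_insert_self _ _⟩
    · rw [eC_insert _ hWn, Finset.card_insert_of_notMem hWn]
      have : 0 < (nbr (attachStep g (n + 1) S) W (n + 1)).card :=
        Finset.card_pos.2 ⟨x, mem_nbr.2 ⟨hx, hadj.symm⟩⟩
      have := hW.2
      omega
    · rw [Finset.card_insert_of_notMem hWn]; omega
  ext p
  constructor
  · intro hp
    obtain ⟨h1, h2, h3⟩ := maxCopies_conn hU hp.1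
    have hc := dirtyCopies_cplx hU hp
    have hpn : n + 1 ∉ p.1 := fun h => hn ⟨p.1, hc, by omega, h⟩
    have hne : ∀ {x}, x ∈ p.1 → x ≠ n + 1 := fun hx h => hpn (h ▸ hx)
    obtain ⟨⟨he, hpg, hmax⟩, x, hx, y, hy, hxy, hnxy⟩ := hp
    refine ⟨⟨he, fun x y h => ?_, fun u hu h w hw => hmax u hu h w (hle hw)⟩, x, hx, y, hy,
      (attach_adj_old (hne hx) (hne hy)).1 hxy, hnxy⟩
    have hm : x ∈ p.1 ∧ y ∈ p.1 := by
      obtain ⟨e, h3, h4⟩ := he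
      rw [← h4, SimpleGraph.map_adj] at h
      obtain ⟨a, b, -, rfl, rfl⟩ := h
      rw [← h3]
      exact ⟨Finset.mem_map_of_mem e (Finset.mem_univ a),
        Finset.mem_map_of_mem e (Finset.mem_univ b)⟩
    exact (attach_adj_old (hne hm.1) (hne hm.2)).1 (hpg h)
  · intro hp
    obtain ⟨h1, h2, h3⟩ := maxCopies_conn hU hp.1
    have hpI := maxCopies_subset_Icc hU hg hp.1
    have hpn : n + 1 ∉ p.1 := fun h => by
      have := Finset.mem_Icc.1 (hpI h); omega
    have hc := dirtyCopies_cplx hU hp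
    have hc' : Cplx (attachStep g (n + 1) S) p.1 :=
      ⟨cutConn_mono hle hc.1, hc.2.trans (eC_mono hle _)⟩
    obtain ⟨⟨he, hpg, hmax⟩, x, hx, y, hy, hxy, hnxy⟩ := hp
    refine ⟨⟨he, hpg.trans hle, fun u hu h w hw => ?_⟩, x, hx, y, hy, hle hxy, hnxy⟩
    have hwn : w ≠ n + 1 := by
      rintro rfl; exact hnadj p.1 hc' h2.le hpn u hu hw
    have hun : u ≠ n + 1 := fun h => hpn (h ▸ hu)
    exact hmax u hu h w ((attach_adj_old hun hwn).1 hw)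

end

section

variable {m d n R T : ℕ} {E : ℕ → (SimpleGraph ℕ → ℝ) →ₗ[ℝ] ℝ}

lemma kerL_first (hd : 2 * m < d) {g : SimpleGraph ℕ} (hg : UAReachable m d T g) (hn : T + 1 ≤ n)
    (f : SimpleGraph ℕ → ℝ) : kerL m d T n f g = stepL m d T (kerL m d (T + 1) n f) g := by
  have h := (chain_evE hd hg).semigroup (Nat.le_succ T) hn f
  rwa [evE_apply, evE_apply, kerL_succ le_rfl, kerL_of_le le_rfl] at h

lemma kerL_mem_Icc (hd : 2 * m < d) {g : SimpleGraph ℕ} (hg : UAReachable m d T g) (hn : T ≤ n)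
    {h : SimpleGraph ℕ → ℝ} (h0 : ∀ g, 0 ≤ h g) (h1 : ∀ g, h g ≤ 1) :
    0 ≤ kerL m d T n h g ∧ kerL m d T n h g ≤ 1 := by
  have hE := chain_evE hd hg
  rw [← evE_apply]
  refine ⟨hE.nonneg hn fun g _ => h0 g, ?_⟩
  rw [← hE.one n hn]
  exact hE.mono n hn _ _ fun g _ => h1 g

/-- Statistics which change only when a small complex set is created. -/
def Frozen (R : ℕ) (m d : ℕ) (Q : SimpleGraph ℕ → ℝ) : Prop :=
  ∀ n g S, UAReachable m d n g → ¬ CplxAt R (attachStep g (n + 1) S) (n + 1) →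
    Q (attachStep g (n + 1) S) = Q g

lemma frozen_approx (hd : 2 * m < d) {T₀ N : ℕ} (hE : Chain m d T₀ E) {Q h : SimpleGraph ℕ → ℝ}
    (hQ : Frozen R m d Q) (hQ0 : ∀ g, 0 ≤ Q g) (hQ1 : ∀ g, Q g ≤ 1) (hh0 : ∀ g, 0 ≤ h g)
    (hh1 : ∀ g, h g ≤ 1) {C : ℝ} (hC : 0 ≤ C)
    (hN : ∀ n, N ≤ n → E (n + 1) (fun g => ind (CplxAt R g (n + 1))) ≤ C * ((n : ℝ) ^ 2)⁻¹)
    (hNT : N ≤ T) (hT0 : T₀ ≤ T) (hT2 : 2 ≤ T) (hn : T ≤ n) :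
    |E n (fun g => Q g * h g) - E T (fun g => Q g * kerL m d T n h g)| ≤ C / ((T : ℝ) - 1) := by
  have key : ∀ s, T ≤ s → s ≤ n → |E s (fun g => Q g * kerL m d s n h g) -
      E T (fun g => Q g * kerL m d T n h g)| ≤ C * (1 / ((T : ℝ) - 1) - 1 / ((s : ℝ) - 1)) := by
    intro s hs
    induction s, hs using Nat.le_induction with
    | base => intro _; simp
    | succ s hs ih =>
      intro hsn
      have h1 := ih (by omega)
      have h2 : |E (s + 1) (fun g => Q g * kerL m d (s + 1) n h g) -
          E s (fun g => Q g * kerL m d s n h g)| ≤ C * ((s : ℝ) ^ 2)⁻¹ := by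
        refine le_trans ?_ (hN s (hNT.trans hs))
        rw [hE.step s (hT0.trans hs), hE.step s (hT0.trans hs), ← hE.sub]
        refine hE.abs_le (hT0.trans hs) fun g hg => ?_
        rw [kerL_first hd hg hsn, stepL_apply, stepL_apply, stepL_apply, ← savg_mul, ← savg_sub,
          abs_le]
        have hle : ∀ S ∈ (lowDegSet d g s).powersetCard m,
            |Q (attachStep g (s + 1) S) * kerL m d (s + 1) n h (attachStep g (s + 1) S) -
              Q g * kerL m d (s + 1) n h (attachStep g (s + 1) S)| ≤
            ind (CplxAt R (attachStep g (s + 1) S) (s + 1)) := by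
          intro S hS
          rw [Finset.mem_powersetCard] at hS
          have hk := kerL_mem_Icc hd (UAReachable.step (reach_le hg) hg hS.1 hS.2) hsn hh0 hh1
          by_cases hc : CplxAt R (attachStep g (s + 1) S) (s + 1)
          · rw [ind_pos hc, ← sub_mul, abs_mul, abs_of_nonneg hk.1]
            have h3 : |Q (attachStep g (s + 1) S) - Q g| ≤ 1 := by
              rw [abs_le]
              constructor <;> linarith [hQ0 g, hQ1 g, hQ0 (attachStep g (s + 1) S),
                hQ1 (attachStep g (s + 1) S)]
            exact mul_le_one₀ h3 hk.1 hk.2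
          · rw [ind_neg hc, hQ s g S hg hc, sub_self, abs_zero]
        constructor
        · rw [neg_le, ← neg_one_mul, ← savg_mul]
          exact savg_mono fun S hS hSc => by
            rw [neg_one_mul]
            exact (neg_le_abs _).trans (hle S (Finset.mem_powersetCard.2 ⟨hS, hSc⟩))
        · exact savg_mono fun S hS hSc =>
            (le_abs_self _).trans (hle S (Finset.mem_powersetCard.2 ⟨hS, hSc⟩))
      have hs2 : (2 : ℝ) ≤ s := by exact_mod_cast hT2.trans hs
      have h3 : ((s : ℝ) ^ 2)⁻¹ ≤ 1 / ((s : ℝ) - 1) - 1 / (((s + 1 : ℕ) : ℝ) - 1) := by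
        push_cast
        rw [add_sub_cancel_right, div_sub_div _ _ (by linarith) (by linarith), inv_eq_one_div,
          div_le_div_iff₀ (by positivity) (by nlinarith)]
        nlinarith
      have h4 := mul_le_mul_of_nonneg_left h3 hC
      have h5 := abs_sub_le (E (s + 1) (fun g => Q g * kerL m d (s + 1) n h g))
        (E s (fun g => Q g * kerL m d s n h g)) (E T (fun g => Q g * kerL m d T n h g))
      rw [mul_sub] at h1 h4 ⊢
      linarith
  have h1 := key n hn le_rfl
  rw [kerL_of_le le_rfl] at h1
  refine h1.trans ?_
  have hn2 : (2 : ℝ) ≤ n := by exact_mod_cast hT2.trans hn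
  rw [mul_sub, mul_one_div]
  have : 0 ≤ C * (1 / ((n : ℝ) - 1)) := mul_nonneg hC (div_nonneg zero_le_one (by linarith))
  linarith

section
variable {K : ℕ} {t : Fin K → ℕ} {U : ∀ j, SimpleGraph (Fin (t j))}

/-- The weighted number of maximal copies which are not induced. -/
noncomputable def dirtySum (U : ∀ j, SimpleGraph (Fin (t j))) (s : Fin K → ℝ) (g : SimpleGraph ℕ) :
    ℝ := ∑ j, s j * ((dirtyCopies g (U j)).ncard : ℝ)

lemma dirtySum_nonneg {s : Fin K → ℝ} (hs : ∀ j, 0 ≤ s j) (g : SimpleGraph ℕ) :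
    0 ≤ dirtySum U s g := Finset.sum_nonneg fun j _ => mul_nonneg (hs j) (Nat.cast_nonneg _)

lemma count_split (hU : ∀ j, IsUnicyclic (U j)) (s : Fin K → ℝ) {g : SimpleGraph ℕ}
    (hg : UAReachable m d n g) :
    ∑ j, s j * (unicyclicCount g (U j) : ℝ) = (cleanWeight U s).tot n g + dirtySum U s g := by
  simp only [unicyclicCount_split (hU _) hg, mul_add, Finset.sum_add_distrib]
  rw [dirtySum, Weight.tot]
  congr 1
  simp only [cleanWeight, Finset.mul_sum]
  exact Finset.sum_comm

lemma frozen_dirtySum (hU : ∀ j, IsUnicyclic (U j)) (s : Fin K → ℝ) (f : ℝ → ℝ) :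
    Frozen (∑ j, t j + 1) m d (fun g => f (dirtySum U s g)) := by
  intro n g S hg hn
  simp only [dirtySum]
  congr 1
  refine Finset.sum_congr rfl fun j _ => ?_
  rw [dirtyCopies_attach (hU j) hg (Nat.add_le_add_right
    (Finset.single_le_sum (f := t) (fun _ _ => Nat.zero_le _) (Finset.mem_univ j)) 1) hn]

lemma tendsto_div_sub_one (C : ℝ) : Tendsto (fun T : ℕ => C / ((T : ℝ) - 1)) atTop (𝓝 0) :=
  tendsto_const_nhds.div_atTop
    (tendsto_atTop_add_const_right atTop (-1) tendsto_natCast_atTop_atTop)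

/-- Convergence of the joint Laplace transforms of the counts. -/
lemma laplace_count_tendsto (hm : 2 ≤ m) (hd : 2 * m < d) (hU : ∀ j, IsUnicyclic (U j))
    (hUd : ∀ j, ¬ UnicyclicComplete (U j) d) {s : Fin K → ℝ} (hs : ∀ j, 0 ≤ s j)
    {T₀ : ℕ} (hE : Chain m d T₀ E) :
    ∃ Φ, Tendsto (fun n => E n (fun g => Real.exp (-∑ j, s j * (unicyclicCount g (U j) : ℝ))))
      atTop (𝓝 Φ) := by
  have hw := cleanWeight_isConn hU hUd hs
  obtain ⟨Φ, hΦ⟩ := hw.laplace_tendsto hm hd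
  obtain ⟨C, hC, hb⟩ := cplxAt_bound hm hd (∑ j, t j + 1)
  obtain ⟨N, hN⟩ := eventually_atTop.1 (hb T₀ E hE)
  set N₀ := max N (max T₀ 2) with hN₀
  have he : Tendsto (fun T : ℕ => C / (((T + N₀ : ℕ) : ℝ) - 1)) atTop (𝓝 0) :=
    (tendsto_div_sub_one C).comp (tendsto_add_atTop_nat N₀)
  have hZ := dirtySum_nonneg (U := U) hs
  have hY := hw.tot_nonneg
  refine (tendsto_of_approx
    (a := fun n => E n (fun g => Real.exp (-∑ j, s j * (unicyclicCount g (U j) : ℝ))))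
    (b := fun T n => E (T + N₀) (fun g => Real.exp (-dirtySum U s g) *
      kerL m d (T + N₀) n (fun g => Real.exp (-(cleanWeight U s).tot n g)) g))
    (p := fun T => E (T + N₀) (fun g => Real.exp (-dirtySum U s g) * Φ)) he
    (Eventually.of_forall fun T => ?_) (fun T => ?_)).imp fun _ h => h.1
  · filter_upwards [eventually_ge_atTop (T + N₀)] with n hn
    have hTn : T₀ ≤ n := by omega
    rw [hE.congr hTn (f' := fun g => Real.exp (-dirtySum U s g) *
      Real.exp (-(cleanWeight U s).tot n g)) fun g hg => by
        rw [count_split hU s hg, ← Real.exp_add]; congr 1; ring]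
    exact frozen_approx hd hE (frozen_dirtySum hU s (fun x => Real.exp (-x)))
      (fun g => (Real.exp_pos _).le) (fun g => Real.exp_le_one_iff.2 (neg_nonpos.2 (hZ g)))
      (fun g => (Real.exp_pos _).le) (fun g => Real.exp_le_one_iff.2 (neg_nonpos.2 (hY n g)))
      hC hN (by omega) (by omega) (by omega) hn
  · have hT : T₀ ≤ T + N₀ := by omega
    rw [hE.eq_sum hT]
    refine (tendsto_congr fun n => hE.eq_sum hT _).2 ?_
    refine tendsto_finsetSum _ fun g hg => Tendsto.mul_const _ (Tendsto.const_mul _ ?_)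
    exact hΦ _ _ (chain_evE hd (mem_reachSet.1 hg))

/-- Tightness of the counts. -/
lemma count_tight (hm : 2 ≤ m) (hd : 2 * m < d) (hU : ∀ j, IsUnicyclic (U j))
    (hUd : ∀ j, ¬ UnicyclicComplete (U j) d) {T₀ : ℕ} (hE : Chain m d T₀ E) {ε : ℝ} (hε : 0 < ε) :
    ∃ M : ℕ, ∀ᶠ n in atTop,
      E n (fun g => ind (∃ j, M ≤ unicyclicCount g (U j))) ≤ ε := by
  have hs : ∀ j : Fin K, (0 : ℝ) ≤ (fun _ => 1 : Fin K → ℝ) j := fun _ => zero_le_one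
  have hw := cleanWeight_isConn hU hUd hs
  obtain ⟨D, hD0, hD⟩ := hw.pow_bound hm hd hE 1
  obtain ⟨C, hC, hb⟩ := cplxAt_bound hm hd (∑ j, t j + 1)
  obtain ⟨N, hN⟩ := eventually_atTop.1 (hb T₀ E hE)
  obtain ⟨T, hTε, hT⟩ := (((tendsto_div_sub_one C).eventually (gt_mem_nhds (half_pos hε))).and
    (eventually_ge_atTop (max N (max T₀ 2)))).exists
  set Y := fun n g => (cleanWeight U fun _ => 1).tot n g with hYdef
  set Z := dirtySum U (fun _ => 1) with hZdef
  obtain ⟨M, hM⟩ := exists_nat_gt (∑ g ∈ reachSet m d T, Z g + 2 * D / ε)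
  have hZ0 : ∀ g, 0 ≤ Z g := dirtySum_nonneg hs
  have hsumZ : 0 ≤ ∑ g ∈ reachSet m d T, Z g := Finset.sum_nonneg fun g _ => hZ0 g
  have hDε : 0 ≤ 2 * D / ε := by positivity
  have hM0 : (0 : ℝ) < M := by linarith
  refine ⟨2 * M, ?_⟩
  filter_upwards [eventually_ge_atTop T] with n hn
  have hTn : T₀ ≤ n := by omega
  have h1 : E n (fun g => ind (∃ j, 2 * M ≤ unicyclicCount g (U j))) ≤
      E n (fun g => (M : ℝ)⁻¹ * Y n g ^ 1 + ind ((M : ℝ) ≤ Z g) * 1) := by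
    refine hE.mono n hTn _ _ fun g hg => ?_
    have hY0 : 0 ≤ Y n g := hw.tot_nonneg n g
    have hnn : 0 ≤ (M : ℝ)⁻¹ * Y n g ^ 1 := by positivity
    by_cases hj : ∃ j, 2 * M ≤ unicyclicCount g (U j)
    · rw [ind_pos hj, pow_one, mul_one]
      obtain ⟨j, hj⟩ := hj
      have h2 : (2 * M : ℝ) ≤ Y n g + Z g := by
        rw [hYdef, hZdef, ← count_split hU (fun _ => 1) hg]
        simp only [one_mul]
        refine le_trans (by exact_mod_cast hj) (Finset.single_le_sum
          (f := fun j => (unicyclicCount g (U j) : ℝ)) (fun _ _ => Nat.cast_nonneg _)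
          (Finset.mem_univ j))
      by_cases hz : (M : ℝ) ≤ Z g
      · rw [ind_pos hz]; rw [pow_one] at hnn; linarith
      · rw [ind_neg hz, add_zero, inv_mul_eq_div, le_div_iff₀ hM0]
        push Not at hz
        linarith
    · rw [ind_neg hj]
      have := ind_nonneg ((M : ℝ) ≤ Z g)
      linarith
  rw [hE.add, hE.mul] at h1
  have h2 := mul_le_mul_of_nonneg_left (hD n hTn) (inv_nonneg.2 hM0.le)
  have h3 : (M : ℝ)⁻¹ * D ≤ ε / 2 := by
    rw [inv_mul_eq_div, div_le_iff₀ hM0]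
    have : 2 * D / ε ≤ M := by linarith
    rw [div_le_iff₀ hε] at this
    linarith
  have h4 := frozen_approx hd hE (h := fun _ => 1)
    (frozen_dirtySum hU (fun _ => 1) (fun x => ind ((M : ℝ) ≤ x)))
    (fun g => ind_nonneg _) (fun g => ind_le_one _) (fun _ => zero_le_one) (fun _ => le_rfl) hC hN
    (by omega) (by omega) (by omega) hn
  have h5 : E T (fun g => ind ((M : ℝ) ≤ Z g) * kerL m d T n (fun _ => 1) g) = 0 := by
    rw [hE.congr (by omega) (f' := fun _ => 0), hE.const (by omega)]
    intro g hg
    rw [ind_neg, zero_mul]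
    have := Finset.single_le_sum (f := Z) (fun g _ => hZ0 g) (mem_reachSet.2 hg)
    intro h; linarith
  rw [h5, sub_zero] at h4
  have h6 := (le_abs_self _).trans h4
  linarith

end

end

section

/-- The indicator of a point of `ℕ` is a uniform limit of polynomials in `(1 / 2) ^ x`. -/
lemma exists_polynomial_near_ind (i : ℕ) {η : ℝ} (hη : 0 < η) :
    ∃ p : Polynomial ℝ, ∀ x : ℕ, |ind (x = i) - p.eval ((1 / 2 : ℝ) ^ x)| ≤ η := by
  have hτ : Continuous fun y : ℝ => max 0 (1 - 2 ^ (i + 1) * |y - (1 / 2) ^ i|) := by fun_prop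
  obtain ⟨p, hp⟩ := exists_polynomial_near_of_continuousOn 0 1 _ hτ.continuousOn η hη
  refine ⟨p, fun x => ?_⟩
  have h := hp ((1 / 2) ^ x) ⟨by positivity, pow_le_one₀ (by norm_num) (by norm_num)⟩
  rw [abs_sub_comm] at h
  refine le_trans (le_of_eq ?_) h.le
  congr 2
  by_cases hx : x = i
  · rw [ind_pos hx, hx, sub_self, abs_zero, mul_zero, sub_zero, max_eq_right zero_le_one]
  · rw [ind_neg hx, max_eq_left]
    have hpos : (0 : ℝ) < 2 ^ (i + 1) := by positivity
    have hi : (2 : ℝ) ^ (i + 1) * (1 / 2) ^ i = 2 := by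
      rw [pow_succ, one_div, inv_pow]; field_simp
    suffices 1 ≤ (2 : ℝ) ^ (i + 1) * |(1 / 2) ^ x - (1 / 2) ^ i| by linarith
    rw [← abs_of_pos hpos, ← abs_mul, mul_sub, hi]
    have hanti : ∀ a b : ℕ, a ≤ b → (1 / 2 : ℝ) ^ b ≤ (1 / 2) ^ a := fun a b hab =>
      pow_le_pow_of_le_one (by norm_num) (by norm_num) hab
    rcases lt_or_gt_of_ne hx with hlt | hlt
    · have h1 := mul_le_mul_of_nonneg_left (hanti (x + 1) i hlt) hpos.le
      rw [hi, pow_succ (1 / 2 : ℝ), ← mul_assoc] at h1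
      refine le_trans ?_ (le_abs_self _)
      linarith
    · have h1 := mul_le_mul_of_nonneg_left (hanti (i + 1) x hlt) hpos.le
      rw [pow_succ (1 / 2 : ℝ), ← mul_assoc, hi] at h1
      refine le_trans ?_ (neg_le_abs _)
      linarith

section
variable {m d T K : ℕ} {E : ℕ → (SimpleGraph ℕ → ℝ) →ₗ[ℝ] ℝ}
  {X : Fin K → SimpleGraph ℕ → ℕ}

/-- Convergence of the mixed moments of `(1 / 2) ^ X j` implies convergence in law. -/
lemma Chain.ind_tendsto (hE : Chain m d T E)
    (hX : ∀ l : Fin K → ℕ, ∃ Φ, Tendsto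
      (fun n => E n (fun g => ∏ j, ((1 / 2 : ℝ) ^ X j g) ^ l j)) atTop (𝓝 Φ)) (i : Fin K → ℕ) :
    ∃ Φ, Tendsto (fun n => E n (fun g => ind (∀ j, X j g = i j))) atTop (𝓝 Φ) := by
  have key : ∀ J : Finset (Fin K), ∀ l : Fin K → ℕ, ∃ Φ, Tendsto (fun n => E n (fun g =>
      ∏ j, if j ∈ J then ind (X j g = i j) else ((1 / 2 : ℝ) ^ X j g) ^ l j)) atTop (𝓝 Φ) := by
    intro J
    induction J using Finset.induction with
    | empty => simpa using hX
    | insert a J ha ih =>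
      intro l
      choose Φ hΦ using fun e => ih (Function.update l a e)
      choose p hp using fun s : ℕ =>
        exists_polynomial_near_ind (i a) (η := 1 / ((s : ℝ) + 1)) (by positivity)
      set R := fun g => ∏ j ∈ Finset.univ.erase a,
        if j ∈ J then ind (X j g = i j) else ((1 / 2 : ℝ) ^ X j g) ^ l j with hR
      have hR0 : ∀ g, 0 ≤ R g := fun g => Finset.prod_nonneg fun j _ => by
        split_ifs
        · exact ind_nonneg _
        · positivity
      have hR1 : ∀ g, R g ≤ 1 := fun g => Finset.prod_le_one
        (fun j _ => by
          split_ifs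
          · exact ind_nonneg _
          · positivity)
        (fun j _ => by
          split_ifs
          · exact ind_le_one _
          · exact pow_le_one₀ (by positivity) (pow_le_one₀ (by norm_num) (by norm_num)))
      have h1 : ∀ g, (∏ j, if j ∈ insert a J then ind (X j g = i j)
          else ((1 / 2 : ℝ) ^ X j g) ^ l j) = ind (X a g = i a) * R g := by
        intro g
        rw [← Finset.mul_prod_erase _ _ (Finset.mem_univ a), if_pos (Finset.mem_insert_self _ _)]
        congr 1
        refine Finset.prod_congr rfl fun j hj => ?_
        simp only [Finset.mem_insert, Finset.ne_of_mem_erase hj, false_or]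
      have h2 : ∀ e g, (∏ j, if j ∈ J then ind (X j g = i j)
          else ((1 / 2 : ℝ) ^ X j g) ^ Function.update l a e j) =
          ((1 / 2 : ℝ) ^ X a g) ^ e * R g := by
        intro e g
        rw [← Finset.mul_prod_erase _ _ (Finset.mem_univ a), if_neg ha, Function.update_self]
        congr 1
        refine Finset.prod_congr rfl fun j hj => ?_
        rw [Function.update_of_ne (Finset.ne_of_mem_erase hj)]
      simp only [h2] at hΦ
      simp only [h1]
      refine (tendsto_of_approx
        (b := fun s n => ∑ e ∈ Finset.range ((p s).natDegree + 1),
          (p s).coeff e * E n (fun g => ((1 / 2 : ℝ) ^ X a g) ^ e * R g))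
        (p := fun s => ∑ e ∈ Finset.range ((p s).natDegree + 1), (p s).coeff e * Φ e)
        tendsto_one_div_add_atTop_nhds_zero_nat
        (Eventually.of_forall fun s => ?_) (fun s => ?_)).imp fun _ h => h.1
      · filter_upwards [eventually_ge_atTop T] with n hn
        simp only [← hE.mul]
        rw [← hE.sum, ← hE.sub]
        have h3 := hE.abs_le hn (f' := fun _ => 1 / ((s : ℝ) + 1))
          (f := fun g => ind (X a g = i a) * R g - ∑ e ∈ Finset.range ((p s).natDegree + 1),
            (p s).coeff e * (((1 / 2 : ℝ) ^ X a g) ^ e * R g)) fun g _ => by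
          simp only [← mul_assoc]
          rw [← Finset.sum_mul, ← Polynomial.eval_eq_sum_range, ← sub_mul, abs_mul,
            abs_of_nonneg (hR0 g)]
          exact (mul_le_of_le_one_right (abs_nonneg _) (hR1 g)).trans (hp s _)
        rwa [hE.const hn] at h3
      · exact tendsto_finsetSum _ fun e _ => (hΦ e).const_mul _
  obtain ⟨Φ, hΦ⟩ := key Finset.univ 0
  refine ⟨Φ, hΦ.congr fun n => ?_⟩
  congr 1
  funext g
  simp only [Finset.mem_univ, if_true]
  by_cases h : ∀ j, X j g = i j
  · rw [ind_pos h, Finset.prod_eq_one fun j _ => ind_pos (h j)]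
  · rw [ind_neg h]
    push Not at h
    obtain ⟨j, hj⟩ := h
    exact Finset.prod_eq_zero (Finset.mem_univ j) (ind_neg hj)

/-- The limits of the point probabilities of a tight sequence sum to one. -/
lemma Chain.tsum_limit_eq_one (hE : Chain m d T E) {c : (Fin K → ℕ) → ℝ}
    (hc : ∀ i, Tendsto (fun n => E n (fun g => ind (∀ j, X j g = i j))) atTop (𝓝 (c i)))
    (htight : ∀ ε : ℝ, 0 < ε → ∃ M : ℕ, ∀ᶠ n in atTop,
      E n (fun g => ind (∃ j, M ≤ X j g)) ≤ ε) :
    (∀ i, 0 ≤ c i) ∧ ∑' i, c i = 1 := by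
  have hc0 : ∀ i, 0 ≤ c i := fun i => ge_of_tendsto (hc i) <| by
    filter_upwards [eventually_ge_atTop T] with n hn
    exact hE.nonneg hn fun g _ => ind_nonneg _
  have hsum : ∀ (F : Finset (Fin K → ℕ)) g,
      ∑ i ∈ F, ind (∀ j, X j g = i j) = ind ((fun j => X j g) ∈ F) := by
    intro F g
    simp only [ind, ← funext_iff (f := fun j => X j g), Finset.sum_ite_eq]
    congr
  have hF : ∀ F : Finset (Fin K → ℕ), Tendsto (fun n => E n (fun g => ind ((fun j => X j g) ∈ F)))
      atTop (𝓝 (∑ i ∈ F, c i)) := by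
    intro F
    simp only [← hsum, hE.sum]
    exact tendsto_finsetSum _ fun i _ => hc i
  have hle : ∀ F : Finset (Fin K → ℕ), ∑ i ∈ F, c i ≤ 1 := fun F => le_of_tendsto (hF F) <| by
    filter_upwards [eventually_ge_atTop T] with n hn
    calc E n (fun g => ind ((fun j => X j g) ∈ F)) ≤ E n (fun _ => 1) :=
          hE.mono n hn _ _ fun g _ => ind_le_one _
      _ = 1 := hE.const hn 1
  have hs : Summable c := summable_of_sum_le hc0 hle
  refine ⟨hc0, le_antisymm (hs.tsum_le_of_sum_le hle) (le_of_forall_pos_le_add fun ε hε => ?_)⟩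
  obtain ⟨M, hM⟩ := htight ε hε
  have h1 : 1 - ε ≤ ∑ i ∈ Fintype.piFinset fun _ : Fin K => Finset.range M, c i := by
    refine ge_of_tendsto (hF _) ?_
    filter_upwards [eventually_ge_atTop T, hM] with n hn hMn
    have h2 : E n (fun g => 1 - ind (∃ j, M ≤ X j g)) ≤
        E n (fun g => ind ((fun j => X j g) ∈ Fintype.piFinset fun _ : Fin K => Finset.range M)) := by
      refine hE.mono n hn _ _ fun g _ => ?_
      by_cases h : ∃ j, M ≤ X j g
      · rw [ind_pos h, sub_self]
        exact ind_nonneg _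
      · rw [ind_neg h, sub_zero, ind_pos]
        push Not at h
        simpa [Fintype.mem_piFinset] using h
    rw [hE.sub, hE.const hn] at h2
    linarith
  have h3 := hs.sum_le_tsum (Fintype.piFinset fun _ : Fin K => Finset.range M) fun i _ => hc0 i
  linarith

end

/-- The limit law of the counts of non-complete maximal unicyclic subgraphs. -/
lemma exists_limit_law {m d : ℕ} (hm : 2 ≤ m) (hd : 2 * m < d)
    {Ω : Type*} [MeasurableSpace Ω] {μ : Measure Ω} [IsProbabilityMeasure μ]
    {G : ℕ → Ω → SimpleGraph ℕ} (hG : IsUAProcess m d μ G)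
    {K : ℕ} {t : Fin K → ℕ} {U : ∀ j, SimpleGraph (Fin (t j))}
    (hU : ∀ j, IsUnicyclic (U j)) (hUd : ∀ j, ¬ UnicyclicComplete (U j) d) :
    ∃ c : (Fin K → ℕ) → ℝ, (∀ i, 0 ≤ c i) ∧
      (∀ i, Tendsto (fun n : ℕ =>
        (μ {ω | ∀ j, unicyclicCount (G n ω) (U j) = i j}).toReal) atTop (𝓝 (c i))) ∧
      ∑' i, c i = 1 := by
  have hE := chain_evE hd (UAReachable.init (m := m) (d := d))
  have hmom : ∀ l : Fin K → ℕ, ∃ Φ, Tendsto (fun n => evE m d m (initGraph m) n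
      (fun g => ∏ j, ((1 / 2 : ℝ) ^ unicyclicCount g (U j)) ^ l j)) atTop (𝓝 Φ) := by
    intro l
    obtain ⟨Φ, hΦ⟩ := laplace_count_tendsto hm hd hU hUd (s := fun j => l j * Real.log 2)
      (fun j => mul_nonneg (Nat.cast_nonneg _) (Real.log_nonneg one_le_two)) hE
    refine ⟨Φ, hΦ.congr fun n => ?_⟩
    congr 1
    funext g
    rw [← Finset.sum_neg_distrib, Real.exp_sum]
    refine Finset.prod_congr rfl fun j _ => ?_
    rw [← pow_mul, one_div, ← Real.exp_log (show (0 : ℝ) < 2⁻¹ by norm_num), Real.log_inv,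
      ← Real.exp_nat_mul]
    push_cast
    congr 1
    ring
  choose c hc using hE.ind_tendsto hmom
  obtain ⟨hc0, hc1⟩ := hE.tsum_limit_eq_one hc fun ε hε => count_tight hm hd hU hUd hE hε
  refine ⟨c, hc0, fun i => (hc i).congr' ?_, hc1⟩
  filter_upwards [eventually_ge_atTop m] with n hn
  rw [process_law hd hG hn (fun g => ∀ j, unicyclicCount g (U j) = i j), ENNReal.toReal_ofReal]
  · simp only [ite_eq_ind]
  · simp only [ite_eq_ind]
    exact hE.nonneg hn fun g _ => ind_nonneg _

end

end UA

/-- In the bounded-degree uniform attachment process with `m ≥ 2`, if `U_1, …, U_K` enumerate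
(up to isomorphism) the non-complete max-admissible unicyclic graphs of depth `k` containing
an `ℓ`-cycle, then for every tuple `(i_1, …, i_K)` of non-negative integers the probability
`P(N_{U_1}(n) = i_1, …, N_{U_K}(n) = i_K)` converges to a constant `c(i_1,…,i_K) ≥ 0`, and
these constants sum to `1`. -/
theorem uniform_attachment_unicyclic_limit_distribution
    (m d : ℕ) (hm : 2 ≤ m) (hd : 2 * m < d)
    {Ω : Type*} [MeasurableSpace Ω] (μ : Measure Ω) [IsProbabilityMeasure μ]
    (G : ℕ → Ω → SimpleGraph ℕ) (hG : IsUAProcess m d μ G)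
    (ℓ k K : ℕ) (tsize : Fin K → ℕ) (U : ∀ j : Fin K, SimpleGraph (Fin (tsize j)))
    (hU : ∀ j : Fin K, IsUnicyclic (U j) ∧ HasCycleOfLength (U j) ℓ ∧
      UnicyclicDepth (U j) k ∧ ¬ UnicyclicComplete (U j) d ∧
      MaxAdmissibleUnicyclic m d (U j))
    (hdistinct : ∀ j j' : Fin K, j ≠ j' → IsEmpty (U j ≃g U j'))
    (hcomplete : ∀ t' : ℕ, ∀ V : SimpleGraph (Fin t'),
      IsUnicyclic V → HasCycleOfLength V ℓ → UnicyclicDepth V k →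
      ¬ UnicyclicComplete V d → MaxAdmissibleUnicyclic m d V →
      ∃ j : Fin K, Nonempty (V ≃g U j)) :
    ∃ c : (Fin K → ℕ) → ℝ, (∀ i : Fin K → ℕ, 0 ≤ c i) ∧
      (∀ i : Fin K → ℕ,
        Tendsto (fun n : ℕ =>
            (μ {ω | ∀ j : Fin K, unicyclicCount (G n ω) (U j) = i j}).toReal)
          atTop (𝓝 (c i))) ∧
      (∑' i : Fin K → ℕ, c i) = 1 := by
  exact UA.exists_limit_law hm hd hG (fun j => (hU j).1) fun j => (hU j).2.2.2.1
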